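/- arXiv:math/0505501 — 2 statements merged into one kernel-verified Lean document; each statement's English description precedes it below -/
import Mathlib

section
/- Let C ⊆ ℝ³ be a regular strictly convex bounded domain, let K ⊆ ∂C be a nonempty connected compact set, and let ε > 0. Then there exists a complete conformal minimal immersion ψ : 𝔻 → C of the open unit disk 𝔻 into C that is proper in C and whose limit set ψ(∂𝔻) = closure(ψ(𝔻)) \ ψ(𝔻) is a nonempty compact set satisfying δ^H(ψ(∂𝔻), K) < ε. -/
open Set Metric Function

noncomputable section

/-- ℝ³, identified with `EuclideanSpace ℝ (Fin 3)`. -/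
abbrev R3 := EuclideanSpace ℝ (Fin 3)

/-- A real function on `ℂ ≃ ℝ²` is harmonic on a set if its Laplacian vanishes there. -/
def HarmOn (f : ℂ → ℝ) (Ω : Set ℂ) : Prop :=
  ∀ z ∈ Ω,
    fderiv ℝ (fun w => fderiv ℝ f w 1) z 1 +
      fderiv ℝ (fun w => fderiv ℝ f w Complex.I) z Complex.I = 0

/-- A conformal minimal immersion on an open set `Ω ⊆ ℂ`: a smooth map whose coordinate
functions are harmonic and whose real derivative at each point of `Ω` is a positive scalar
multiple of a linear isometry (hence injective and conformal). -/
def ConfMinImmOn (X : ℂ → R3) (Ω : Set ℂ) : Prop :=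
  ContDiffOn ℝ (⊤ : ℕ∞) X Ω ∧
  (∀ i : Fin 3, HarmOn (fun z => X z i) Ω) ∧
  ∀ z ∈ Ω, ∃ c : ℝ, 0 < c ∧ ∀ v : ℂ, ‖fderiv ℝ X z v‖ = c * ‖v‖

/-- A path `γ : [0,1) → Ω` that eventually leaves every compact subset of `Ω`. -/
def DivergentPath (Ω : Set ℂ) (γ : ℝ → ℂ) : Prop :=
  ContinuousOn γ (Ico 0 1) ∧ MapsTo γ (Ico 0 1) Ω ∧
  ∀ K : Set ℂ, IsCompact K → K ⊆ Ω →
    ∃ t₀ ∈ Ico (0:ℝ) 1, ∀ t ∈ Ico t₀ 1, γ t ∉ K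

/-- Completeness of an immersion `X` on `Ω`: every divergent path has image of infinite
total variation (length). -/
def CompleteOn (X : ℂ → R3) (Ω : Set ℂ) : Prop :=
  ∀ γ : ℝ → ℂ, DivergentPath Ω γ → eVariationOn (X ∘ γ) (Ico 0 1) = ⊤

/-- Properness of `ψ : Ω → D`: preimages of compact subsets of `D` are compact. -/
def ProperIn (ψ : ℂ → R3) (Ω : Set ℂ) (D : Set R3) : Prop :=
  ∀ K : Set R3, IsCompact K → K ⊆ D → IsCompact (Ω ∩ ψ ⁻¹' K)

/-- The limit set of a map on the open unit disk. -/
def limitSet (ψ : ℂ → R3) : Set R3 :=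
  closure (ψ '' ball (0:ℂ) 1) \ ψ '' ball (0:ℂ) 1

/-- A regular strictly convex bounded domain: a nonempty bounded convex open set satisfying
uniform interior and exterior sphere conditions. -/
def RegStrictConvexDomain (C : Set R3) : Prop :=
  C.Nonempty ∧ IsOpen C ∧ Convex ℝ C ∧ Bornology.IsBounded C ∧
  ∃ r R : ℝ, 0 < r ∧ r ≤ R ∧
    ∀ p ∈ frontier C,
      (∃ x, p ∈ sphere x r ∧ closedBall x r ⊆ closure C) ∧
      (∃ y, p ∈ sphere y R ∧ closure C ⊆ closedBall y R)

/-- `R` is a uniform exterior sphere radius for `E`. -/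
def ExtSphereRadius (E : Set R3) (R : ℝ) : Prop :=
  0 < R ∧ ∀ p ∈ frontier E, ∃ y, p ∈ sphere y R ∧ closure E ⊆ closedBall y R

/-- `γ : ℝ → ℝ³`, `1`-periodic, parametrizes a smooth Jordan curve: it is `C^∞`, injective on
a period, and has nowhere-vanishing derivative. -/
def SmoothJordan (γ : ℝ → R3) : Prop :=
  ContDiff ℝ (⊤ : ℕ∞) γ ∧ Periodic γ 1 ∧
  (∀ s ∈ Ico (0:ℝ) 1, ∀ t ∈ Ico (0:ℝ) 1, γ s = γ t → s = t) ∧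
  ∀ t, deriv γ t ≠ 0

/-- `p : ℝ → ℂ`, `1`-periodic, parametrizes a polygon: an injective piecewise-linear loop. -/
def PolygonParam (p : ℝ → ℂ) : Prop :=
  Continuous p ∧ Periodic p 1 ∧
  (∀ s ∈ Ico (0:ℝ) 1, ∀ t ∈ Ico (0:ℝ) 1, p s = p t → s = t) ∧
  ∃ n : ℕ, 0 < n ∧ ∀ k : ℕ, k < n → ∀ s ∈ Icc ((k:ℝ)/n) ((k+1)/n),
    p s = p (k/n) + (((s - k/n) * n) : ℝ) • (p ((k+1)/n) - p (k/n))

/-- The interior region of a polygon `P ⊆ ℂ`: the union of the bounded connected components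
of the complement of `P`. -/
def polyInt (P : Set ℂ) : Set ℂ :=
  {z | z ∉ P ∧ Bornology.IsBounded (connectedComponentIn Pᶜ z)}

/-- The intrinsic distance, induced by `X`, within `W` from a point `z` to a set `S`:
the infimum of the lengths (total variations) of `X ∘ α` over continuous paths `α` in `W`
joining `z` to `S`. -/
def intrinsicDist (X : ℂ → R3) (W : Set ℂ) (z : ℂ) (S : Set ℂ) : ENNReal :=
  ⨅ (α : ℝ → ℂ) (_ : ContinuousOn α (Icc 0 1)) (_ : MapsTo α (Icc 0 1) W)
    (_ : α 0 = z) (_ : α 1 ∈ S), eVariationOn (X ∘ α) (Icc 0 1)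

/-- Two `1`-periodic loops in `ℝ³` are freely homotopic within a set `T`. -/
def HomotopicLoopsIn (T : Set R3) (f g : ℝ → R3) : Prop :=
  ∃ H : ℝ × ℝ → R3, Continuous H ∧
    (∀ t, H (t, 0) = f t) ∧ (∀ t, H (t, 1) = g t) ∧
    (∀ t s, H (t + 1, s) = H (t, s)) ∧
    ∀ t s, s ∈ Icc (0:ℝ) 1 → H (t, s) ∈ T

/-- The inner parallel body `E₋ₜ` of a convex open set. -/
def innerParallel (E : Set R3) (t : ℝ) : Set R3 :=
  {x ∈ E | t < infDist x Eᶜ}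

/-! ### Spinor parametrization of null vectors -/

/-- The null vector in `ℂ³` with spinor coordinates `(a, b)`. -/
def nullVec (a b : ℂ) : Fin 3 → ℂ :=
  ![a ^ 2 - b ^ 2, Complex.I * (a ^ 2 + b ^ 2), 2 * a * b]

/-- Componentwise real part `ℂ³ → ℝ³`. -/
def reVec (ν : Fin 3 → ℂ) : R3 := WithLp.toLp 2 fun i => (ν i).re

@[simp] lemma reVec_apply (ν : Fin 3 → ℂ) (i : Fin 3) : reVec ν i = (ν i).re := rfl

lemma reVec_sub (ν μ : Fin 3 → ℂ) : reVec (ν - μ) = reVec ν - reVec μ := by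
  ext i; simp

lemma reVec_real_smul (t : ℝ) (ν : Fin 3 → ℂ) : reVec ((t : ℂ) • ν) = t • reVec ν := by
  ext i; simp

lemma norm_R3_sq (x : R3) : ‖x‖ ^ 2 = x 0 ^ 2 + x 1 ^ 2 + x 2 ^ 2 := by
  rw [EuclideanSpace.norm_sq_eq]; simp [Fin.sum_univ_three]

lemma inner_R3 (x y : R3) : inner ℝ x y = x 0 * y 0 + x 1 * y 1 + x 2 * y 2 := by
  rw [PiLp.inner_apply]
  simp only [Fin.sum_univ_three, RCLike.inner_apply, conj_trivial]
  ring

lemma norm_R3_le (x : R3) : ‖x‖ ≤ |x 0| + |x 1| + |x 2| := by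
  refine abs_le_of_sq_le_sq' ?_ (by positivity) |>.2
  rw [norm_R3_sq, ← sq_abs (x 0), ← sq_abs (x 1), ← sq_abs (x 2)]
  nlinarith [abs_nonneg (x 0), abs_nonneg (x 1), abs_nonneg (x 2),
    mul_nonneg (abs_nonneg (x 0)) (abs_nonneg (x 1)),
    mul_nonneg (abs_nonneg (x 0)) (abs_nonneg (x 2)),
    mul_nonneg (abs_nonneg (x 1)) (abs_nonneg (x 2))]

lemma norm_reVec_le (ν : Fin 3 → ℂ) : ‖reVec ν‖ ≤ ‖ν 0‖ + ‖ν 1‖ + ‖ν 2‖ := by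
  refine (norm_R3_le _).trans ?_
  gcongr <;> exact Complex.abs_re_le_norm _

lemma norm_reVec_le_of_forall {ν : Fin 3 → ℂ} {c : ℝ} (h : ∀ i, ‖ν i‖ ≤ c) :
    ‖reVec ν‖ ≤ 3 * c := by
  linarith [norm_reVec_le ν, h 0, h 1, h 2]

lemma nullVec_smul (c a b : ℂ) : nullVec (c * a) (c * b) = c ^ 2 • nullVec a b := by
  ext i; fin_cases i <;> simp [nullVec] <;> ring

lemma sum_nullVec_sq (a b : ℂ) :
    nullVec a b 0 ^ 2 + nullVec a b 1 ^ 2 + nullVec a b 2 ^ 2 = 0 := by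
  simp only [nullVec, Matrix.cons_val]
  linear_combination (a ^ 2 + b ^ 2) ^ 2 * Complex.I_sq

lemma norm_sq_eq_re_im (z : ℂ) : ‖z‖ ^ 2 = z.re ^ 2 + z.im ^ 2 := by
  rw [Complex.sq_norm, Complex.normSq_apply]; ring

lemma sum_norm_nullVec_sq (a b : ℂ) :
    ‖nullVec a b 0‖ ^ 2 + ‖nullVec a b 1‖ ^ 2 + ‖nullVec a b 2‖ ^ 2 =
      2 * (‖a‖ ^ 2 + ‖b‖ ^ 2) ^ 2 := by
  simp only [nullVec, Matrix.cons_val, norm_sq_eq_re_im]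
  simp [pow_two]
  ring

/-- A complex multiple of a null vector has real part of half the squared norm. -/
lemma norm_reVec_smul_sq {ν : Fin 3 → ℂ} (h : ν 0 ^ 2 + ν 1 ^ 2 + ν 2 ^ 2 = 0) (c : ℂ) :
    ‖reVec (c • ν)‖ ^ 2 = ‖c‖ ^ 2 * ((‖ν 0‖ ^ 2 + ‖ν 1‖ ^ 2 + ‖ν 2‖ ^ 2) / 2) := by
  have hr := congrArg Complex.re h
  have hi := congrArg Complex.im h
  simp [pow_two] at hr hi
  rw [norm_R3_sq]
  simp only [norm_sq_eq_re_im, reVec_apply, Pi.smul_apply, smul_eq_mul, Complex.mul_re]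
  linear_combination (c.re ^ 2 - c.im ^ 2) / 2 * hr - c.re * c.im * hi

lemma norm_reVec_smul_nullVec (c a b : ℂ) :
    ‖reVec (c • nullVec a b)‖ = ‖c‖ * (‖a‖ ^ 2 + ‖b‖ ^ 2) := by
  have h := norm_reVec_smul_sq (sum_nullVec_sq a b) c
  rw [sum_norm_nullVec_sq] at h
  rw [← sq_eq_sq₀ (norm_nonneg _) (by positivity), h]
  ring

lemma norm_nullVec_apply_le (a b : ℂ) (i : Fin 3) :
    ‖nullVec a b i‖ ≤ 2 * (‖a‖ ^ 2 + ‖b‖ ^ 2) := by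
  refine abs_le_of_sq_le_sq' ?_ (by positivity) |>.2
  have h := sum_norm_nullVec_sq a b
  have h0 := sq_nonneg ‖nullVec a b 0‖
  have h1 := sq_nonneg ‖nullVec a b 1‖
  have h2 := sq_nonneg ‖nullVec a b 2‖
  have h3 := sq_nonneg (‖a‖ ^ 2 + ‖b‖ ^ 2)
  fin_cases i <;> simp only [Fin.zero_eta, Fin.mk_one, Fin.reduceFinMk] <;> nlinarith

/-- Every null vector has spinor coordinates. -/
lemma exists_nullVec_eq {ν : Fin 3 → ℂ} (h : ν 0 ^ 2 + ν 1 ^ 2 + ν 2 ^ 2 = 0) :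
    ∃ a b, nullVec a b = ν := by
  obtain ⟨a, ha⟩ := IsAlgClosed.exists_pow_nat_eq ((ν 0 - Complex.I * ν 1) / 2) two_pos
  obtain ⟨b, hb⟩ := IsAlgClosed.exists_pow_nat_eq ((-ν 0 - Complex.I * ν 1) / 2) two_pos
  replace ha := ha.symm
  replace hb := hb.symm
  have hI := Complex.I_sq
  have hab : (2 * a * b) ^ 2 = ν 2 ^ 2 := by
    linear_combination (-4 * b ^ 2) * ha - (2 * (ν 0 - Complex.I * ν 1)) * hb - h + ν 1 ^ 2 * hI
  have key : ∀ b : ℂ, (-ν 0 - Complex.I * ν 1) / 2 = b ^ 2 → 2 * a * b = ν 2 →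
      nullVec a b = ν := by
    intro b hb h2
    ext i; fin_cases i
    · simp only [nullVec, Fin.zero_eta, Matrix.cons_val]; linear_combination hb - ha
    · simp only [nullVec, Fin.mk_one, Matrix.cons_val]
      linear_combination (-Complex.I) * ha - Complex.I * hb - ν 1 * hI
    · simpa [nullVec] using h2
  rcases sq_eq_sq_iff_eq_or_eq_neg.1 hab with h2 | h2
  · exact ⟨a, b, key b hb h2⟩
  · exact ⟨a, -b, key (-b) (by rw [hb]; ring) (by linear_combination -h2)⟩

/-- Every vector of `ℝ³` is the real part of a null vector. -/
lemma exists_reVec_nullVec_eq (e : R3) : ∃ a b, reVec (nullVec a b) = e := by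
  obtain ⟨f, hf, hn⟩ : ∃ f : R3, inner ℝ e f = 0 ∧ ‖f‖ ^ 2 = ‖e‖ ^ 2 := by
    by_cases h : e 0 ^ 2 + e 1 ^ 2 = 0
    · have h0 : e 0 = 0 := by nlinarith [sq_nonneg (e 0), sq_nonneg (e 1)]
      have h1 : e 1 = 0 := by nlinarith [sq_nonneg (e 0), sq_nonneg (e 1)]
      refine ⟨!₂[e 2, 0, 0], ?_, ?_⟩
      · rw [inner_R3]; simp [h0]
      · rw [norm_R3_sq, norm_R3_sq]; simp [h0, h1]
    · have hp : 0 < e 0 ^ 2 + e 1 ^ 2 := lt_of_le_of_ne (by positivity) (Ne.symm h)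
      set d := √(e 0 ^ 2 + e 1 ^ 2)
      have hd : d ^ 2 = e 0 ^ 2 + e 1 ^ 2 := Real.sq_sqrt hp.le
      have hd0 : d ≠ 0 := (Real.sqrt_pos.2 hp).ne'
      refine ⟨!₂[-(‖e‖ / d) * e 1, ‖e‖ / d * e 0, 0], ?_, ?_⟩
      · rw [inner_R3]; simp; ring
      · rw [norm_R3_sq]; simp
        field_simp
        linear_combination -(‖e‖ ^ 2) * hd
  rw [inner_R3] at hf
  rw [norm_R3_sq, norm_R3_sq] at hn
  obtain ⟨a, b, hab⟩ := exists_nullVec_eq (ν := fun i => (⟨e i, f i⟩ : ℂ)) (by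
    apply Complex.ext
    · simp [pow_two]; linarith
    · simp [pow_two]; linarith)
  exact ⟨a, b, by rw [hab]; ext i; rfl⟩

/-- If `(a, b)` is an eigenspinor of `x`, then its null vector is orthogonal to `x`. -/
lemma inner_reVec_eq_zero_of_eigen {x : R3} {n a b : ℂ}
    (h1 : -(x 2 : ℂ) * a + (x 0 - Complex.I * x 1) * b = n * a)
    (h2 : (x 0 + Complex.I * x 1) * a + x 2 * b = n * b) (c : ℂ) :
    inner ℝ (reVec (c • nullVec a b)) x = 0 := by
  have key : (x 0 : ℂ) * nullVec a b 0 + x 1 * nullVec a b 1 + x 2 * nullVec a b 2 = 0 := by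
    simp only [nullVec, Matrix.cons_val]
    linear_combination a * h2 - b * h1
  have := congrArg Complex.re (congrArg (c * ·) key)
  rw [inner_R3]
  simp only [reVec_apply, Pi.smul_apply, smul_eq_mul]
  simp at this ⊢
  linarith

/-! ### Polynomial null curves -/

section PolynomialNullCurves

open Polynomial

/-- The antiderivative of a polynomial vanishing at `0`. -/
def prim (p : ℂ[X]) : ℂ[X] := p.sum fun n a => C (a / (n + 1)) * X ^ (n + 1)

lemma derivative_prim (p : ℂ[X]) : derivative (prim p) = p := by
  conv_rhs => rw [← p.sum_C_mul_X_pow_eq]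
  simp only [prim, Polynomial.sum, derivative_sum]
  refine Finset.sum_congr rfl fun n _ => ?_
  have : (n + 1 : ℂ) ≠ 0 := by exact_mod_cast n.succ_ne_zero
  rw [derivative_C_mul_X_pow]
  push_cast
  rw [div_mul_cancel₀ _ this]

lemma eval_zero_prim (p : ℂ[X]) : (prim p).eval 0 = 0 := by
  simp [prim, Polynomial.sum, eval_finsetSum]

lemma eq_prim {p G : ℂ[X]} (h : derivative G = p) (h0 : G.eval 0 = 0) : prim p = G := by
  have hd : derivative (G - prim p) = 0 := by rw [derivative_sub, h, derivative_prim, sub_self]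
  obtain hC := eq_C_of_derivative_eq_zero hd
  have : (G - prim p).eval 0 = 0 := by rw [eval_sub, h0, eval_zero_prim, sub_self]
  rw [hC, eval_C] at this
  rw [this, C_0, sub_eq_zero] at hC
  exact hC.symm

lemma prim_add (p q : ℂ[X]) : prim (p + q) = prim p + prim q :=
  eq_prim (by simp [derivative_prim]) (by simp [eval_zero_prim])

lemma exists_bound_prim (p : ℂ[X]) :
    ∃ B : ℝ, 0 ≤ B ∧ ∀ (m : ℕ) (z : ℂ), ‖z‖ ≤ 1 → ‖(prim (X ^ m * p)).eval z‖ ≤ B / (m + 1) := by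
  induction p using Polynomial.induction_on' with
  | add p q hp hq =>
    obtain ⟨B, hB, h⟩ := hp
    obtain ⟨B', hB', h'⟩ := hq
    refine ⟨B + B', by positivity, fun m z hz => ?_⟩
    rw [mul_add, prim_add, eval_add, add_div]
    exact (norm_add_le _ _).trans (add_le_add (h m z hz) (h' m z hz))
  | monomial n a =>
    refine ⟨‖a‖, norm_nonneg a, fun m z hz => ?_⟩
    have hne : ((m : ℂ) + n + 1) ≠ 0 := by exact_mod_cast (m + n).succ_ne_zero
    have : prim (X ^ m * monomial n a) = C (a / (m + n + 1)) * X ^ (m + n + 1) := by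
      refine eq_prim ?_ (by simp)
      rw [derivative_C_mul_X_pow, ← C_mul_X_pow_eq_monomial]
      push_cast
      rw [div_mul_cancel₀ _ hne]
      ring
    rw [this, eval_mul, eval_C, eval_pow, eval_X, norm_mul, norm_div, norm_pow]
    have h1 : ‖(m : ℂ) + n + 1‖ = m + n + 1 := by
      have : ((m : ℂ) + n + 1) = ((m + n + 1 : ℝ) : ℂ) := by push_cast; rfl
      rw [this, Complex.norm_real, Real.norm_of_nonneg (by positivity)]
    rw [h1]
    calc ‖a‖ / (m + n + 1) * ‖z‖ ^ (m + n + 1) ≤ ‖a‖ / (m + n + 1) * 1 := by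
          gcongr; exact pow_le_one₀ (norm_nonneg z) hz
      _ ≤ ‖a‖ / (m + 1) := by
          rw [mul_one]; gcongr
          linarith [(Nat.cast_nonneg n : (0 : ℝ) ≤ n)]

/-- Polynomial version of `nullVec`. -/
def nullPoly (a b : ℂ[X]) : Fin 3 → ℂ[X] :=
  ![a ^ 2 - b ^ 2, C Complex.I * (a ^ 2 + b ^ 2), 2 * a * b]

lemma eval_nullPoly (a b : ℂ[X]) (i : Fin 3) (z : ℂ) :
    (nullPoly a b i).eval z = nullVec (a.eval z) (b.eval z) i := by
  fin_cases i <;> simp [nullPoly, nullVec]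

/-- A polynomial null immersion `F : ℂ → ℂ³` with spinor `(u, v)` without zeros. -/
structure NullCurve where
  /-- first spinor component -/
  u : ℂ[X]
  /-- second spinor component -/
  v : ℂ[X]
  /-- the curve -/
  F : Fin 3 → ℂ[X]
  ne : ∀ z, u.eval z ≠ 0 ∨ v.eval z ≠ 0
  deriv_F : ∀ i, derivative (F i) = nullPoly u v i

/-- The polynomial conformal minimal immersion given by the real part of a null curve. -/
def NullCurve.surf (S : NullCurve) (z : ℂ) : R3 := reVec fun i => (S.F i).eval z

/-- The conformal factor of the real part of a null curve. -/
def NullCurve.lam (S : NullCurve) (z : ℂ) : ℝ := ‖S.u.eval z‖ ^ 2 + ‖S.v.eval z‖ ^ 2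

lemma NullCurve.continuous_surf (S : NullCurve) : Continuous S.surf := by
  unfold NullCurve.surf reVec
  have : ∀ i, Continuous fun z => (S.F i).eval z := fun i => (S.F i).continuous
  fun_prop

lemma NullCurve.continuous_lam (S : NullCurve) : Continuous S.lam := by
  unfold NullCurve.lam
  have := S.u.continuous
  have := S.v.continuous
  fun_prop

lemma NullCurve.lam_pos (S : NullCurve) (z : ℂ) : 0 < S.lam z := by
  unfold NullCurve.lam
  rcases S.ne z with h | h
  · have := norm_pos_iff.2 h; positivity
  · have := norm_pos_iff.2 h; positivity

/-- Adding the rapidly oscillating spinor `α √(2n+3) zⁿ⁺¹ (P, Q)` to the spinor of a null curve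
adds, up to a small error, the term `α² z²ⁿ⁺³ nullVec P Q` to the curve. -/
lemma NullCurve.exists_oscillation (S : NullCurve) (P Q : ℂ[X]) (α : ℕ → ℂ)
    (hα : ∀ n, ‖α n‖ = 1)
    (hne : ∀ n z, S.u.eval z + α n * √(2 * n + 3) * z ^ (n + 1) * P.eval z ≠ 0 ∨
      S.v.eval z + α n * √(2 * n + 3) * z ^ (n + 1) * Q.eval z ≠ 0) :
    ∃ (T : ℕ → NullCurve) (B : ℝ), 0 ≤ B ∧ ∀ n z,
      (T n).u.eval z = S.u.eval z + α n * √(2 * n + 3) * z ^ (n + 1) * P.eval z ∧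
      (T n).v.eval z = S.v.eval z + α n * √(2 * n + 3) * z ^ (n + 1) * Q.eval z ∧
      ∀ i, ‖z‖ ≤ 1 → ‖((T n).F i).eval z - (S.F i).eval z -
        α n ^ 2 * z ^ (2 * n + 3) * nullVec (P.eval z) (Q.eval z) i‖ ≤ B / √(n + 1) := by
  let b : Fin 3 → ℂ[X] := ![S.u * P - S.v * Q, C Complex.I * (S.u * P + S.v * Q),
    S.u * Q + S.v * P]
  let κ : ℕ → ℂ := fun n => α n * √(2 * n + 3)
  have hκ : ∀ n, κ n ^ 2 = α n ^ 2 * (2 * n + 3) := by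
    intro n
    have : ((√(2 * n + 3) : ℝ) : ℂ) ^ 2 = (2 * n + 3 : ℂ) := by
      rw [← Complex.ofReal_pow, Real.sq_sqrt (by positivity)]; push_cast; rfl
    simp only [κ, mul_pow, this]
  let G := nullPoly P Q
  choose B1 hB1 hb1 using fun i => exists_bound_prim (b i)
  choose B2 hB2 hb2 using fun i => exists_bound_prim (derivative (G i))
  let T : ℕ → NullCurve := fun n =>
    { u := S.u + C (κ n) * X ^ (n + 1) * P
      v := S.v + C (κ n) * X ^ (n + 1) * Q
      F := fun i => S.F i + C (2 * κ n) * prim (X ^ (n + 1) * b i) +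
        C (α n ^ 2) * (X ^ (2 * n + 3) * G i - prim (X ^ (2 * n + 3) * derivative (G i)))
      ne := fun z => by simpa [κ, mul_assoc] using hne n z
      deriv_F := fun i => by
        have hC : C (α n ^ 2) * C ((2 * n + 3 : ℕ) : ℂ) = C (κ n) ^ 2 := by
          rw [← C_pow, hκ, ← C_mul]; push_cast; rfl
        have h2 : C (2 * κ n) = 2 * C (κ n) := by rw [C_mul, map_ofNat]
        have hp : (2 * n + 3 - 1) = 2 * (n + 1) := by omega
        have hd : derivative (X ^ (2 * n + 3) * G i) =
            C ((2 * n + 3 : ℕ) : ℂ) * X ^ (2 * (n + 1)) * G i +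
              X ^ (2 * n + 3) * derivative (G i) := by
          rw [derivative_mul, derivative_X_pow, hp]
        have hN : nullPoly (S.u + C (κ n) * X ^ (n + 1) * P) (S.v + C (κ n) * X ^ (n + 1) * Q) i =
            nullPoly S.u S.v i + 2 * C (κ n) * (X ^ (n + 1) * b i) +
              C (κ n) ^ 2 * (X ^ (2 * (n + 1)) * G i) := by
          fin_cases i <;> simp only [nullPoly, b, G, Fin.zero_eta, Fin.mk_one, Fin.reduceFinMk,
            Matrix.cons_val] <;> ring
        rw [derivative_add, derivative_add, derivative_C_mul, derivative_C_mul, derivative_sub,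
          derivative_prim, derivative_prim, S.deriv_F, hd, hN, h2, ← hC]
        ring }
  have hsum : ∀ (f : Fin 3 → ℝ), (∀ i, 0 ≤ f i) → ∀ i, f i ≤ ∑ j, f j := fun f hf i =>
    Finset.single_le_sum (fun j _ => hf j) (Finset.mem_univ i)
  refine ⟨T, 4 * ∑ i, B1 i + ∑ i, B2 i, ?_, fun n z => ⟨?_, ?_, fun i hz => ?_⟩⟩
  · have := Finset.sum_nonneg fun i (_ : i ∈ Finset.univ) => hB1 i
    have := Finset.sum_nonneg fun i (_ : i ∈ Finset.univ) => hB2 i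
    positivity
  · simp [T, κ]
  · simp [T, κ]
  · have hs : 0 < √((n : ℝ) + 1) := Real.sqrt_pos.2 (by positivity)
    have hs2 : √((n : ℝ) + 1) ^ 2 = n + 1 := Real.sq_sqrt (by positivity)
    have e : ((T n).F i).eval z - (S.F i).eval z -
        α n ^ 2 * z ^ (2 * n + 3) * nullVec (P.eval z) (Q.eval z) i =
        2 * κ n * (prim (X ^ (n + 1) * b i)).eval z -
        α n ^ 2 * (prim (X ^ (2 * n + 3) * derivative (G i))).eval z := by
      simp only [T, eval_add, eval_mul, eval_C, eval_sub, eval_pow, eval_X, G, eval_nullPoly]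
      ring
    have hκn : ‖κ n‖ ≤ 2 * √((n : ℝ) + 1) := by
      simp only [κ, norm_mul, hα, one_mul, Complex.norm_real, Real.norm_eq_abs,
        abs_of_nonneg (Real.sqrt_nonneg _)]
      rw [Real.sqrt_le_left (by positivity), mul_pow, hs2]
      linarith [(Nat.cast_nonneg n : (0 : ℝ) ≤ n)]
    rw [e]
    have h1 : ‖2 * κ n * (prim (X ^ (n + 1) * b i)).eval z‖ ≤ 4 * B1 i / √((n : ℝ) + 1) := by
      rw [norm_mul, norm_mul, Complex.norm_ofNat]
      calc 2 * ‖κ n‖ * ‖(prim (X ^ (n + 1) * b i)).eval z‖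
          ≤ 2 * (2 * √((n : ℝ) + 1)) * (B1 i / ((n + 1 : ℕ) + 1)) := by
            gcongr; exact hb1 i _ z hz
        _ ≤ 2 * (2 * √((n : ℝ) + 1)) * (B1 i / (n + 1)) := by
            have := hB1 i
            gcongr; linarith
        _ = 4 * B1 i / √((n : ℝ) + 1) := by
            generalize √((n : ℝ) + 1) = s at hs hs2
            rw [← hs2]; field_simp; ring
    have h2 : ‖α n ^ 2 * (prim (X ^ (2 * n + 3) * derivative (G i))).eval z‖ ≤
        B2 i / √((n : ℝ) + 1) := by
      rw [norm_mul, norm_pow, hα, one_pow, one_mul]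
      refine (hb2 i _ z hz).trans ?_
      have := hB2 i
      gcongr
      rw [Real.sqrt_le_left (by positivity)]
      push_cast
      nlinarith [(Nat.cast_nonneg n : (0 : ℝ) ≤ n)]
    refine (norm_sub_le _ _).trans ((add_le_add h1 h2).trans ?_)
    rw [← add_div]
    have := hsum B1 hB1 i
    have := hsum B2 hB2 i
    gcongr

end PolynomialNullCurves

/-! ### Approximation on the circle and lifting directions to spinors -/

section Circle

open Polynomial

lemma norm_eq_one_of_mem_sphere {ζ : ℂ} (h : ζ ∈ sphere (0 : ℂ) 1) : ‖ζ‖ = 1 := by simpa using h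

/-- Continuous functions on the circle are uniform limits of Laurent polynomials. -/
lemma exists_poly_approx {f : ℂ → ℂ} (hf : ContinuousOn f (sphere 0 1)) {ε : ℝ} (hε : 0 < ε) :
    ∃ (k : ℕ) (P : ℂ[X]), ∀ ζ ∈ sphere (0 : ℂ) 1, ‖P.eval ζ - ζ ^ k * f ζ‖ < ε := by
  have key : ∀ g : C(sphere (0 : ℂ) 1, ℂ), ∀ ε : ℝ, 0 < ε → ∃ (k : ℕ) (P : ℂ[X]),
      ∀ ζ : sphere (0 : ℂ) 1, ‖P.eval (ζ : ℂ) - (ζ : ℂ) ^ k * g ζ‖ < ε := by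
    intro g
    induction g using ContinuousMap.induction_on_of_compact with
    | const r => exact fun ε hε => ⟨0, C r, fun ζ => by simpa using hε⟩
    | id => exact fun ε hε => ⟨0, X, fun ζ => by simpa using hε⟩
    | star_id =>
      refine fun ε hε => ⟨1, 1, fun ζ => ?_⟩
      have : (ζ : ℂ) * (starRingEnd ℂ) ζ = 1 := by
        rw [Complex.mul_conj, Complex.normSq_eq_norm_sq, norm_eq_one_of_mem_sphere ζ.2]; simp
      simpa [this] using hε
    | add f g hf hg =>
      intro ε hε
      obtain ⟨k, P, hP⟩ := hf (ε / 2) (half_pos hε)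
      obtain ⟨l, Q, hQ⟩ := hg (ε / 2) (half_pos hε)
      refine ⟨k + l, X ^ l * P + X ^ k * Q, fun ζ => ?_⟩
      have e : (X ^ l * P + X ^ k * Q).eval (ζ : ℂ) - (ζ : ℂ) ^ (k + l) * (f + g) ζ =
          (ζ : ℂ) ^ l * (P.eval (ζ : ℂ) - (ζ : ℂ) ^ k * f ζ) +
          (ζ : ℂ) ^ k * (Q.eval (ζ : ℂ) - (ζ : ℂ) ^ l * g ζ) := by
        simp; ring
      rw [e]
      refine (norm_add_le _ _).trans_lt ?_
      rw [norm_mul, norm_mul, norm_pow, norm_pow, norm_eq_one_of_mem_sphere ζ.2]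
      linarith [hP ζ, hQ ζ, one_pow (M := ℝ) l, one_pow (M := ℝ) k, one_mul (1 : ℝ),
        (by simp : (1 : ℝ) ^ l * ‖P.eval (ζ : ℂ) - (ζ : ℂ) ^ k * f ζ‖ =
          ‖P.eval (ζ : ℂ) - (ζ : ℂ) ^ k * f ζ‖),
        (by simp : (1 : ℝ) ^ k * ‖Q.eval (ζ : ℂ) - (ζ : ℂ) ^ l * g ζ‖ =
          ‖Q.eval (ζ : ℂ) - (ζ : ℂ) ^ l * g ζ‖)]
    | mul f g hf hg =>
      intro ε hε
      have hD : 0 < ‖f‖ + ‖g‖ + 1 := by positivity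
      obtain ⟨k, P, hP⟩ := hf (ε / (‖f‖ + ‖g‖ + 1)) (by positivity)
      obtain ⟨l, Q, hQ⟩ := hg (min 1 (ε / (‖f‖ + ‖g‖ + 1))) (by positivity)
      refine ⟨k + l, P * Q, fun ζ => ?_⟩
      have hf' : ‖f ζ‖ ≤ ‖f‖ := f.norm_coe_le_norm ζ
      have hg' : ‖g ζ‖ ≤ ‖g‖ := g.norm_coe_le_norm ζ
      have hQ1 := (hQ ζ).trans_le (min_le_left _ _)
      have hQ2 := (hQ ζ).trans_le (min_le_right _ _)
      have hζ := norm_eq_one_of_mem_sphere ζ.2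
      have e : (P * Q).eval (ζ : ℂ) - (ζ : ℂ) ^ (k + l) * (f * g) ζ =
          (P.eval (ζ : ℂ) - (ζ : ℂ) ^ k * f ζ) * Q.eval (ζ : ℂ) +
          (ζ : ℂ) ^ k * f ζ * (Q.eval (ζ : ℂ) - (ζ : ℂ) ^ l * g ζ) := by
        simp; ring
      have hQn : ‖Q.eval (ζ : ℂ)‖ ≤ ‖g‖ + 1 := by
        have : Q.eval (ζ : ℂ) = (Q.eval (ζ : ℂ) - (ζ : ℂ) ^ l * g ζ) + (ζ : ℂ) ^ l * g ζ := by ring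
        rw [this]
        refine (norm_add_le _ _).trans ?_
        rw [norm_mul, norm_pow, hζ, one_pow, one_mul]
        linarith
      rw [e]
      refine (norm_add_le _ _).trans_lt ?_
      rw [norm_mul, norm_mul, norm_mul, norm_pow, hζ, one_pow, one_mul]
      set D := ‖f‖ + ‖g‖ + 1
      calc _ ≤ ‖P.eval (ζ : ℂ) - (ζ : ℂ) ^ k * f ζ‖ * (‖g‖ + 1) + ‖f‖ * (ε / D) := by gcongr
        _ < ε / D * (‖g‖ + 1) + ‖f‖ * (ε / D) := by
          have := mul_lt_mul_of_pos_right (hP ζ) (by positivity : 0 < ‖g‖ + 1)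
          linarith
        _ = ε / D * D := by simp only [D]; ring
        _ = ε := div_mul_cancel₀ _ hD.ne'
    | frequently f h =>
      intro ε hε
      obtain ⟨g, hg, hgf⟩ := (h.and_eventually (Metric.ball_mem_nhds f (half_pos hε))).exists
      obtain ⟨k, P, hP⟩ := hg (ε / 2) (half_pos hε)
      refine ⟨k, P, fun ζ => ?_⟩
      have h1 : ‖g ζ - f ζ‖ < ε / 2 := by
        rw [← dist_eq_norm]
        exact (ContinuousMap.dist_apply_le_dist ζ).trans_lt hgf
      have e : P.eval (ζ : ℂ) - (ζ : ℂ) ^ k * f ζ =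
          (P.eval (ζ : ℂ) - (ζ : ℂ) ^ k * g ζ) + (ζ : ℂ) ^ k * (g ζ - f ζ) := by ring
      rw [e]
      refine (norm_add_le _ _).trans_lt ?_
      rw [norm_mul, norm_pow, norm_eq_one_of_mem_sphere ζ.2, one_pow, one_mul]
      linarith [hP ζ]
  obtain ⟨k, P, hP⟩ := key ⟨(sphere (0 : ℂ) 1).domRestrict f, hf.domRestrict⟩ ε hε
  exact ⟨k, P, fun ζ hζ => hP ⟨ζ, hζ⟩⟩

lemma exists_poly_pair_approx {f g : ℂ → ℂ} (hf : ContinuousOn f (sphere 0 1))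
    (hg : ContinuousOn g (sphere 0 1)) {ε : ℝ} (hε : 0 < ε) :
    ∃ (k : ℕ) (P Q : ℂ[X]), ∀ ζ ∈ sphere (0 : ℂ) 1,
      ‖P.eval ζ - ζ ^ k * f ζ‖ < ε ∧ ‖Q.eval ζ - ζ ^ k * g ζ‖ < ε := by
  obtain ⟨k, P, hP⟩ := exists_poly_approx hf hε
  obtain ⟨l, Q, hQ⟩ := exists_poly_approx hg hε
  refine ⟨k + l, X ^ l * P, X ^ k * Q, fun ζ hζ => ⟨?_, ?_⟩⟩
  · have e : (X ^ l * P).eval ζ - ζ ^ (k + l) * f ζ = ζ ^ l * (P.eval ζ - ζ ^ k * f ζ) := by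
      simp; ring
    rw [e, norm_mul, norm_pow, norm_eq_one_of_mem_sphere hζ, one_pow, one_mul]
    exact hP ζ hζ
  · have e : (X ^ k * Q).eval ζ - ζ ^ (k + l) * g ζ = ζ ^ k * (Q.eval ζ - ζ ^ l * g ζ) := by
      simp; ring
    rw [e, norm_mul, norm_pow, norm_eq_one_of_mem_sphere hζ, one_pow, one_mul]
    exact hQ ζ hζ

/-- First component of the Hermitian matrix `|x| + M(x)` applied to `(a, b)`, where
`M(x)² = |x|²`. -/
def herm1 (x : R3) (a b : ℂ) : ℂ := ‖x‖ * a + (-(x 2 : ℂ) * a + (x 0 - Complex.I * x 1) * b)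

/-- Second component of the Hermitian matrix `|x| + M(x)` applied to `(a, b)`. -/
def herm2 (x : R3) (a b : ℂ) : ℂ := ‖x‖ * b + ((x 0 + Complex.I * x 1) * a + x 2 * b)

lemma norm_R3_sq_complex (x : R3) :
    (‖x‖ : ℂ) ^ 2 = (x 0 : ℂ) ^ 2 + (x 1 : ℂ) ^ 2 + (x 2 : ℂ) ^ 2 := by
  exact_mod_cast congrArg (fun t : ℝ => (t : ℂ)) (norm_R3_sq x)

lemma inner_reVec_herm (x : R3) (a b c d : ℂ) :
    inner ℝ (reVec (c • nullVec (d * herm1 x a b) (d * herm2 x a b))) x = 0 := by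
  refine inner_reVec_eq_zero_of_eigen (n := ‖x‖) ?_ ?_ c
  · simp only [herm1, herm2]
    linear_combination (-d * a) * norm_R3_sq_complex x - (d * a * x 1 ^ 2) * Complex.I_sq
  · simp only [herm1, herm2]
    linear_combination (-d * b) * norm_R3_sq_complex x - (d * b * x 1 ^ 2) * Complex.I_sq

/-- If the eigenspinor of `a` is killed by `|x| + M(x)` then `a` is a multiple of `x`. -/
lemma exists_smul_eq_of_herm_eq_zero {x e : R3} (hx : x ≠ 0) (he : e 2 < 0)
    (h1 : herm1 x (‖e‖ - e 2) (e 0 + Complex.I * e 1) = 0)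
    (h2 : herm2 x (‖e‖ - e 2) (e 0 + Complex.I * e 1) = 0) : ∃ s : ℝ, s • x = e := by
  have hxn : ‖x‖ ≠ 0 := norm_ne_zero_iff.2 hx
  set a : ℂ := ‖e‖ - e 2 with ha
  set b : ℂ := e 0 + Complex.I * e 1 with hb
  have ha0 : a ≠ 0 := by
    have : a = ((‖e‖ - e 2 : ℝ) : ℂ) := by simp [ha]
    rw [this, Complex.ofReal_ne_zero]
    linarith [norm_nonneg e]
  have hn := norm_R3_sq_complex e
  have k1 : -(e 2 : ℂ) * a + (e 0 - Complex.I * e 1) * b = ‖e‖ * a := by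
    rw [ha, hb]; linear_combination -hn - (e 1 : ℂ) ^ 2 * Complex.I_sq
  have k2 : (e 0 + Complex.I * e 1) * a + e 2 * b = ‖e‖ * b := by
    rw [ha, hb]; ring
  let y : R3 := ‖x‖ • e + ‖e‖ • x
  have y1 : -(y 2 : ℂ) * a + (y 0 - Complex.I * y 1) * b = 0 := by
    simp only [y, PiLp.add_apply, PiLp.smul_apply, smul_eq_mul, Complex.ofReal_add,
      Complex.ofReal_mul]
    simp only [herm1] at h1
    linear_combination ‖x‖ * k1 + ‖e‖ * h1
  have y2 : (y 0 + Complex.I * y 1) * a + y 2 * b = 0 := by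
    simp only [y, PiLp.add_apply, PiLp.smul_apply, smul_eq_mul, Complex.ofReal_add,
      Complex.ofReal_mul]
    simp only [herm2] at h2
    linear_combination ‖x‖ * k2 + ‖e‖ * h2
  have hy : (‖y‖ : ℂ) ^ 2 * a = 0 := by
    rw [norm_R3_sq_complex]
    linear_combination (-(y 2 : ℂ)) * y1 + (y 0 - Complex.I * y 1) * y2 +
      (a * y 1 ^ 2) * Complex.I_sq
  have hy0 : y = 0 := by
    rcases mul_eq_zero.1 hy with h | h
    · have := pow_eq_zero_iff two_ne_zero |>.1 h
      exact norm_eq_zero.1 (by exact_mod_cast this)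
    · exact absurd h ha0
  refine ⟨-(‖e‖ / ‖x‖), ?_⟩
  have : ‖x‖ • e = -(‖e‖ • x) := eq_neg_of_add_eq_zero_left hy0
  rw [neg_smul, div_eq_inv_mul, mul_smul, ← smul_neg, ← this, inv_smul_smul₀ hxn]

/-- A continuous field of directions along the circle can be approximated so that the orthogonal
planes are spanned by a continuous field of null vectors. -/
lemma exists_orthogonal_spinor {w : ℂ → R3} (hw : ContinuousOn w (sphere 0 1))
    (hw1 : ∀ ζ ∈ sphere (0 : ℂ) 1, ‖w ζ‖ = 1) {θ : ℝ} (hθ : 0 < θ) :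
    ∃ q₁ q₂ : ℂ → ℂ, ContinuousOn q₁ (sphere 0 1) ∧ ContinuousOn q₂ (sphere 0 1) ∧
      ∀ ζ ∈ sphere (0 : ℂ) 1, ‖q₁ ζ‖ ^ 2 + ‖q₂ ζ‖ ^ 2 = 1 ∧
        ∀ φ : ℂ, ‖φ‖ ≤ 1 → |inner ℝ (reVec (φ • nullVec (q₁ ζ) (q₂ ζ))) (w ζ)| ≤ θ := by
  set η := min (θ / 3) (1 / 6) with hη
  have hηp : 0 < η := by positivity
  have hc : ∀ i, ContinuousOn (fun ζ => ((w ζ i : ℝ) : ℂ)) (sphere 0 1) := fun i => by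
    have : Continuous fun x : R3 => ((x i : ℝ) : ℂ) := by fun_prop
    exact this.comp_continuousOn hw
  choose k P hP using fun i => exists_poly_approx (hc i) hηp
  let W : ℂ → R3 := fun ζ => WithLp.toLp 2 fun i =>
    ((starRingEnd ℂ ζ) ^ k i * (P i).eval ζ).re
  have hWc : Continuous W := by
    have : ∀ i, Continuous fun z => (P i).eval z := fun i => (P i).continuous
    have : Continuous fun z : ℂ => starRingEnd ℂ z := Complex.continuous_conj
    fun_prop
  have hWw : ∀ ζ ∈ sphere (0 : ℂ) 1, ‖W ζ - w ζ‖ ≤ 3 * η := by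
    intro ζ hζ
    have hi : ∀ i, |(W ζ - w ζ) i| ≤ η := by
      intro i
      have hconj : (starRingEnd ℂ ζ) ^ k i * ζ ^ k i = 1 := by
        rw [← mul_pow, mul_comm, Complex.mul_conj, Complex.normSq_eq_norm_sq,
          norm_eq_one_of_mem_sphere hζ]; simp
      have e : (W ζ - w ζ) i =
          ((starRingEnd ℂ ζ) ^ k i * ((P i).eval ζ - ζ ^ k i * (w ζ i : ℝ))).re := by
        rw [mul_sub, ← mul_assoc, hconj]
        simp [W]
      rw [e]
      refine (Complex.abs_re_le_norm _).trans ?_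
      rw [norm_mul, norm_pow, Complex.norm_conj, norm_eq_one_of_mem_sphere hζ, one_pow, one_mul]
      exact (hP i ζ hζ).le
    linarith [norm_R3_le (W ζ - w ζ), hi 0, hi 1, hi 2]
  have hW0 : ∀ ζ ∈ sphere (0 : ℂ) 1, W ζ ≠ 0 := by
    intro ζ hζ h0
    have := hWw ζ hζ
    rw [h0, zero_sub, norm_neg, hw1 ζ hζ] at this
    linarith [min_le_right (θ / 3) (1 / 6 : ℝ)]
  have hsm : ContDiff ℝ 1 fun p : ℝ × ℝ => p.1 • W (Complex.exp (p.2 * Complex.I)) := by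
    refine contDiff_fst.smul ?_
    rw [contDiff_euclidean]
    intro i
    have h1 : ContDiff ℝ 1 fun p : ℝ × ℝ => Complex.exp ((p.2 : ℂ) * Complex.I) :=
      ((Complex.ofRealCLM.contDiff.comp contDiff_snd).mul contDiff_const).cexp
    have h2 : ContDiff ℝ 1 fun z : ℂ => (P i).eval z :=
      ((P i).differentiable (𝕜 := ℂ)).contDiff.restrict_scalars ℝ
    have h3 : ContDiff ℝ 1 fun z : ℂ => (starRingEnd ℂ) z := Complex.conjCLE.contDiff
    exact Complex.reCLM.contDiff.comp (((h3.comp h1).pow (k i)).mul (h2.comp h1))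
  have hdense : Dense (range fun p : ℝ × ℝ => p.1 • W (Complex.exp (p.2 * Complex.I)))ᶜ :=
    hsm.dense_compl_range_of_finrank_lt_finrank (by simp)
  obtain ⟨e, he2, he⟩ := hdense.inter_open_nonempty {x : R3 | x 2 < 0}
    (isOpen_lt (by fun_prop) continuous_const) ⟨EuclideanSpace.single 2 (-1), by simp⟩
  let a : ℂ := ‖e‖ - e 2
  let b : ℂ := e 0 + Complex.I * e 1
  let N : ℂ → ℝ := fun ζ => √(‖herm1 (W ζ) a b‖ ^ 2 + ‖herm2 (W ζ) a b‖ ^ 2)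
  have h1c : Continuous fun ζ => herm1 (W ζ) a b := by unfold herm1; fun_prop
  have h2c : Continuous fun ζ => herm2 (W ζ) a b := by unfold herm2; fun_prop
  have hNc : Continuous N := by fun_prop
  have hN0 : ∀ ζ ∈ sphere (0 : ℂ) 1, 0 < ‖herm1 (W ζ) a b‖ ^ 2 + ‖herm2 (W ζ) a b‖ ^ 2 := by
    intro ζ hζ
    by_contra hcon
    have h1 : ‖herm1 (W ζ) a b‖ = 0 := by
      nlinarith [sq_nonneg ‖herm1 (W ζ) a b‖, sq_nonneg ‖herm2 (W ζ) a b‖]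
    have h2 : ‖herm2 (W ζ) a b‖ = 0 := by
      nlinarith [sq_nonneg ‖herm1 (W ζ) a b‖, sq_nonneg ‖herm2 (W ζ) a b‖]
    obtain ⟨s, hs⟩ := exists_smul_eq_of_herm_eq_zero (hW0 ζ hζ) he2
      (norm_eq_zero.1 h1) (norm_eq_zero.1 h2)
    obtain ⟨t, ht⟩ : ∃ t : ℝ, Complex.exp (t * Complex.I) = ζ := by
      refine ⟨ζ.arg, ?_⟩
      have := Complex.norm_mul_exp_arg_mul_I ζ
      rwa [norm_eq_one_of_mem_sphere hζ, Complex.ofReal_one, one_mul] at this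
    exact he ⟨(s, t), by simp only [ht]; exact hs⟩
  refine ⟨fun ζ => ((N ζ)⁻¹ : ℝ) * herm1 (W ζ) a b, fun ζ => ((N ζ)⁻¹ : ℝ) * herm2 (W ζ) a b,
    ?_, ?_, fun ζ hζ => ?_⟩
  · refine ContinuousOn.mul (Complex.continuous_ofReal.comp_continuousOn
      (hNc.continuousOn.inv₀ fun ζ hζ => (Real.sqrt_pos.2 (hN0 ζ hζ)).ne')) h1c.continuousOn
  · refine ContinuousOn.mul (Complex.continuous_ofReal.comp_continuousOn
      (hNc.continuousOn.inv₀ fun ζ hζ => (Real.sqrt_pos.2 (hN0 ζ hζ)).ne')) h2c.continuousOn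
  · have hu : ‖((N ζ)⁻¹ : ℝ) * herm1 (W ζ) a b‖ ^ 2 + ‖((N ζ)⁻¹ : ℝ) * herm2 (W ζ) a b‖ ^ 2 = 1 := by
      rw [norm_mul, norm_mul, Complex.norm_real, mul_pow, mul_pow, Real.norm_eq_abs, sq_abs,
        ← mul_add, inv_pow, Real.sq_sqrt (hN0 ζ hζ).le, inv_mul_cancel₀ (hN0 ζ hζ).ne']
    refine ⟨hu, fun φ hφ => ?_⟩
    have h0 := inner_reVec_herm (W ζ) a b φ ((N ζ)⁻¹ : ℝ)
    set E := reVec (φ • nullVec (((N ζ)⁻¹ : ℝ) * herm1 (W ζ) a b) (((N ζ)⁻¹ : ℝ) * herm2 (W ζ) a b))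
    have hE : ‖E‖ ≤ 1 := by
      rw [norm_reVec_smul_nullVec, hu, mul_one]; exact hφ
    have : inner ℝ E (w ζ) = -inner ℝ E (W ζ - w ζ) := by rw [inner_sub_right, h0]; ring
    rw [this, abs_neg]
    calc _ ≤ ‖E‖ * ‖W ζ - w ζ‖ := abs_real_inner_le_norm _ _
      _ ≤ 1 * (3 * η) := by gcongr; exact hWw ζ hζ
      _ ≤ θ := by linarith [min_le_left (θ / 3) (1 / 6 : ℝ)]

end Circle

/-! ### Generic perturbations, crossing lengths, and the basic deformation -/

section Deformation

open Polynomial Filter Topology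

lemma exists_mem_ball_notMem_of_countable {s : Set ℂ} (hs : s.Countable) {δ : ℝ} (hδ : 0 < δ) :
    ∃ c : ℂ, ‖c‖ < δ ∧ c ∉ s := by
  obtain ⟨c, hc, hcs⟩ := (hs.dense_compl ℝ).inter_open_nonempty (ball (0 : ℂ) δ) isOpen_ball
    ⟨0, mem_ball_self hδ⟩
  exact ⟨c, by simpa using hc, hcs⟩

/-- A small generic perturbation makes a sequence of spinors zero free. -/
lemma exists_generic_perturbation {u v : ℂ[X]} (P Q : ℂ[X])
    (ne : ∀ z, u.eval z ≠ 0 ∨ v.eval z ≠ 0) {κ : ℕ → ℂ} (hκ : ∀ n, κ n ≠ 0) {δ : ℝ}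
    (hδ : 0 < δ) :
    ∃ c₁ c₂ : ℂ, ‖c₁‖ < δ ∧ ‖c₂‖ < δ ∧ ∀ n z,
      u.eval z + κ n * z ^ (n + 1) * (P.eval z + c₁) ≠ 0 ∨
      v.eval z + κ n * z ^ (n + 1) * (Q.eval z + c₂) ≠ 0 := by
  let A : ℕ → ℂ → ℂ[X] := fun n c => u + C (κ n) * X ^ (n + 1) * (P + C c)
  have hA : ∀ n c z, (A n c).eval z = u.eval z + κ n * z ^ (n + 1) * (P.eval z + c) := by
    intro n c z; simp [A]
  have h1 : (⋃ n, {c | A n c = 0}).Countable := by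
    refine countable_iUnion fun n => Set.Subsingleton.countable fun c hc c' hc' => ?_
    have h : A n c - A n c' = 0 := by rw [hc, hc', sub_zero]
    have := congrArg (Polynomial.eval 1) h
    simp only [eval_sub, hA, eval_zero, one_pow, mul_one] at this
    have h' : κ n * (c - c') = 0 := by linear_combination this
    exact sub_eq_zero.1 ((mul_eq_zero.1 h').resolve_left (hκ n))
  obtain ⟨c₁, hc₁, hc₁'⟩ := exists_mem_ball_notMem_of_countable h1 hδ
  have h2 : (⋃ n, ⋃ z ∈ (A n c₁).roots.toFinset,
      {c : ℂ | v.eval z + κ n * z ^ (n + 1) * (Q.eval z + c) = 0 ∧ z ≠ 0}).Countable := by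
    refine countable_iUnion fun n => Set.Countable.biUnion (Finset.countable_toSet _)
      fun z _ => Set.Subsingleton.countable fun c hc c' hc' => ?_
    have h' : κ n * z ^ (n + 1) * (c - c') = 0 := by linear_combination hc.1 - hc'.1
    exact sub_eq_zero.1 ((mul_eq_zero.1 h').resolve_left
      (mul_ne_zero (hκ n) (pow_ne_zero _ hc.2)))
  obtain ⟨c₂, hc₂, hc₂'⟩ := exists_mem_ball_notMem_of_countable h2 hδ
  refine ⟨c₁, c₂, hc₁, hc₂, fun n z => ?_⟩
  by_contra! hcon
  rcases eq_or_ne z 0 with rfl | hz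
  · simpa using (ne 0).imp (fun h => h (by simpa using hcon.1)) (fun h => h (by simpa using hcon.2))
  · refine hc₂' (mem_iUnion.2 ⟨n, mem_iUnion₂.2 ⟨z, ?_, hcon.2, hz⟩⟩)
    rw [Multiset.mem_toFinset, mem_roots']
    refine ⟨fun h0 => hc₁' (mem_iUnion.2 ⟨n, h0⟩), ?_⟩
    rw [IsRoot, hA]
    exact hcon.1

/-- `Cross l r r' L`: the conformal factor `l` is, on finitely many consecutive annuli between
radii `r` and `r'`, so large that crossing all of them costs length at least `L`. -/
inductive Cross (l : ℂ → ℝ) (r : ℝ) : ℝ → ℝ → Prop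
  | refl : Cross l r r 0
  | skip {a b L : ℝ} : Cross l r a L → a ≤ b → Cross l r b L
  | mono {a L L' : ℝ} : Cross l r a L → L' ≤ L → Cross l r a L'
  | step {a b L M gap : ℝ} : Cross l r a L → a ≤ b → 0 ≤ M → 0 < gap →
      (∀ z : ℂ, a ≤ ‖z‖ → ‖z‖ ≤ b → M + gap ≤ l z) → Cross l r b (L + M * (b - a))

lemma Cross.le {l : ℂ → ℝ} {r r' L : ℝ} (h : Cross l r r' L) : r ≤ r' := by
  induction h with
  | refl => exact le_rfl
  | skip _ hab ih => exact ih.trans hab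
  | mono _ _ ih => exact ih
  | step _ hab _ _ _ ih => exact ih.trans hab

lemma Cross.trans {l : ℂ → ℝ} {r s t L L' : ℝ} (h : Cross l r s L) (h' : Cross l s t L') :
    Cross l r t (L + L') := by
  induction h' with
  | refl => rwa [add_zero]
  | skip _ hab ih => exact ih.skip hab
  | mono _ hL ih => exact ih.mono (by linarith)
  | step _ hab hM hgap hl ih => rw [← add_assoc]; exact ih.step hab hM hgap hl

lemma Cross.robust {l : ℂ → ℝ} {r r' L : ℝ} (h : Cross l r r' L) :
    ∃ τ > 0, ∀ l' : ℂ → ℝ, (∀ z, ‖z‖ ≤ r' → l z - τ ≤ l' z) → Cross l' r r' L := by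
  induction h with
  | refl => exact ⟨1, one_pos, fun _ _ => .refl⟩
  | skip _ hab ih =>
    obtain ⟨τ, hτ, H⟩ := ih
    exact ⟨τ, hτ, fun l' hl' => (H l' fun z hz => hl' z (hz.trans hab)).skip hab⟩
  | mono _ hL ih =>
    obtain ⟨τ, hτ, H⟩ := ih
    exact ⟨τ, hτ, fun l' hl' => (H l' hl').mono hL⟩
  | step _ hab hM hgap hl ih =>
    obtain ⟨τ, hτ, H⟩ := ih
    rename_i gap _
    refine ⟨min τ (gap / 2), by positivity, fun l' hl' => ?_⟩
    refine (H l' fun z hz => ?_).step hab hM (half_pos hgap) fun z hz hz' => ?_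
    · linarith [hl' z (hz.trans hab), min_le_left τ (gap / 2)]
    · linarith [hl' z hz', min_le_right τ (gap / 2), hl z hz hz']

/-- Closeness of two null curves and their conformal factors on a closed disc. -/
def NullCurve.Near (S S' : NullCurve) (r τ : ℝ) : Prop :=
  ∀ z : ℂ, ‖z‖ ≤ r → (∀ i, ‖(S'.F i).eval z - (S.F i).eval z‖ ≤ τ) ∧ |S'.lam z - S.lam z| ≤ τ

lemma NullCurve.Near.refl (S : NullCurve) (r : ℝ) : S.Near S r 0 := fun z _ => by simp

lemma NullCurve.Near.mono {S S' : NullCurve} {r r' τ τ' : ℝ} (h : S.Near S' r τ) (hr : r' ≤ r)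
    (hτ : τ ≤ τ') : S.Near S' r' τ' := fun z hz =>
  ⟨fun i => ((h z (hz.trans hr)).1 i).trans hτ, (h z (hz.trans hr)).2.trans hτ⟩

lemma NullCurve.Near.trans {S S' S'' : NullCurve} {r τ τ' : ℝ} (h : S.Near S' r τ)
    (h' : S'.Near S'' r τ') : S.Near S'' r (τ + τ') := fun z hz => by
  refine ⟨fun i => ?_, ?_⟩
  · have := norm_sub_le_norm_sub_add_norm_sub ((S''.F i).eval z) ((S'.F i).eval z) ((S.F i).eval z)
    linarith [(h z hz).1 i, (h' z hz).1 i]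
  · have := abs_sub_le (S''.lam z) (S'.lam z) (S.lam z)
    linarith [(h z hz).2, (h' z hz).2]

lemma NullCurve.norm_surf_sub_le {S S' : NullCurve} {z : ℂ} {τ : ℝ}
    (h : ∀ i, ‖(S'.F i).eval z - (S.F i).eval z‖ ≤ τ) : ‖S'.surf z - S.surf z‖ ≤ 3 * τ := by
  rw [NullCurve.surf, NullCurve.surf, ← reVec_sub]
  exact norm_reVec_le_of_forall h

lemma norm_nullVec_sub_le {a b a' b' : ℂ} {B δ : ℝ} (ha' : ‖a'‖ ≤ B) (hb' : ‖b'‖ ≤ B)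
    (ha : ‖a - a'‖ ≤ δ) (hb : ‖b - b'‖ ≤ δ) (i : Fin 3) :
    ‖nullVec a b i - nullVec a' b' i‖ ≤ 2 * δ * (2 * B + δ) := by
  have hδ : 0 ≤ δ := (norm_nonneg _).trans ha
  have hB : 0 ≤ B := (norm_nonneg _).trans ha'
  have ha1 : ‖a‖ ≤ B + δ := by linarith [norm_le_norm_add_norm_sub' a a']
  have hb1 : ‖b‖ ≤ B + δ := by linarith [norm_le_norm_add_norm_sub' b b']
  have h1 : ‖(a - a') * (a + a')‖ ≤ δ * (2 * B + δ) := by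
    rw [norm_mul]; gcongr; linarith [norm_add_le a a']
  have h2 : ‖(b - b') * (b + b')‖ ≤ δ * (2 * B + δ) := by
    rw [norm_mul]; gcongr; linarith [norm_add_le b b']
  fin_cases i
  · have e : nullVec a b 0 - nullVec a' b' 0 = (a - a') * (a + a') - (b - b') * (b + b') := by
      simp [nullVec]; ring
    change ‖nullVec a b 0 - nullVec a' b' 0‖ ≤ _
    rw [e]
    linarith [norm_sub_le ((a - a') * (a + a')) ((b - b') * (b + b'))]
  · have e : nullVec a b 1 - nullVec a' b' 1 =
        Complex.I * ((a - a') * (a + a') + (b - b') * (b + b')) := by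
      simp [nullVec]; ring
    change ‖nullVec a b 1 - nullVec a' b' 1‖ ≤ _
    rw [e, norm_mul, Complex.norm_I, one_mul]
    linarith [norm_add_le ((a - a') * (a + a')) ((b - b') * (b + b'))]
  · have e : nullVec a b 2 - nullVec a' b' 2 = 2 * ((a - a') * b) + 2 * (a' * (b - b')) := by
      simp [nullVec]; ring
    change ‖nullVec a b 2 - nullVec a' b' 2‖ ≤ _
    rw [e]
    refine (norm_add_le _ _).trans ?_
    rw [norm_mul, norm_mul, norm_mul, norm_mul, Complex.norm_ofNat]
    have := mul_le_mul ha hb1 (norm_nonneg _) hδ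
    have := mul_le_mul ha' hb (norm_nonneg _) hB
    linarith

lemma abs_norm_add_sq_sub_le (u x : ℂ) : |‖u + x‖ ^ 2 - ‖u‖ ^ 2| ≤ ‖x‖ * (2 * ‖u‖ + ‖x‖) := by
  have h1 := norm_add_le u x
  have h2 := abs_norm_sub_norm_le (u + x) u
  rw [add_sub_cancel_left] at h2
  have e : ‖u + x‖ ^ 2 - ‖u‖ ^ 2 = (‖u + x‖ - ‖u‖) * (‖u + x‖ + ‖u‖) := by ring
  rw [e, abs_mul, abs_of_nonneg (by positivity : 0 ≤ ‖u + x‖ + ‖u‖)]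
  exact mul_le_mul h2 (by linarith) (by positivity) (norm_nonneg _)

lemma le_norm_add_sq (u x : ℂ) : ‖x‖ ^ 2 / 2 - ‖u‖ ^ 2 ≤ ‖u + x‖ ^ 2 := by
  have h := norm_sub_le (u + x) u
  rw [add_sub_cancel_left] at h
  nlinarith [sq_nonneg (‖u + x‖ - ‖u‖), norm_nonneg x, norm_nonneg (u + x), norm_nonneg u]

/-- A continuous function is radially uniformly continuous up to the unit circle. -/
lemma exists_radius_norm_sub_le {E : Type*} [SeminormedAddCommGroup E] {f : ℂ → E}
    (hf : Continuous f) {ε : ℝ} (hε : 0 < ε) :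
    ∃ ρ < 1, 0 ≤ ρ ∧ ∀ ζ ∈ sphere (0 : ℂ) 1, ∀ t : ℝ, ρ ≤ t → t ≤ 1 →
      ‖f (t * ζ) - f ζ‖ ≤ ε := by
  have huc := (isCompact_closedBall (0 : ℂ) 1).uniformContinuousOn_of_continuous hf.continuousOn
  obtain ⟨δ, hδ, H⟩ := Metric.uniformContinuousOn_iff.1 huc ε hε
  refine ⟨max 0 (1 - δ / 2), by simp [hδ], le_max_left _ _, fun ζ hζ t ht ht1 => ?_⟩
  have ht0 : 0 ≤ t := (le_max_left _ _).trans ht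
  have hn := norm_eq_one_of_mem_sphere hζ
  rw [← dist_eq_norm]
  refine (H _ ?_ _ (sphere_subset_closedBall hζ) ?_).le
  · rw [mem_closedBall_zero_iff, norm_mul, Complex.norm_real, Real.norm_of_nonneg ht0, hn]
    linarith
  · have e : (t : ℂ) * ζ - ζ = ((t - 1 : ℝ) : ℂ) * ζ := by push_cast; ring
    rw [dist_eq_norm, e, norm_mul, hn, Complex.norm_real, Real.norm_eq_abs,
      abs_of_nonpos (by linarith)]
    linarith [(le_max_right _ _).trans ht]

lemma exists_bound_closedBall {f : ℂ → ℂ} (hf : Continuous f) :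
    ∃ D : ℝ, 0 ≤ D ∧ ∀ z, ‖z‖ ≤ 1 → ‖f z‖ ≤ D := by
  obtain ⟨D, hD⟩ := (isCompact_closedBall (0 : ℂ) 1).exists_bound_of_continuousOn hf.continuousOn
  exact ⟨D, (norm_nonneg _).trans (hD 0 (by simp)), fun z hz => hD z (by simpa using hz)⟩

lemma half_le_pow {N : ℕ} (hN : 1 ≤ N) {t : ℝ} (ht : 1 - 1 / (2 * N) ≤ t) : 1 / 2 ≤ t ^ N := by
  have hN' : (1 : ℝ) ≤ N := by exact_mod_cast hN
  have h1 : 1 / (2 * (N : ℝ)) ≤ 1 / 2 := by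
    apply one_div_le_one_div_of_le <;> linarith
  have h := one_add_mul_le_pow (a := -(1 / (2 * (N : ℝ)))) (by linarith) N
  have e : 1 + (N : ℝ) * -(1 / (2 * (N : ℝ))) = 1 / 2 := by field_simp; norm_num
  rw [e] at h
  refine h.trans (pow_le_pow_left₀ (by linarith) (by linarith) N)

end Deformation

section BasicDeformation

open Polynomial Filter Topology

lemma sq_le_sq_add_of_le {x y δ B ε : ℝ} (hx : 0 ≤ x) (hy : 0 ≤ y) (hxy : x ≤ y + δ)
    (hxB : x ≤ B) (hδ : 0 ≤ δ) (hB : 0 ≤ B) (hε : 2 * δ * (2 * B + δ) ≤ ε) :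
    x ^ 2 ≤ y ^ 2 + ε := by
  have h0 : 0 ≤ 2 * δ * (2 * B + δ) := by positivity
  rcases le_total x y with h | h
  · nlinarith
  · have : (x - y) * (x + y) ≤ δ * (2 * B) :=
      mul_le_mul (by linarith) (by linarith) (by linarith) hδ
    nlinarith

set_option maxHeartbeats 1000000 in
/-- The basic deformation: a null curve is left nearly unchanged on a disc `‖z‖ ≤ ρ`, while outside
it is moved along the ellipses spanned by a prescribed field of null vectors. -/
lemma NullCurve.exists_deformation (S : NullCurve) {q₁ q₂ : ℂ → ℂ}
    (hq₁ : ContinuousOn q₁ (sphere 0 1)) (hq₂ : ContinuousOn q₂ (sphere 0 1)) {ζ₀ : ℂ}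
    (hζ₀ : ζ₀ ∈ sphere (0 : ℂ) 1) {r τ m : ℝ} (hr : r < 1) (hτ : 0 < τ) (hm : 0 ≤ m)
    (hmq : ∀ ζ ∈ sphere (0 : ℂ) 1, m ≤ ‖q₁ ζ‖ ^ 2 + ‖q₂ ζ‖ ^ 2) :
    ∃ (S' : NullCurve) (ρ ρ' : ℝ), r < ρ ∧ 0 ≤ ρ ∧ ρ ≤ ρ' ∧ ρ' < 1 ∧ S.Near S' ρ τ ∧
      Cross S'.lam ρ ρ' (m / 64) ∧
      ‖S'.surf ζ₀ - S.surf ζ₀ - reVec (nullVec (q₁ ζ₀) (q₂ ζ₀))‖ ≤ τ ∧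
      ∀ ζ ∈ sphere (0 : ℂ) 1, ∀ t : ℝ, ρ ≤ t → t ≤ 1 → ‖S.surf (t * ζ) - S.surf ζ‖ ≤ τ ∧
        ∃ φ : ℂ, ‖φ‖ ≤ 1 ∧ (t = 1 → ‖φ‖ = 1) ∧
          ‖S'.surf (t * ζ) - S.surf ζ - reVec (φ • nullVec (q₁ ζ) (q₂ ζ))‖ ≤ τ := by
  obtain ⟨B, hB, hqB⟩ : ∃ B : ℝ, 0 ≤ B ∧ ∀ ζ ∈ sphere (0 : ℂ) 1, ‖q₁ ζ‖ ≤ B ∧ ‖q₂ ζ‖ ≤ B := by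
    obtain ⟨B₁, h₁⟩ := (isCompact_sphere (0 : ℂ) 1).exists_bound_of_continuousOn hq₁
    obtain ⟨B₂, h₂⟩ := (isCompact_sphere (0 : ℂ) 1).exists_bound_of_continuousOn hq₂
    refine ⟨max 0 (max B₁ B₂), le_max_left _ _, fun ζ hζ => ⟨(h₁ ζ hζ).trans ?_, (h₂ ζ hζ).trans ?_⟩⟩
    · exact (le_max_left _ _).trans (le_max_right _ _)
    · exact (le_max_right _ _).trans (le_max_right _ _)
  -- the accuracy of all approximations
  set ε : ℝ := if m = 0 then τ / 15 else min (τ / 15) (m / 8) with hεdef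
  have hε : 0 < ε := by
    rw [hεdef]; split_ifs with h
    · positivity
    · have := lt_of_le_of_ne hm (Ne.symm h); positivity
  have hετ : ε ≤ τ / 15 := by
    rw [hεdef]; split_ifs with h
    · rfl
    · exact min_le_left _ _
  have hεm : m = 0 ∨ ε ≤ m / 8 := by
    rw [hεdef]; split_ifs with h
    · exact Or.inl h
    · exact Or.inr (min_le_right _ _)
  set δ : ℝ := min 1 (ε / (2 * (2 * B + 1))) with hδdef
  have hδ : 0 < δ := by positivity
  have hδε : 2 * δ * (2 * B + δ) ≤ ε := by
    have h1 : δ ≤ 1 := min_le_left _ _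
    have h2 : δ ≤ ε / (2 * (2 * B + 1)) := min_le_right _ _
    rw [le_div_iff₀ (by positivity)] at h2
    nlinarith
  obtain ⟨k, P₀, Q₀, hPQ₀⟩ := exists_poly_pair_approx hq₁ hq₂ (half_pos hδ)
  have hζ₀1 := norm_eq_one_of_mem_sphere hζ₀
  have hζ₀0 : ζ₀ ≠ 0 := norm_ne_zero_iff.1 (by rw [hζ₀1]; exact one_ne_zero)
  choose α hα using fun n : ℕ =>
    IsAlgClosed.exists_pow_nat_eq ((ζ₀ ^ (2 * n + 3 + 2 * k))⁻¹) two_pos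
  have hα1 : ∀ n, ‖α n‖ = 1 := by
    intro n
    have := congrArg norm (hα n)
    rw [norm_pow, norm_inv, norm_pow, hζ₀1, one_pow, inv_one] at this
    exact (pow_eq_one_iff_of_nonneg (norm_nonneg _) two_ne_zero).1 this
  have hκ : ∀ n : ℕ, α n * (√(2 * n + 3) : ℝ) ≠ 0 := by
    intro n
    refine mul_ne_zero (norm_ne_zero_iff.1 (by rw [hα1]; exact one_ne_zero)) ?_
    rw [Complex.ofReal_ne_zero]
    positivity
  obtain ⟨c₁, c₂, hc₁, hc₂, hgen⟩ := exists_generic_perturbation P₀ Q₀ S.ne hκ (half_pos hδ)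
  set P : ℂ[X] := P₀ + C c₁
  set Q : ℂ[X] := Q₀ + C c₂
  have hPQ : ∀ ζ ∈ sphere (0 : ℂ) 1, ‖P.eval ζ - ζ ^ k * q₁ ζ‖ ≤ δ ∧
      ‖Q.eval ζ - ζ ^ k * q₂ ζ‖ ≤ δ := by
    intro ζ hζ
    simp only [P, Q, eval_add, eval_C]
    constructor
    · rw [add_sub_right_comm]
      exact (norm_add_le _ _).trans (by linarith [(hPQ₀ ζ hζ).1])
    · rw [add_sub_right_comm]
      exact (norm_add_le _ _).trans (by linarith [(hPQ₀ ζ hζ).2])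
  obtain ⟨T, E, hE, hT⟩ := S.exists_oscillation P Q α hα1 fun n z => by
    simpa [P, Q] using hgen n z
  -- radial continuity
  have hnc : Continuous fun z : ℂ => nullVec (P.eval z) (Q.eval z) := by
    have := P.continuous; have := Q.continuous
    refine continuous_pi fun i => ?_
    fin_cases i <;> simp [nullVec] <;> fun_prop
  have hhc : Continuous fun z : ℂ => ‖P.eval z‖ ^ 2 + ‖Q.eval z‖ ^ 2 := by
    have := P.continuous; have := Q.continuous
    fun_prop
  obtain ⟨ρ₁, hρ₁, -, H₁⟩ := exists_radius_norm_sub_le hnc hε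
  obtain ⟨ρ₂, hρ₂, -, H₂⟩ := exists_radius_norm_sub_le hhc hε
  obtain ⟨ρ₃, hρ₃, -, H₃⟩ := exists_radius_norm_sub_le S.continuous_surf hε
  obtain ⟨ρ, hρmax, hρ1⟩ := exists_between (show max 0 (max r (max ρ₁ (max ρ₂ ρ₃))) < 1 by simp [*])
  simp only [max_lt_iff] at hρmax
  obtain ⟨hρ0, hrρ, hρ₁ρ, hρ₂ρ, hρ₃ρ⟩ := hρmax
  obtain ⟨Dp, hDp, hP⟩ := exists_bound_closedBall P.continuous
  obtain ⟨Dq, hDq, hQ⟩ := exists_bound_closedBall Q.continuous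
  obtain ⟨Du, hDu, hU⟩ := exists_bound_closedBall S.u.continuous
  obtain ⟨Dv, hDv, hV⟩ := exists_bound_closedBall S.v.continuous
  set D := Dp + Dq + Du + Dv with hD
  have hD0 : 0 ≤ D := by positivity
  replace hP : ∀ z, ‖z‖ ≤ 1 → ‖P.eval z‖ ≤ D := fun z hz => (hP z hz).trans (by linarith)
  replace hQ : ∀ z, ‖z‖ ≤ 1 → ‖Q.eval z‖ ≤ D := fun z hz => (hQ z hz).trans (by linarith)
  replace hU : ∀ z, ‖z‖ ≤ 1 → ‖S.u.eval z‖ ≤ D := fun z hz => (hU z hz).trans (by linarith)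
  replace hV : ∀ z, ‖z‖ ≤ 1 → ‖S.v.eval z‖ ≤ D := fun z hz => (hV z hz).trans (by linarith)
  -- choice of `n`
  have t1 : Tendsto (fun n : ℕ => (2 * (n : ℝ) + 3) * ρ ^ n) atTop (𝓝 0) := by
    have ha := (tendsto_self_mul_const_pow_of_lt_one hρ0.le hρ1).const_mul 2
    have hb := (tendsto_pow_atTop_nhds_zero_of_lt_one hρ0.le hρ1).const_mul 3
    have := ha.add hb
    simp only [mul_zero, add_zero] at this
    refine this.congr fun n => by ring
  have t2 : Tendsto (fun n : ℕ => E / √((n : ℝ) + 1)) atTop (𝓝 0) :=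
    tendsto_const_nhds.div_atTop
      (Real.tendsto_sqrt_atTop.comp (tendsto_atTop_add_const_right _ _ tendsto_natCast_atTop_atTop))
  have t3 : Tendsto (fun n : ℕ => 2 * (((2 * (n : ℝ) + 3) * ρ ^ n * D) *
      (2 * D + (2 * (n : ℝ) + 3) * ρ ^ n * D))) atTop (𝓝 0) := by
    have := ((t1.mul_const D).mul ((t1.mul_const D).const_add (2 * D))).const_mul 2
    simpa using this
  have t4 : Tendsto (fun n : ℕ => (2 * (n : ℝ) + 3) * ρ ^ n * (2 * (2 * D ^ 2))) atTop (𝓝 0) := by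
    simpa using t1.mul_const (2 * (2 * D ^ 2))
  have t5 : Tendsto (fun n : ℕ => 1 / (2 * ((n : ℝ) + 1))) atTop (𝓝 0) :=
    tendsto_const_nhds.div_atTop ((tendsto_atTop_add_const_right _ _
      tendsto_natCast_atTop_atTop).const_mul_atTop two_pos)
  have e6 : ∀ᶠ n : ℕ in atTop, m = 0 ∨ 2 * D ^ 2 + 1 ≤ ((n : ℝ) + 1) * (m / 16) := by
    rcases eq_or_lt_of_le hm with h | h
    · exact Eventually.of_forall fun n => Or.inl h.symm
    · have : Tendsto (fun n : ℕ => ((n : ℝ) + 1) * (m / 16)) atTop atTop :=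
        (tendsto_atTop_add_const_right _ _ tendsto_natCast_atTop_atTop).atTop_mul_const
          (by positivity)
      exact (this.eventually_ge_atTop _).mono fun n hn => Or.inr hn
  obtain ⟨n, h2, h3, h4, h5, h6⟩ := ((t2.eventually_le_const hε).and
    ((t3.eventually_le_const hτ).and ((t4.eventually_le_const hε).and
    ((t5.eventually_le_const (show (0 : ℝ) < 1 - ρ by linarith)).and e6)))).exists
  have hn0 : (0 : ℝ) ≤ n := Nat.cast_nonneg n
  have hsq : √(2 * (n : ℝ) + 3) ≤ 2 * n + 3 := by
    rw [Real.sqrt_le_left (by positivity)]; nlinarith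
  have hsq2 : √(2 * (n : ℝ) + 3) ^ 2 = 2 * n + 3 := Real.sq_sqrt (by positivity)
  have hκn : ∀ z p : ℂ, ‖α n * √(2 * n + 3) * z ^ (n + 1) * p‖ =
      √(2 * (n : ℝ) + 3) * ‖z‖ ^ (n + 1) * ‖p‖ := by
    intro z p
    rw [norm_mul, norm_mul, norm_mul, hα1, one_mul, norm_pow, Complex.norm_real,
      Real.norm_of_nonneg (Real.sqrt_nonneg _)]
  have hlam : ∀ z, (T n).lam z = ‖S.u.eval z + α n * √(2 * n + 3) * z ^ (n + 1) * P.eval z‖ ^ 2 +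
      ‖S.v.eval z + α n * √(2 * n + 3) * z ^ (n + 1) * Q.eval z‖ ^ 2 := by
    intro z; rw [NullCurve.lam, (hT n z).1, (hT n z).2.1]
  have hmain : ∀ z, ‖z‖ ≤ 1 → ‖(T n).surf z - S.surf z -
      reVec ((α n ^ 2 * z ^ (2 * n + 3)) • nullVec (P.eval z) (Q.eval z))‖ ≤ 3 * ε := by
    intro z hz
    rw [NullCurve.surf, NullCurve.surf, ← reVec_sub, ← reVec_sub]
    exact norm_reVec_le_of_forall fun i => ((hT n z).2.2 i hz).trans h2
  have hnv : ∀ ζ ∈ sphere (0 : ℂ) 1, ∀ i, ‖nullVec (P.eval ζ) (Q.eval ζ) i -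
      (ζ ^ (2 * k) • nullVec (q₁ ζ) (q₂ ζ)) i‖ ≤ ε := by
    intro ζ hζ i
    have e : ζ ^ (2 * k) • nullVec (q₁ ζ) (q₂ ζ) = nullVec (ζ ^ k * q₁ ζ) (ζ ^ k * q₂ ζ) := by
      rw [nullVec_smul, ← pow_mul, mul_comm k 2]
    have hk : ‖ζ ^ k‖ = 1 := by rw [norm_pow, norm_eq_one_of_mem_sphere hζ, one_pow]
    rw [e]
    refine (norm_nullVec_sub_le (B := B) (δ := δ) ?_ ?_ (hPQ ζ hζ).1 (hPQ ζ hζ).2 i).trans hδε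
    · rw [norm_mul, hk, one_mul]; exact (hqB ζ hζ).1
    · rw [norm_mul, hk, one_mul]; exact (hqB ζ hζ).2
  have hmove : ∀ ζ ∈ sphere (0 : ℂ) 1, ∀ t : ℝ, ρ ≤ t → t ≤ 1 →
      ‖S.surf (t * ζ) - S.surf ζ‖ ≤ ε ∧
      ‖(T n).surf (t * ζ) - S.surf ζ - reVec ((α n ^ 2 * (t * ζ) ^ (2 * n + 3) * ζ ^ (2 * k)) •
        nullVec (q₁ ζ) (q₂ ζ))‖ ≤ 10 * ε := by
    intro ζ hζ t ht ht1
    have ht0 : 0 ≤ t := hρ0.le.trans ht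
    have hζ1 := norm_eq_one_of_mem_sphere hζ
    have htz : ‖(t : ℂ) * ζ‖ = t := by
      rw [norm_mul, Complex.norm_real, hζ1, mul_one, Real.norm_of_nonneg ht0]
    have a1 := hmain (t * ζ) (htz.trans_le ht1)
    have a2 := H₃ ζ hζ t (hρ₃ρ.le.trans ht) ht1
    refine ⟨a2, ?_⟩
    set ω : ℂ := α n ^ 2 * (t * ζ) ^ (2 * n + 3) with hω
    have hω1 : ‖ω‖ ≤ 1 := by
      rw [hω, norm_mul, norm_pow, norm_pow, hα1, htz, one_pow, one_mul]
      exact pow_le_one₀ ht0 ht1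
    have a3 : ‖reVec (ω • nullVec (P.eval (t * ζ)) (Q.eval (t * ζ))) -
        reVec ((ω * ζ ^ (2 * k)) • nullVec (q₁ ζ) (q₂ ζ))‖ ≤ 3 * (2 * ε) := by
      rw [← reVec_sub, mul_smul ω, ← smul_sub]
      refine norm_reVec_le_of_forall fun i => ?_
      rw [Pi.smul_apply, smul_eq_mul, norm_mul, Pi.sub_apply]
      have b1 : ‖nullVec (P.eval (t * ζ)) (Q.eval (t * ζ)) i - nullVec (P.eval ζ) (Q.eval ζ) i‖ ≤ ε :=
        (norm_le_pi_norm (nullVec (P.eval (t * ζ)) (Q.eval (t * ζ)) -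
          nullVec (P.eval ζ) (Q.eval ζ)) i).trans (H₁ ζ hζ t (hρ₁ρ.le.trans ht) ht1)
      have b2 := hnv ζ hζ i
      have b3 := norm_sub_le_norm_sub_add_norm_sub (nullVec (P.eval (t * ζ)) (Q.eval (t * ζ)) i)
        (nullVec (P.eval ζ) (Q.eval ζ) i) ((ζ ^ (2 * k) • nullVec (q₁ ζ) (q₂ ζ)) i)
      refine (mul_le_of_le_one_left (norm_nonneg _) hω1).trans (b3.trans ?_)
      linarith
    have e : (T n).surf (t * ζ) - S.surf ζ - reVec ((ω * ζ ^ (2 * k)) • nullVec (q₁ ζ) (q₂ ζ)) =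
        ((T n).surf (t * ζ) - S.surf (t * ζ) -
          reVec (ω • nullVec (P.eval (t * ζ)) (Q.eval (t * ζ)))) +
        (reVec (ω • nullVec (P.eval (t * ζ)) (Q.eval (t * ζ))) -
          reVec ((ω * ζ ^ (2 * k)) • nullVec (q₁ ζ) (q₂ ζ))) + (S.surf (t * ζ) - S.surf ζ) := by
      abel
    rw [e]
    have c1 := norm_add₃_le (a := (T n).surf (t * ζ) - S.surf (t * ζ) -
          reVec (ω • nullVec (P.eval (t * ζ)) (Q.eval (t * ζ))))
        (b := reVec (ω • nullVec (P.eval (t * ζ)) (Q.eval (t * ζ))) -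
          reVec ((ω * ζ ^ (2 * k)) • nullVec (q₁ ζ) (q₂ ζ))) (c := S.surf (t * ζ) - S.surf ζ)
    linarith
  -- the crossing annulus
  set a : ℝ := 1 - 1 / (2 * ((n : ℝ) + 1)) with ha
  set b : ℝ := 1 - 1 / (4 * ((n : ℝ) + 1)) with hb
  have hab : b - a = 1 / (4 * ((n : ℝ) + 1)) := by rw [ha, hb]; field_simp; ring
  have hab' : a ≤ b := by have : 0 ≤ b - a := by rw [hab]; positivity
                          linarith
  have hb1 : b < 1 := by rw [hb]; have : 0 < 1 / (4 * ((n : ℝ) + 1)) := by positivity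
                         linarith
  have hρa : ρ ≤ a := by rw [ha]; linarith
  refine ⟨T n, ρ, b, hrρ, hρ0.le, hρa.trans hab', hb1, ?_, ?_, ?_, ?_⟩
  · intro z hz
    have hz1 : ‖z‖ ≤ 1 := hz.trans hρ1.le
    have hzn : ‖z‖ ^ n ≤ ρ ^ n := pow_le_pow_left₀ (norm_nonneg _) hz n
    constructor
    · intro i
      have h := (hT n z).2.2 i hz1
      have g1 : ‖α n ^ 2 * z ^ (2 * n + 3) * nullVec (P.eval z) (Q.eval z) i‖ ≤ ε := by
        rw [norm_mul, norm_mul, norm_pow, norm_pow, hα1, one_pow, one_mul]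
        refine le_trans ?_ h4
        have g2 : ‖nullVec (P.eval z) (Q.eval z) i‖ ≤ 2 * (2 * D ^ 2) := by
          refine (norm_nullVec_apply_le _ _ i).trans ?_
          have := pow_le_pow_left₀ (norm_nonneg _) (hP z hz1) 2
          have := pow_le_pow_left₀ (norm_nonneg _) (hQ z hz1) 2
          linarith
        have g3 : ‖z‖ ^ (2 * n + 3) ≤ (2 * (n : ℝ) + 3) * ρ ^ n := by
          calc ‖z‖ ^ (2 * n + 3) ≤ ‖z‖ ^ n :=
                pow_le_pow_of_le_one (norm_nonneg _) hz1 (by omega)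
            _ ≤ 1 * ρ ^ n := by rw [one_mul]; exact hzn
            _ ≤ (2 * (n : ℝ) + 3) * ρ ^ n := by gcongr; linarith
        gcongr
      have := norm_add_le (((T n).F i).eval z - (S.F i).eval z -
        α n ^ 2 * z ^ (2 * n + 3) * nullVec (P.eval z) (Q.eval z) i)
        (α n ^ 2 * z ^ (2 * n + 3) * nullVec (P.eval z) (Q.eval z) i)
      rw [sub_add_cancel] at this
      linarith
    · have hx : ∀ p : ℂ, ‖p‖ ≤ D →
          ‖α n * √(2 * n + 3) * z ^ (n + 1) * p‖ ≤ (2 * (n : ℝ) + 3) * ρ ^ n * D := by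
        intro p hp
        rw [hκn]
        have : ‖z‖ ^ (n + 1) ≤ ρ ^ n :=
          (pow_le_pow_of_le_one (norm_nonneg _) hz1 (Nat.le_succ n)).trans hzn
        gcongr
      have k1 := abs_norm_add_sq_sub_le (S.u.eval z) (α n * √(2 * n + 3) * z ^ (n + 1) * P.eval z)
      have k2 := abs_norm_add_sq_sub_le (S.v.eval z) (α n * √(2 * n + 3) * z ^ (n + 1) * Q.eval z)
      rw [hlam, NullCurve.lam]
      set X₁ := α n * √(2 * n + 3) * z ^ (n + 1) * P.eval z
      set X₂ := α n * √(2 * n + 3) * z ^ (n + 1) * Q.eval z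
      set Y := (2 * (n : ℝ) + 3) * ρ ^ n * D
      have hY : 0 ≤ Y := (norm_nonneg _).trans (hx _ (hP z hz1))
      have l1 : ‖X₁‖ * (2 * ‖S.u.eval z‖ + ‖X₁‖) ≤ Y * (2 * D + Y) := by
        have := hx _ (hP z hz1); have := hU z hz1
        gcongr
      have l2 : ‖X₂‖ * (2 * ‖S.v.eval z‖ + ‖X₂‖) ≤ Y * (2 * D + Y) := by
        have := hx _ (hQ z hz1); have := hV z hz1
        gcongr
      rw [add_sub_add_comm]
      exact (abs_add_le _ _).trans (by linarith)
  · have hskip : Cross (T n).lam ρ a 0 := Cross.refl.skip hρa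
    rcases hεm with h0 | hεm
    · rw [h0, zero_div]; exact hskip.skip hab'
    rcases h6 with h0 | h6
    · rw [h0, zero_div]; exact hskip.skip hab'
    have hM : m / 64 = 0 + (((n : ℝ) + 1) * (m / 16)) * (b - a) := by
      rw [hab]; field_simp; ring
    rw [hM]
    refine hskip.step hab' (by positivity) one_pos fun z hza hzb => ?_
    have hz1 : ‖z‖ ≤ 1 := hzb.trans hb1.le
    have hzpos : 0 < ‖z‖ := hρ0.trans_le (hρa.trans hza)
    obtain ⟨ζ, hζ, hzζ⟩ : ∃ ζ ∈ sphere (0 : ℂ) 1, z = (‖z‖ : ℂ) * ζ := by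
      refine ⟨z / ‖z‖, by simp [hzpos.ne'], ?_⟩
      rw [mul_div_cancel₀]
      exact_mod_cast hzpos.ne'
    have hh : m / 2 ≤ ‖P.eval z‖ ^ 2 + ‖Q.eval z‖ ^ 2 := by
      have g1 := H₂ ζ hζ ‖z‖ (hρ₂ρ.le.trans (hρa.trans hza)) hz1
      rw [← hzζ, Real.norm_eq_abs] at g1
      have hk : ‖ζ ^ k‖ = 1 := by rw [norm_pow, norm_eq_one_of_mem_sphere hζ, one_pow]
      have aux : ∀ p q : ℂ, ‖p - ζ ^ k * q‖ ≤ δ → ‖q‖ ≤ B → ‖q‖ ^ 2 ≤ ‖p‖ ^ 2 + ε := by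
        intro p q hp hq
        have h := norm_sub_norm_le (ζ ^ k * q) p
        rw [norm_mul, hk, one_mul, norm_sub_rev] at h
        exact sq_le_sq_add_of_le (norm_nonneg _) (norm_nonneg _) (by linarith) hq hδ.le hB hδε
      have g2 := aux _ _ (hPQ ζ hζ).1 (hqB ζ hζ).1
      have g3 := aux _ _ (hPQ ζ hζ).2 (hqB ζ hζ).2
      have g4 := hmq ζ hζ
      have g5 := (abs_le.1 g1).1
      linarith
    have hpow : 1 / 2 ≤ ‖z‖ ^ (n + 1) := half_le_pow (by omega) (by push_cast; exact hza)
    have hx : ∀ p : ℂ, ((n : ℝ) + 1) / 2 * ‖p‖ ^ 2 ≤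
        ‖α n * √(2 * n + 3) * z ^ (n + 1) * p‖ ^ 2 := by
      intro p
      rw [hκn, mul_pow, mul_pow, hsq2]
      have : (1 / 2 : ℝ) ^ 2 ≤ (‖z‖ ^ (n + 1)) ^ 2 := pow_le_pow_left₀ (by norm_num) hpow 2
      have h' : ((n : ℝ) + 1) / 2 ≤ (2 * (n : ℝ) + 3) * (‖z‖ ^ (n + 1)) ^ 2 := by nlinarith
      gcongr
    rw [hlam]
    have k1 := le_norm_add_sq (S.u.eval z) (α n * √(2 * n + 3) * z ^ (n + 1) * P.eval z)
    have k2 := le_norm_add_sq (S.v.eval z) (α n * √(2 * n + 3) * z ^ (n + 1) * Q.eval z)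
    have k3 := hx (P.eval z)
    have k4 := hx (Q.eval z)
    have k5 := pow_le_pow_left₀ (norm_nonneg _) (hU z hz1) 2
    have k6 := pow_le_pow_left₀ (norm_nonneg _) (hV z hz1) 2
    have k7 : ((n : ℝ) + 1) / 2 * (m / 2) ≤
        ((n : ℝ) + 1) / 2 * (‖P.eval z‖ ^ 2 + ‖Q.eval z‖ ^ 2) :=
      mul_le_mul_of_nonneg_left hh (by positivity)
    linarith
  · have := (hmove ζ₀ hζ₀ 1 hρ1.le le_rfl).2
    rw [Complex.ofReal_one, one_mul, mul_assoc, ← pow_add, hα,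
      inv_mul_cancel₀ (pow_ne_zero _ hζ₀0), one_smul] at this
    exact this.trans (by linarith)
  · intro ζ hζ t ht ht1
    obtain ⟨g1, g2⟩ := hmove ζ hζ t ht ht1
    have ht0 : 0 ≤ t := hρ0.le.trans ht
    have hφ : ‖α n ^ 2 * (t * ζ) ^ (2 * n + 3) * ζ ^ (2 * k)‖ = t ^ (2 * n + 3) := by
      rw [norm_mul, norm_mul, norm_pow, norm_pow, norm_pow, norm_mul, hα1,
        norm_eq_one_of_mem_sphere hζ, Complex.norm_real, Real.norm_of_nonneg ht0]
      simp
    refine ⟨by linarith, _, ?_, ?_, g2.trans (by linarith)⟩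
    · rw [hφ]; exact pow_le_one₀ ht0 ht1
    · rintro rfl; rw [hφ, one_pow]

end BasicDeformation

section Completeness

open Polynomial Filter Topology

/-- Maximum principle for the norm of a harmonic polynomial map into `ℝ³`. -/
lemma norm_reVec_eval_le_of_sphere (G : Fin 3 → ℂ[X]) {η : ℝ}
    (h : ∀ ζ ∈ sphere (0 : ℂ) 1, ‖reVec fun i => (G i).eval ζ‖ ≤ η) {z : ℂ} (hz : ‖z‖ ≤ 1) :
    ‖reVec fun i => (G i).eval z‖ ≤ η := by
  set e : R3 := reVec fun i => (G i).eval z with he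
  let H : ℂ[X] := ∑ i, C (e i : ℂ) * G i
  have hH : ∀ w, (H.eval w).re = inner ℝ e (reVec fun i => (G i).eval w) := by
    intro w
    rw [inner_R3]
    simp [H, Fin.sum_univ_three]
  have key : ‖Complex.exp (H.eval z)‖ ≤ Real.exp (‖e‖ * η) := by
    refine Complex.norm_le_of_forall_mem_frontier_norm_le (U := ball (0 : ℂ) 1)
      (f := fun w => Complex.exp (H.eval w)) isBounded_ball
      (H.differentiable.cexp.diffContOnCl) (fun w hw => ?_) ?_
    · rw [frontier_ball _ one_ne_zero] at hw
      rw [Complex.norm_exp, Real.exp_le_exp, hH]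
      exact (real_inner_le_norm _ _).trans (by gcongr; exact h w hw)
    · rw [closure_ball _ one_ne_zero]; simpa using hz
  rw [Complex.norm_exp, Real.exp_le_exp, hH, ← he, real_inner_self_eq_norm_sq, sq] at key
  rcases eq_or_lt_of_le (norm_nonneg e) with h0 | h0
  · rw [← h0]
    exact (norm_nonneg _).trans (h 1 (by simp))
  · exact le_of_mul_le_mul_left key h0

lemma NullCurve.norm_surf_sub_le_of_sphere {S S' : NullCurve} {η : ℝ}
    (h : ∀ ζ ∈ sphere (0 : ℂ) 1, ‖S'.surf ζ - S.surf ζ‖ ≤ η) {z : ℂ} (hz : ‖z‖ ≤ 1) :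
    ‖S'.surf z - S.surf z‖ ≤ η := by
  have e : ∀ w, S'.surf w - S.surf w = reVec fun i => (S'.F i - S.F i).eval w := by
    intro w; ext i; simp [NullCurve.surf]
  simp only [e] at h ⊢
  exact norm_reVec_eval_le_of_sphere _ h hz

/-- Deformation along a field of directions tangent to spheres: the displacement at boundary points
has prescribed length and is nearly orthogonal to a given field of unit vectors. -/
lemma NullCurve.exists_orthogonal_deformation (S : NullCurve) {w : ℂ → R3} {l : ℂ → ℝ}
    (hw : ContinuousOn w (sphere 0 1)) (hw1 : ∀ ζ ∈ sphere (0 : ℂ) 1, ‖w ζ‖ = 1)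
    (hl : ContinuousOn l (sphere 0 1)) {r τ m : ℝ} (hr : r < 1) (hτ : 0 < τ) (hm : 0 ≤ m)
    (hml : ∀ ζ ∈ sphere (0 : ℂ) 1, m ≤ l ζ) :
    ∃ (S' : NullCurve) (ρ ρ' : ℝ), r < ρ ∧ 0 ≤ ρ ∧ ρ ≤ ρ' ∧ ρ' < 1 ∧ S.Near S' ρ τ ∧
      Cross S'.lam ρ ρ' (m / 64) ∧
      ∀ ζ ∈ sphere (0 : ℂ) 1, ∀ t : ℝ, ρ ≤ t → t ≤ 1 → ‖S.surf (t * ζ) - S.surf ζ‖ ≤ τ ∧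
        ∃ e : R3, ‖e‖ ≤ l ζ ∧ (t = 1 → ‖e‖ = l ζ) ∧ |inner ℝ e (w ζ)| ≤ τ ∧
          ‖S'.surf (t * ζ) - S.surf ζ - e‖ ≤ τ := by
  obtain ⟨A, hA⟩ := (isCompact_sphere (0 : ℂ) 1).exists_bound_of_continuousOn hl
  have hA0 : 0 ≤ A := (norm_nonneg _).trans (hA 1 (by simp))
  obtain ⟨q₁, q₂, h₁, h₂, hq⟩ := exists_orthogonal_spinor hw hw1
    (show 0 < τ / (A + 1) by positivity)
  have hsq : ContinuousOn (fun ζ => ((√(l ζ) : ℝ) : ℂ)) (sphere 0 1) :=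
    Complex.continuous_ofReal.comp_continuousOn hl.sqrt
  have hs : ∀ ζ ∈ sphere (0 : ℂ) 1, √(l ζ) ^ 2 = l ζ := fun ζ hζ =>
    Real.sq_sqrt (hm.trans (hml ζ hζ))
  have hn : ∀ ζ ∈ sphere (0 : ℂ) 1, ‖(√(l ζ) : ℂ) * q₁ ζ‖ ^ 2 + ‖(√(l ζ) : ℂ) * q₂ ζ‖ ^ 2 = l ζ := by
    intro ζ hζ
    rw [norm_mul, norm_mul, Complex.norm_real, Real.norm_of_nonneg (Real.sqrt_nonneg _), mul_pow,
      mul_pow, ← mul_add, (hq ζ hζ).1, mul_one, hs ζ hζ]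
  obtain ⟨S', ρ, ρ', hrρ, hρ0, hρρ', hρ'1, hnear, hcross, -, hmove⟩ := S.exists_deformation
    (q₁ := fun ζ => (√(l ζ) : ℂ) * q₁ ζ) (q₂ := fun ζ => (√(l ζ) : ℂ) * q₂ ζ)
    (hsq.mul h₁) (hsq.mul h₂) (ζ₀ := 1) (by simp) hr hτ hm fun ζ hζ =>
      (hml ζ hζ).trans_eq (hn ζ hζ).symm
  refine ⟨S', ρ, ρ', hrρ, hρ0, hρρ', hρ'1, hnear, hcross, fun ζ hζ t ht ht1 => ?_⟩
  obtain ⟨g1, φ, hφ, hφ1, hd⟩ := hmove ζ hζ t ht ht1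
  have hl0 := hm.trans (hml ζ hζ)
  have hnE : ‖reVec (φ • nullVec ((√(l ζ) : ℂ) * q₁ ζ) ((√(l ζ) : ℂ) * q₂ ζ))‖ = ‖φ‖ * l ζ := by
    rw [norm_reVec_smul_nullVec, hn ζ hζ]
  refine ⟨g1, _, ?_, fun h => ?_, ?_, hd⟩
  · rw [hnE]; exact mul_le_of_le_one_left hl0 hφ
  · rw [hnE, hφ1 h, one_mul]
  · have e : reVec (φ • nullVec ((√(l ζ) : ℂ) * q₁ ζ) ((√(l ζ) : ℂ) * q₂ ζ)) =
        l ζ • reVec (φ • nullVec (q₁ ζ) (q₂ ζ)) := by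
      rw [nullVec_smul, ← reVec_real_smul, smul_comm φ, ← Complex.ofReal_pow, hs ζ hζ]
    rw [e, real_inner_smul_left, abs_mul, abs_of_nonneg hl0]
    have hlA : l ζ ≤ A + 1 := by linarith [le_abs_self (l ζ), hA ζ hζ, Real.norm_eq_abs (l ζ)]
    calc l ζ * _ ≤ (A + 1) * (τ / (A + 1)) := by gcongr; exact (hq ζ hζ).2 φ hφ
      _ = τ := mul_div_cancel₀ _ (by positivity)

lemma norm_add_sq_bounds {D e f : R3} {ρ τ M : ℝ} (hD : ‖D‖ ≤ M) (he : ‖e‖ = ρ)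
    (hf : ‖f‖ ≤ τ) (hin : |inner ℝ e D| ≤ τ * M)
    (hτM : τ * (4 * M + 2 * ρ + τ) ≤ ρ ^ 2) :
    ‖D‖ ^ 2 ≤ ‖D + e + f‖ ^ 2 ∧ ‖D + e + f‖ ^ 2 ≤ ‖D‖ ^ 2 + 2 * ρ ^ 2 := by
  have h1 : ‖D + e + f‖ ^ 2 = ‖D‖ ^ 2 + ρ ^ 2 + 2 * inner ℝ e D +
      (2 * inner ℝ (D + e) f + ‖f‖ ^ 2) := by
    rw [norm_add_sq_real, norm_add_sq_real, he, real_inner_comm]; ring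
  have h2 : |inner ℝ (D + e) f| ≤ (M + ρ) * τ := by
    refine (abs_real_inner_le_norm _ _).trans ?_
    have : ‖D + e‖ ≤ M + ρ := (norm_add_le _ _).trans (by linarith)
    gcongr
    exact (norm_nonneg _).trans this
  have h3 : ‖f‖ ^ 2 ≤ τ ^ 2 := pow_le_pow_left₀ (norm_nonneg _) hf 2
  have h4 := sq_nonneg ‖f‖
  obtain ⟨a1, a2⟩ := abs_le.1 hin
  obtain ⟨b1, b2⟩ := abs_le.1 h2
  have h5 : 2 * (τ * M) + 2 * ((M + ρ) * τ) + τ ^ 2 ≤ ρ ^ 2 := by nlinarith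
  have hτ2 : 0 ≤ τ ^ 2 := sq_nonneg τ
  constructor <;> rw [h1] <;> linarith

/-- A polynomial null curve can be deformed so that the surface moves arbitrarily little but
crossing an annulus near the boundary becomes arbitrarily expensive. -/
lemma NullCurve.exists_cross (S : NullCurve) {r η L : ℝ} (hr : r < 1) (hη : 0 < η) :
    ∃ (S' : NullCurve) (r' : ℝ), r < r' ∧ r' < 1 ∧ S.Near S' r η ∧
      (∀ z : ℂ, ‖z‖ ≤ 1 → ‖S'.surf z - S.surf z‖ ≤ η) ∧ Cross S'.lam r r' L := by
  set σ := η / 3 with hσ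
  have hσ0 : 0 < σ := by positivity
  set Λ := 64 * (|L| + 1) with hΛ
  have hΛ0 : 0 < Λ := by positivity
  obtain ⟨N, hN⟩ := exists_nat_gt (Λ ^ 2 / σ ^ 2)
  have hN0 : (0 : ℝ) < N := lt_of_le_of_lt (by positivity) hN
  set ρ := Λ / N with hρ
  have hρ0 : 0 < ρ := by positivity
  have hNρ : N * ρ = Λ := by rw [hρ]; field_simp
  have hNρ2 : N * ρ ^ 2 ≤ σ ^ 2 := by
    rw [div_lt_iff₀ (by positivity)] at hN
    have : N * ρ ^ 2 = Λ ^ 2 / N := by rw [hρ]; field_simp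
    rw [this, div_le_iff₀ hN0]
    linarith
  set M := 2 * σ with hM
  obtain ⟨τ, hτ0, hτN, hτM⟩ : ∃ τ > 0, N * τ ≤ η ∧ τ * (4 * M + 2 * ρ + τ) ≤ ρ ^ 2 := by
    refine ⟨min 1 (min (η / N) (ρ ^ 2 / (4 * M + 2 * ρ + 1))), by positivity, ?_, ?_⟩
    · rw [mul_comm, ← le_div_iff₀ hN0]; exact (min_le_right _ _).trans (min_le_left _ _)
    · have h1 := min_le_left (1 : ℝ) (min (η / N) (ρ ^ 2 / (4 * M + 2 * ρ + 1)))
      have h2 : min 1 (min (η / N) (ρ ^ 2 / (4 * M + 2 * ρ + 1))) ≤ ρ ^ 2 / (4 * M + 2 * ρ + 1) :=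
        (min_le_right _ _).trans (min_le_right _ _)
      set τ := min 1 (min (η / N) (ρ ^ 2 / (4 * M + 2 * ρ + 1)))
      rw [le_div_iff₀ (by positivity)] at h2
      refine le_trans ?_ h2
      have : 0 < τ := by positivity
      gcongr
  let v : R3 := EuclideanSpace.single 0 σ
  have hv : ‖v‖ = σ := by simp [v, abs_of_pos hσ0]
  have main : ∀ j : ℕ, j ≤ N → ∃ (S' : NullCurve) (r' : ℝ), r ≤ r' ∧ r' < 1 ∧
      S.Near S' r (j * τ) ∧ Cross S'.lam r r' (j * (ρ / 64)) ∧ ∀ ζ ∈ sphere (0 : ℂ) 1,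
        σ ^ 2 ≤ ‖S'.surf ζ - S.surf ζ - v‖ ^ 2 ∧
        ‖S'.surf ζ - S.surf ζ - v‖ ^ 2 ≤ σ ^ 2 + j * (2 * ρ ^ 2) := by
    intro j
    induction j with
    | zero =>
      intro _
      refine ⟨S, r, le_rfl, hr, ?_, ?_, fun ζ _ => ?_⟩
      · simpa using NullCurve.Near.refl S r
      · simpa using Cross.refl
      · simp [hv]
    | succ j ih =>
      intro hj
      obtain ⟨S₁, r₁, hr₁, hr₁1, hnear, hcross, hD⟩ := ih (by omega)
      obtain ⟨τ', hτ', hrob⟩ := hcross.robust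
      have hjN : (j : ℝ) ≤ N := by exact_mod_cast (by omega : j ≤ N)
      have hDM : ∀ ζ ∈ sphere (0 : ℂ) 1, ‖S₁.surf ζ - S.surf ζ - v‖ ≤ M := by
        intro ζ hζ
        refine abs_le_of_sq_le_sq' ?_ (by positivity) |>.2
        have := (hD ζ hζ).2
        have : (j : ℝ) * (2 * ρ ^ 2) ≤ N * (2 * ρ ^ 2) := by gcongr
        nlinarith
      have hDpos : ∀ ζ ∈ sphere (0 : ℂ) 1, 0 < ‖S₁.surf ζ - S.surf ζ - v‖ := by
        intro ζ hζ
        have := (hD ζ hζ).1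
        by_contra hcon
        have h0 : ‖S₁.surf ζ - S.surf ζ - v‖ = 0 := le_antisymm (not_lt.1 hcon) (norm_nonneg _)
        rw [h0] at this
        nlinarith
      have hDc : Continuous fun ζ => S₁.surf ζ - S.surf ζ - v :=
        (S₁.continuous_surf.sub S.continuous_surf).sub continuous_const
      obtain ⟨S₂, ρ₁, ρ₂, h1, -, h3, h4, h5, h6, h7⟩ := S₁.exists_orthogonal_deformation
        (w := fun ζ => ‖S₁.surf ζ - S.surf ζ - v‖⁻¹ • (S₁.surf ζ - S.surf ζ - v))
        (l := fun _ => ρ) ((hDc.norm.continuousOn.inv₀ fun ζ hζ => (hDpos ζ hζ).ne').smul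
          hDc.continuousOn)
        (fun ζ hζ => by
          rw [norm_smul, norm_inv, norm_norm, inv_mul_cancel₀ (hDpos ζ hζ).ne'])
        continuousOn_const hr₁1 (lt_min hτ0 hτ') hρ0.le (fun _ _ => le_rfl)
      refine ⟨S₂, ρ₂, hr₁.trans (h1.le.trans h3), h4, ?_, ?_, fun ζ hζ => ?_⟩
      · have := hnear.trans (h5.mono (hr₁.trans h1.le) (min_le_left _ _))
        refine this.mono le_rfl (le_of_eq ?_)
        push_cast; ring
      · have hc : Cross S₂.lam r r₁ (j * (ρ / 64)) := hrob _ fun z hz => by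
          have := (h5 z (hz.trans h1.le)).2
          linarith [(abs_le.1 this).1, min_le_right τ τ']
        refine ((hc.skip h1.le).trans h6).mono (le_of_eq ?_)
        push_cast; ring
      · obtain ⟨-, e, -, he, hin, hf⟩ := h7 ζ hζ 1 (h3.trans h4.le) le_rfl
        rw [Complex.ofReal_one, one_mul] at hf
        have hin' : |inner ℝ e (S₁.surf ζ - S.surf ζ - v)| ≤ τ * M := by
          rw [real_inner_smul_right, abs_mul, abs_inv, abs_norm, inv_mul_le_iff₀ (hDpos ζ hζ),
            mul_comm] at hin
          refine hin.trans ?_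
          exact mul_le_mul (min_le_left _ _) (hDM ζ hζ) (norm_nonneg _) hτ0.le
        have hb := norm_add_sq_bounds (hDM ζ hζ) (he rfl) (hf.trans (min_le_left _ _)) hin' hτM
        have e1 : S₁.surf ζ - S.surf ζ - v + e + (S₂.surf ζ - S₁.surf ζ - e) =
          S₂.surf ζ - S.surf ζ - v := by abel
        rw [e1] at hb
        refine ⟨(hD ζ hζ).1.trans hb.1, hb.2.trans ?_⟩
        have := (hD ζ hζ).2
        push_cast
        linarith
  obtain ⟨S', r', hr', hr'1, hnear, hcross, hD⟩ := main N le_rfl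
  refine ⟨S', (r' + 1) / 2, by linarith, by linarith, hnear.mono le_rfl hτN, fun z hz => ?_, ?_⟩
  · refine NullCurve.norm_surf_sub_le_of_sphere (fun ζ hζ => ?_) hz
    have h1 : ‖S'.surf ζ - S.surf ζ - v‖ ≤ 2 * σ := by
      refine abs_le_of_sq_le_sq' ?_ (by positivity) |>.2
      have := (hD ζ hζ).2
      nlinarith
    have h2 := norm_add_le (S'.surf ζ - S.surf ζ - v) v
    rw [sub_add_cancel, hv] at h2
    linarith
  · refine (hcross.skip (by linarith)).mono ?_
    have : (N : ℝ) * (ρ / 64) = |L| + 1 := by rw [← mul_div_assoc, hNρ, hΛ]; ring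
    rw [this]
    linarith [le_abs_self L]

end Completeness

section Core

open Filter Topology

lemma IsPreconnected.exists_mem_frontier {α : Type*} [TopologicalSpace α] {T U : Set α}
    (hT : IsPreconnected T) (h1 : (T ∩ U).Nonempty) (h2 : (T ∩ Uᶜ).Nonempty) :
    ∃ p ∈ T, p ∈ frontier U := by
  by_contra! hcon
  obtain ⟨x, hxT, hxU⟩ := h1
  obtain ⟨y, hyT, hyU⟩ := h2
  have hx : x ∈ interior U := by
    by_contra hx
    exact hcon x hxT ⟨subset_closure hxU, hx⟩
  have hy : y ∈ (closure U)ᶜ := fun hy => hcon y hyT ⟨hy, fun h => hyU (interior_subset h)⟩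
  obtain ⟨z, -, hz1, hz2⟩ := hT _ _ isOpen_interior isClosed_closure.isOpen_compl
    (fun p hp => by
      by_cases hpi : p ∈ interior U
      · exact Or.inl hpi
      · exact Or.inr fun hpc => hcon p hp ⟨hpc, hpi⟩) ⟨x, hxT, hx⟩ ⟨y, hyT, hy⟩
  exact hz2 (interior_subset_closure hz1)

lemma exists_metric_projection {A : Set R3} (hne : A.Nonempty) (hA : IsCompact A)
    (hconv : Convex ℝ A) :
    ∃ π : R3 → R3, Continuous π ∧ ∀ x, π x ∈ A ∧ infDist x A = ‖x - π x‖ ∧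
      ∀ a ∈ A, inner ℝ (x - π x) (a - π x) ≤ 0 := by
  have key : ∀ x, ∃ c ∈ A, infDist x A = ‖x - c‖ := fun x => by
    obtain ⟨c, hc, h⟩ := hA.exists_infDist_eq_dist hne x
    exact ⟨c, hc, h.trans (dist_eq_norm x c)⟩
  choose π hπ hπd using key
  have hin : ∀ x, ∀ a ∈ A, inner ℝ (x - π x) (a - π x) ≤ 0 := by
    intro x
    refine (norm_eq_iInf_iff_real_inner_le_zero hconv (hπ x)).1 ?_
    rw [← hπd x, infDist_eq_iInf]
    simp only [dist_eq_norm]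
  refine ⟨π, ?_, fun x => ⟨hπ x, hπd x, hin x⟩⟩
  refine (LipschitzWith.of_dist_le_mul (K := 1) fun x y => ?_).continuous
  rw [dist_eq_norm, dist_eq_norm, NNReal.coe_one, one_mul]
  have h1 := hin x (π y) (hπ y)
  have h2 := hin y (π x) (hπ x)
  have h3 : ‖π x - π y‖ ^ 2 ≤ inner ℝ (x - y) (π x - π y) := by
    rw [← real_inner_self_eq_norm_sq]
    simp only [inner_sub_left, inner_sub_right] at h1 h2 ⊢
    linarith
  have h4 := h3.trans (real_inner_le_norm _ _)
  rcases eq_or_lt_of_le (norm_nonneg (π x - π y)) with h0 | h0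
  · rw [← h0]; exact norm_nonneg _
  · rw [sq] at h4; exact le_of_mul_le_mul_right h4 h0

lemma infDist_eq_of_inner_nonpos {A : Set R3} {x c : R3} (hc : c ∈ A)
    (h : ∀ a ∈ A, inner ℝ (x - c) (a - c) ≤ 0) : infDist x A = ‖x - c‖ := by
  refine le_antisymm ((infDist_le_dist_of_mem hc).trans_eq (dist_eq_norm _ _)) ?_
  refine (le_infDist ⟨c, hc⟩).2 fun a ha => ?_
  rw [dist_eq_norm]
  have h1 : ‖x - a‖ ^ 2 = ‖x - c‖ ^ 2 - 2 * inner ℝ (x - c) (a - c) + ‖a - c‖ ^ 2 := by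
    rw [← norm_sub_sq_real]; congr 2; abel
  refine abs_le_of_sq_le_sq' ?_ (norm_nonneg _) |>.2
  nlinarith [h a ha, sq_nonneg ‖a - c‖]

lemma dist_add_le_of_closedBall_subset {a y : R3} {h R : ℝ} (hh : 0 ≤ h) (hR : h ≤ R)
    (hsub : closedBall a h ⊆ closedBall y R) : ‖a - y‖ + h ≤ R := by
  rcases eq_or_ne (a - y) 0 with h0 | h0
  · simpa [h0] using hR
  · have hn : 0 < ‖a - y‖ := norm_pos_iff.2 h0
    have h1 : a + (h / ‖a - y‖) • (a - y) ∈ closedBall y R := hsub (by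
      rw [mem_closedBall, dist_eq_norm, add_sub_cancel_left, norm_smul, Real.norm_of_nonneg
        (by positivity), div_mul_cancel₀ _ hn.ne'])
    rw [mem_closedBall, dist_eq_norm] at h1
    have h2 : a + (h / ‖a - y‖) • (a - y) - y = (1 + h / ‖a - y‖) • (a - y) := by
      rw [add_smul, one_smul]; abel
    rw [h2, norm_smul, Real.norm_of_nonneg (by positivity)] at h1
    have : (1 + h / ‖a - y‖) * ‖a - y‖ = ‖a - y‖ + h := by field_simp
    linarith

/-- A description of a convex domain `C` as the open `h`-neighbourhood of a compact convex set `A`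
satisfying an exterior sphere condition of radius `σ`. -/
structure IsCore (C A : Set R3) (h σ : ℝ) : Prop where
  h_pos : 0 < h
  σ_nonneg : 0 ≤ σ
  nonempty : A.Nonempty
  isCompact : IsCompact A
  convex : Convex ℝ A
  mem_iff : ∀ x, x ∈ C ↔ infDist x A < h
  subset_closedBall : ∀ x ∈ C, ∀ c ∈ A, 0 < infDist x A → infDist x A = ‖x - c‖ →
    (∀ a ∈ A, inner ℝ (x - c) (a - c) ≤ 0) →
    ∀ a ∈ A, ‖a - (c - σ • (‖x - c‖⁻¹ • (x - c)))‖ ≤ σ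

lemma infDist_ray {A : Set R3} {x c : R3} (hc : c ∈ A)
    (h : ∀ a ∈ A, inner ℝ (x - c) (a - c) ≤ 0) {s : ℝ} (hs : 0 ≤ s) :
    infDist (c + s • (x - c)) A = s * ‖x - c‖ := by
  rw [infDist_eq_of_inner_nonpos hc]
  · rw [add_sub_cancel_left, norm_smul, Real.norm_of_nonneg hs]
  · intro a ha
    rw [add_sub_cancel_left, real_inner_smul_left]
    exact mul_nonpos_of_nonneg_of_nonpos hs (h a ha)

lemma RegStrictConvexDomain.exists_isCore {C : Set R3} (hC : RegStrictConvexDomain C) :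
    ∃ A h σ, IsCore C A h σ := by
  obtain ⟨hne, hopen, hconv, hbdd, h, R, h0, hhR, hball⟩ := hC
  set A : Set R3 := {c | closedBall c h ⊆ closure C} with hA
  have memA : ∀ c, c ∈ A ↔ ∀ v : R3, ‖v‖ ≤ h → c + v ∈ closure C := by
    intro c
    constructor
    · intro hc v hv; exact hc (by simpa using hv)
    · intro hc y hy
      have := hc (y - c) (by rwa [← dist_eq_norm])
      simpa using this
  have hinter : interior (closure C) = C := by
    rw [hconv.interior_closure_eq_interior_of_nonempty_interior (by rwa [hopen.interior_eq]),
      hopen.interior_eq]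
  have hAC : A ⊆ closure C := fun c hc => hc (mem_closedBall_self h0.le)
  have hAclosed : IsClosed A := by
    have : A = ⋂ (v : R3) (_ : ‖v‖ ≤ h), (fun c => c + v) ⁻¹' closure C := by
      ext c; simp only [memA, mem_iInter, mem_preimage]
    rw [this]
    exact isClosed_biInter fun v _ => isClosed_closure.preimage (by fun_prop)
  have hAcomp : IsCompact A := isCompact_of_isClosed_isBounded hAclosed (hbdd.closure.subset hAC)
  have hAconv : Convex ℝ A := by
    intro a ha b hb s t hs ht hst
    rw [memA] at ha hb ⊢
    intro v hv
    have := hconv.closure (ha v hv) (hb v hv) hs ht hst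
    convert this using 1
    rw [smul_add, smul_add, add_add_add_comm, ← add_smul, hst, one_smul]
  have hCne : C ≠ univ := by
    rintro rfl
    exact NormedSpace.unbounded_univ ℝ R3 hbdd
  have hfront : ∀ p ∈ frontier C, infDist p A ≤ h := by
    intro p hp
    obtain ⟨⟨x, hx, hxC⟩, -⟩ := hball p hp
    exact (infDist_le_dist_of_mem (s := A) hxC).trans_eq (mem_sphere.1 hx)
  have hAne : A.Nonempty := by
    obtain ⟨p, hp⟩ : (frontier C).Nonempty := by
      exact nonempty_frontier_iff.2 ⟨hne, hCne⟩
    obtain ⟨⟨x, -, hxC⟩, -⟩ := hball p hp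
    exact ⟨x, hxC⟩
  have hsub : ∀ x, infDist x A < h → x ∈ C := by
    intro x hx
    obtain ⟨c, hc, hxc⟩ := (infDist_lt_iff hAne).1 hx
    rw [← hinter]
    exact interior_mono (show closedBall c h ⊆ closure C from hc) (ball_subset_interior_closedBall hxc)
  have hmem : ∀ x, x ∈ C ↔ infDist x A < h := by
    refine fun x => ⟨fun hx => ?_, hsub x⟩
    obtain ⟨π, -, hπ⟩ := exists_metric_projection hAne hAcomp hAconv
    obtain ⟨hc, hd, hin⟩ := hπ x
    rcases eq_or_lt_of_le (infDist_nonneg (x := x) (s := A)) with h1 | h1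
    · rwa [← h1]
    rw [hd] at h1 ⊢
    obtain ⟨M, hM⟩ := hbdd.exists_norm_le
    set c := π x
    let f : ℝ → R3 := fun s => c + s • (x - c)
    have hf : Continuous f := by fun_prop
    have hM0 : 0 ≤ M := (norm_nonneg _).trans (hM x hx)
    set s₁ := (M + ‖c‖) / ‖x - c‖ + 1 with hs₁
    have h2 : f s₁ ∉ C := by
      intro hcon
      have h3 := hM _ hcon
      have h4 : ‖f s₁ - c‖ = s₁ * ‖x - c‖ := by
        rw [add_sub_cancel_left, norm_smul, Real.norm_of_nonneg (by positivity)]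
      have h5 := norm_sub_le (f s₁) c
      have h6 : s₁ * ‖x - c‖ = M + ‖c‖ + ‖x - c‖ := by rw [hs₁]; field_simp
      linarith
    have hle : (1 : ℝ) ≤ s₁ := by rw [hs₁]; linarith [show 0 ≤ (M + ‖c‖) / ‖x - c‖ by positivity]
    obtain ⟨_, ⟨s, hs, rfl⟩, hp⟩ :=
      (isPreconnected_Icc.image f hf.continuousOn).exists_mem_frontier (U := C)
      ⟨x, ⟨1, ⟨le_rfl, hle⟩, by simp [f]⟩, hx⟩ ⟨f s₁, ⟨s₁, ⟨hle, le_rfl⟩, rfl⟩, h2⟩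
    have h3 := hfront _ hp
    rw [infDist_ray hc hin (by linarith [hs.1])] at h3
    have h4 : s ≠ 1 := by
      rintro rfl
      rw [hopen.frontier_eq] at hp
      exact hp.2 (by simpa [f] using hx)
    have h5 : 1 < s := lt_of_le_of_ne hs.1 (Ne.symm h4)
    nlinarith
  refine ⟨A, h, R - h, h0, by linarith, hAne, hAcomp, hAconv, hmem, ?_⟩
  intro x hx c hc hpos hd hin a ha
  rw [hd] at hpos
  set w := ‖x - c‖⁻¹ • (x - c) with hw
  have hw1 : ‖w‖ = 1 := by rw [hw, norm_smul, norm_inv, norm_norm, inv_mul_cancel₀ hpos.ne']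
  have hpC : c + h • w ∉ C := by
    rw [hmem, not_lt, hw, smul_smul, infDist_ray hc hin (by positivity)]
    rw [mul_assoc, inv_mul_cancel₀ hpos.ne', mul_one]
  have hp : c + h • w ∈ frontier C := by
    rw [hopen.frontier_eq]
    refine ⟨(memA c).1 hc _ ?_, hpC⟩
    rw [norm_smul, hw1, mul_one, Real.norm_of_nonneg h0.le]
  obtain ⟨-, y, hy, hyC⟩ := hball _ hp
  rw [mem_sphere, dist_eq_norm] at hy
  have h1 : ∀ b ∈ A, ‖b - y‖ + h ≤ R := fun b hb =>
    dist_add_le_of_closedBall_subset h0.le hhR (Subset.trans hb hyC)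
  have h2 : c + h • w - y = (c - y) + h • w := by abel
  rw [h2] at hy
  have h3 := norm_add_le (c - y) (h • w)
  rw [hy, norm_smul, hw1, mul_one, Real.norm_of_nonneg h0.le] at h3
  have h4 : ‖c - y‖ = R - h := by linarith [h1 c hc]
  have h5 : inner ℝ (c - y) w = R - h := by
    have := norm_add_sq_real (c - y) (h • w)
    rw [hy, h4, norm_smul, hw1, mul_one, Real.norm_of_nonneg h0.le, real_inner_smul_right] at this
    have h6 : h * inner ℝ (c - y) w = h * (R - h) := by linarith
    exact mul_left_cancel₀ h0.ne' h6
  have h6 : c - y - (R - h) • w = 0 := by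
    rw [← norm_eq_zero, ← sq_eq_zero_iff, norm_sub_sq_real, real_inner_smul_right, h5, h4,
      norm_smul, hw1, mul_one, Real.norm_of_nonneg (by linarith)]
    ring
  have h7 : c - (R - h) • w = y := by
    rw [sub_sub, sub_eq_zero] at h6
    rw [h6]; abel
  rw [h7]
  linarith [h1 a ha]

lemma IsCore.κ_bounds {h σ d δ τ κ : ℝ} (h0 : 0 < h) (hσ : 0 ≤ σ) (hκ : κ = h / (8 * (σ + h)))
    (hd : 0 < d) (hδ : δ = h - d) (hdh : d ≤ h / 2) (hτ : τ ≤ κ * d / 16) (hτ0 : 0 < τ) :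
    (σ + δ + κ * d + 2 * τ) ^ 2 ≤ (σ + δ) ^ 2 + h * d / 2 - 2 * (σ + δ) * τ := by
  have hκ0 : 0 < κ := by rw [hκ]; positivity
  have e1 : κ * (8 * (σ + h)) = h := by rw [hκ]; field_simp
  have hκ1 : κ ≤ 1 / 8 := by nlinarith
  set s := κ * d with hs
  have hs0 : 0 < s := by positivity
  have e2 : s * (8 * (σ + h)) = h * d := by rw [hs, mul_right_comm, e1]
  have h1 : σ + δ ≤ σ + h := by linarith
  have h2 : s + 2 * τ ≤ 9 / 8 * s := by linarith
  have h3 : (s + 2 * τ) ^ 2 ≤ (9 / 8 * s) ^ 2 := by gcongr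
  have h4 : s ≤ σ + h := by nlinarith
  have h5 : s ^ 2 ≤ s * (σ + h) := by nlinarith
  have h6 : (σ + δ) * (s + 2 * τ) ≤ (σ + h) * (9 / 8 * s) := by gcongr
  have h7 : (σ + δ) * τ ≤ (σ + h) * (s / 16) := by gcongr
  nlinarith

/-- The effect on the distance to the core of a displacement nearly tangent to the parallel
surface. -/
lemma IsCore.push {C A : Set R3} {h σ : ℝ} (H : IsCore C A h σ) {x c e f : R3} {τ : ℝ}
    (hxC : x ∈ C) (hc : c ∈ A) (hx : h / 2 ≤ infDist x A) (hd : infDist x A = ‖x - c‖)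
    (hin : ∀ a ∈ A, inner ℝ (x - c) (a - c) ≤ 0)
    (he : ‖e‖ ^ 2 ≤ h * (h - infDist x A) / 2)
    (hew : |inner ℝ e (‖x - c‖⁻¹ • (x - c))| ≤ τ) (hf : ‖f‖ ≤ τ) (hτ0 : 0 < τ)
    (hτ : τ ≤ h / (8 * (σ + h)) * (h - infDist x A) / 16) :
    infDist (x + e + f) A < h ∧ h - infDist (x + e + f) A < 2 * (h - infDist x A) ∧
    (‖e‖ ^ 2 = h * (h - infDist x A) / 2 →
      h - infDist (x + e + f) A < (1 - h / (8 * (σ + h))) * (h - infDist x A)) := by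
  have h0 := H.h_pos
  have hσ := H.σ_nonneg
  set δ := infDist x A with hδ
  set w := ‖x - c‖⁻¹ • (x - c) with hw
  set κ := h / (8 * (σ + h)) with hκ
  have hκ0 : 0 < κ := by positivity
  have hκ1 : κ ≤ 1 / 8 := by rw [hκ, div_le_iff₀ (by positivity)]; linarith
  have hδ0 : 0 < δ := by linarith
  have hδh : δ < h := (H.mem_iff x).1 hxC
  have hw1 : ‖w‖ = 1 := by
    rw [hw, norm_smul, norm_inv, norm_norm, inv_mul_cancel₀ (by rw [← hd]; exact hδ0.ne')]
  have hxw : x - c = δ • w := by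
    rw [hw, hd, smul_smul, mul_inv_cancel₀ (by rw [← hd]; exact hδ0.ne'), one_smul]
  obtain ⟨i1, i2⟩ := abs_le.1 hew
  have hτd : τ ≤ (h - δ) / 128 := by
    refine hτ.trans ?_
    have : κ * (h - δ) ≤ 1 / 8 * (h - δ) := by gcongr
    linarith
  have hfdist : ∀ a : R3, |‖x + e + f - a‖ - ‖x + e - a‖| ≤ τ := fun a => by
    refine (abs_norm_sub_norm_le _ _).trans ?_
    have : x + e + f - a - (x + e - a) = f := by abel
    rwa [this]
  have lower : ∀ s, 0 ≤ σ + s → (σ + s) ^ 2 ≤ (σ + δ) ^ 2 + ‖e‖ ^ 2 - 2 * (σ + δ) * τ →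
      s - τ ≤ infDist (x + e + f) A := by
    intro s hs0 hs
    refine (le_infDist H.nonempty).2 fun a ha => ?_
    rw [dist_eq_norm]
    have h1 := H.subset_closedBall x hxC c hc hδ0 hd hin a ha
    rw [← hw] at h1
    set y := c - σ • w with hy
    have h2 : x + e - y = (σ + δ) • w + e := by
      rw [hy, add_smul, ← hxw]; abel
    have h3 : ‖x + e - y‖ ^ 2 = (σ + δ) ^ 2 + 2 * ((σ + δ) * inner ℝ e w) + ‖e‖ ^ 2 := by
      rw [h2, norm_add_sq_real, norm_smul, hw1, mul_one, Real.norm_of_nonneg (by linarith),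
        real_inner_smul_left, real_inner_comm]
    have h4 : σ + s ≤ ‖x + e - y‖ := by
      refine abs_le_of_sq_le_sq' ?_ (norm_nonneg _) |>.2
      rw [h3]
      have : (σ + δ) * (-τ) ≤ (σ + δ) * inner ℝ e w := by gcongr
      linarith
    have h5 := norm_sub_le_norm_sub_add_norm_sub (x + e) a y
    linarith [(abs_le.1 (hfdist a)).1]
  refine ⟨?_, ?_, fun heq => ?_⟩
  · refine ((infDist_le_dist_of_mem hc).trans_eq (dist_eq_norm _ _)).trans_lt ?_
    have h1 : ‖x + e - c‖ ≤ h - 2 * τ := by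
      refine abs_le_of_sq_le_sq' ?_ (by linarith) |>.2
      have h2 : x + e - c = δ • w + e := by rw [← hxw]; abel
      rw [h2, norm_add_sq_real, norm_smul, hw1, mul_one, Real.norm_of_nonneg hδ0.le,
        real_inner_smul_left, real_inner_comm]
      have h3 : δ * inner ℝ e w ≤ h * τ := by
        have : δ * inner ℝ e w ≤ δ * τ := by gcongr
        nlinarith
      nlinarith
    linarith [(abs_le.1 (hfdist c)).2]
  · have := lower (δ - 2 * τ) (by linarith) (by nlinarith [sq_nonneg ‖e‖])
    linarith
  · have := lower (δ + κ * (h - δ) + 2 * τ) (by nlinarith [mul_pos hκ0 (sub_pos.2 hδh)]) (by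
      rw [heq]
      have := IsCore.κ_bounds h0 hσ hκ (sub_pos.2 hδh) (by ring : δ = h - (h - δ)) (by linarith)
        hτ hτ0
      convert this using 2
      ring)
    linarith

end Core

section Stage

open Filter Topology

lemma IsCompact.exists_margin {α : Type*} [TopologicalSpace α] {K : Set α} (hK : IsCompact K)
    {f : α → ℝ} (hf : ContinuousOn f K) {c : ℝ} (h : ∀ x ∈ K, f x < c) :
    ∃ μ > 0, ∀ x ∈ K, f x ≤ c - μ := by
  rcases K.eq_empty_or_nonempty with rfl | hne
  · exact ⟨1, one_pos, by simp⟩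
  · obtain ⟨x, hx, hmax⟩ := hK.exists_isMaxOn hne hf
    refine ⟨c - f x, sub_pos.2 (h x hx), fun y hy => ?_⟩
    have : f y ≤ f x := hmax hy
    linarith

lemma abs_infDist_sub_infDist_le (A : Set R3) (x y : R3) :
    |infDist x A - infDist y A| ≤ ‖x - y‖ := by
  have h1 := infDist_le_infDist_add_dist (s := A) (x := x) (y := y)
  have h2 := infDist_le_infDist_add_dist (s := A) (x := y) (y := x)
  rw [dist_comm] at h2
  rw [← dist_eq_norm, abs_le]
  constructor <;> linarith

/-- One step of the recursion: the boundary of the surface is pushed towards the frontier of the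
domain while an annulus becomes expensive to cross. -/
lemma IsCore.exists_stage {C A : Set R3} {h σ : ℝ} (H : IsCore C A h σ) (S : NullCurve)
    {r d τ : ℝ} (hr0 : 0 ≤ r) (hr : r < 1) (hτ : 0 < τ) (hd : d ≤ h / 2)
    (hS : ∀ z : ℂ, ‖z‖ ≤ 1 → S.surf z ∈ C)
    (hSd : ∀ z : ℂ, r ≤ ‖z‖ → ‖z‖ ≤ 1 → h - infDist (S.surf z) A < d) :
    ∃ (S' : NullCurve) (r' : ℝ), r < r' ∧ r' < 1 ∧ 1 - r' ≤ (1 - r) / 2 ∧ S.Near S' r τ ∧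
      (∀ z : ℂ, ‖z‖ ≤ 1 → S'.surf z ∈ C) ∧
      (∀ z : ℂ, r' ≤ ‖z‖ → ‖z‖ ≤ 1 →
        h - infDist (S'.surf z) A < (1 - h / (8 * (σ + h))) * d) ∧
      (∀ z : ℂ, r ≤ ‖z‖ → ‖z‖ ≤ 1 → h - infDist (S'.surf z) A < 2 * d) ∧
      (∀ z : ℂ, ‖z‖ ≤ 1 → ‖S'.surf z - S.surf z‖ ≤ √(h * d / 2) + τ) ∧
      Cross S'.lam r r' 1 := by
  have h0 := H.h_pos
  have hσ := H.σ_nonneg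
  set κ := h / (8 * (σ + h)) with hκ
  have hκ0 : 0 < κ := by positivity
  have hκ1 : κ ≤ 1 / 8 := by rw [hκ, div_le_iff₀ (by positivity)]; linarith
  obtain ⟨π, hπc, hπ⟩ := exists_metric_projection H.nonempty H.isCompact H.convex
  have hcont : ∀ T : NullCurve, Continuous fun z => infDist (T.surf z) A := fun T =>
    (continuous_infDist_pt A).comp T.continuous_surf
  have hB : IsCompact {z : ℂ | ‖z‖ ≤ 1} := by
    simpa [closedBall, dist_zero_right] using isCompact_closedBall (0 : ℂ) 1
  have hB' : IsCompact {z : ℂ | r ≤ ‖z‖ ∧ ‖z‖ ≤ 1} :=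
    hB.inter_left (isClosed_le continuous_const continuous_norm)
  obtain ⟨μ, hμ, hSμ⟩ := hB.exists_margin (hcont S).continuousOn fun z hz =>
    (H.mem_iff _).1 (hS z hz)
  have hμd : μ < d := by
    have h1 := hSd 1 (by simpa using hr.le) (by simp)
    have h2 := hSμ 1 (by simp)
    linarith
  obtain ⟨τ₁, hτ₁, hτ₁τ, hτ₁μ⟩ : ∃ τ₁ > 0, τ₁ ≤ τ / 2 ∧ τ₁ ≤ κ * μ / 16 :=
    ⟨min (τ / 2) (κ * μ / 16), by positivity, min_le_left _ _, min_le_right _ _⟩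
  have hτ₁μ' : 3 * τ₁ < μ := by nlinarith
  have hsph : ∀ ζ ∈ sphere (0 : ℂ) 1, ‖ζ‖ = 1 := fun ζ hζ => norm_eq_one_of_mem_sphere hζ
  have hδ2 : ∀ ζ ∈ sphere (0 : ℂ) 1, h / 2 ≤ infDist (S.surf ζ) A := fun ζ hζ => by
    have := hSd ζ (by rw [hsph ζ hζ]; exact hr.le) (hsph ζ hζ).le
    linarith
  have hpos : ∀ ζ ∈ sphere (0 : ℂ) 1, 0 < ‖S.surf ζ - π (S.surf ζ)‖ := fun ζ hζ => by
    rw [← (hπ _).2.1]; linarith [hδ2 ζ hζ]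
  have hc1 : Continuous fun ζ => S.surf ζ - π (S.surf ζ) :=
    S.continuous_surf.sub (hπc.comp S.continuous_surf)
  have hlc : Continuous fun ζ => √(h * (h - infDist (S.surf ζ) A) / 2) := by
    have := hcont S
    fun_prop
  obtain ⟨S₁, ρ, ρ', hrρ, hρ0, hρρ', hρ'1, hnear, -, hmove⟩ := S.exists_orthogonal_deformation
    (w := fun ζ => ‖S.surf ζ - π (S.surf ζ)‖⁻¹ • (S.surf ζ - π (S.surf ζ)))
    (l := fun ζ => √(h * (h - infDist (S.surf ζ) A) / 2))
    ((hc1.norm.continuousOn.inv₀ fun ζ hζ => (hpos ζ hζ).ne').smul hc1.continuousOn)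
    (fun ζ hζ => by rw [norm_smul, norm_inv, norm_norm, inv_mul_cancel₀ (hpos ζ hζ).ne'])
    hlc.continuousOn (show (1 + r) / 2 < 1 by linarith) hτ₁ le_rfl fun ζ _ => Real.sqrt_nonneg _
  have hnn : ∀ ζ ∈ sphere (0 : ℂ) 1, 0 < h - infDist (S.surf ζ) A := fun ζ hζ => by
    linarith [hSμ ζ (hsph ζ hζ).le]
  have hpush : ∀ ζ ∈ sphere (0 : ℂ) 1, ∀ t : ℝ, ρ ≤ t → t ≤ 1 →
      infDist (S₁.surf (t * ζ)) A < h ∧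
      h - infDist (S₁.surf (t * ζ)) A < 2 * (h - infDist (S.surf ζ) A) ∧
      (t = 1 → h - infDist (S₁.surf (t * ζ)) A < (1 - κ) * (h - infDist (S.surf ζ) A)) := by
    intro ζ hζ t ht ht1
    obtain ⟨-, e, he, he1, hew, hf⟩ := hmove ζ hζ t ht ht1
    obtain ⟨hcA, hdist, hin⟩ := hπ (S.surf ζ)
    have hsqr : √(h * (h - infDist (S.surf ζ) A) / 2) ^ 2 = h * (h - infDist (S.surf ζ) A) / 2 :=
      Real.sq_sqrt (by have := hnn ζ hζ; positivity)
    have key := H.push (e := e) (f := S₁.surf (t * ζ) - S.surf ζ - e) (τ := τ₁)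
      (hS ζ (hsph ζ hζ).le) hcA (hδ2 ζ hζ) hdist hin
      ((pow_le_pow_left₀ (norm_nonneg _) he 2).trans_eq hsqr) hew hf hτ₁ (hτ₁μ.trans (by
        have : μ ≤ h - infDist (S.surf ζ) A := by linarith [hSμ ζ (hsph ζ hζ).le]
        gcongr))
    have e1 : S.surf ζ + e + (S₁.surf (t * ζ) - S.surf ζ - e) = S₁.surf (t * ζ) := by abel
    rw [e1] at key
    exact ⟨key.1, key.2.1, fun h1 => key.2.2 (by rw [he1 h1, hsqr])⟩
  have hpolar : ∀ z : ℂ, 0 < ‖z‖ → ∃ ζ ∈ sphere (0 : ℂ) 1, (‖z‖ : ℂ) * ζ = z := fun z hz => by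
    have hz' : (‖z‖ : ℂ) ≠ 0 := by exact_mod_cast hz.ne'
    refine ⟨z / ‖z‖, ?_, mul_div_cancel₀ _ hz'⟩
    rw [mem_sphere_zero_iff_norm, norm_div, Complex.norm_real, norm_norm, div_self hz.ne']
  have hsmall : ∀ z : ℂ, ‖z‖ ≤ ρ → |infDist (S₁.surf z) A - infDist (S.surf z) A| < μ := by
    intro z hz
    refine (abs_infDist_sub_infDist_le A _ _).trans_lt (lt_of_le_of_lt ?_ hτ₁μ')
    exact NullCurve.norm_surf_sub_le (hnear z hz).1
  have hS₁ : ∀ z ∈ {z : ℂ | ‖z‖ ≤ 1}, infDist (S₁.surf z) A < h := by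
    intro z hz
    rcases le_total ‖z‖ ρ with hzρ | hzρ
    · linarith [(abs_lt.1 (hsmall z hzρ)).2, hSμ z hz]
    · obtain ⟨ζ, hζ, he⟩ := hpolar z (by linarith)
      have := (hpush ζ hζ ‖z‖ hzρ hz).1
      rwa [he] at this
  have hS₁d : ∀ z ∈ {z : ℂ | r ≤ ‖z‖ ∧ ‖z‖ ≤ 1}, h - infDist (S₁.surf z) A < 2 * d := by
    rintro z ⟨hzr, hz⟩
    rcases le_total ‖z‖ ρ with hzρ | hzρ
    · linarith [(abs_lt.1 (hsmall z hzρ)).1, hSd z hzr hz]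
    · obtain ⟨ζ, hζ, he⟩ := hpolar z (by linarith)
      have := (hpush ζ hζ ‖z‖ hzρ hz).2.1
      rw [he] at this
      linarith [hSd ζ (by rw [hsph ζ hζ]; exact hr.le) (hsph ζ hζ).le]
  have hS₁s : ∀ ζ ∈ sphere (0 : ℂ) 1, h - infDist (S₁.surf ζ) A < (1 - κ) * d := by
    intro ζ hζ
    have h1 := (hpush ζ hζ 1 (by linarith) le_rfl).2.2 rfl
    rw [Complex.ofReal_one, one_mul] at h1
    refine h1.trans ?_
    have := hSd ζ (by rw [hsph ζ hζ]; exact hr.le) (hsph ζ hζ).le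
    exact mul_lt_mul_of_pos_left this (by linarith)
  have hcd : Continuous fun z => h - infDist (S₁.surf z) A := continuous_const.sub (hcont S₁)
  obtain ⟨μ₁, hμ₁, hm₁⟩ := hB.exists_margin (hcont S₁).continuousOn hS₁
  obtain ⟨μ₂, hμ₂, hm₂⟩ := hB'.exists_margin hcd.continuousOn hS₁d
  obtain ⟨μ₃, hμ₃, hm₃⟩ := (isCompact_sphere (0 : ℂ) 1).exists_margin hcd.continuousOn hS₁s
  obtain ⟨ρ₁, hρ₁1, hρ₁0, hρ₁⟩ := exists_radius_norm_sub_le hcd (half_pos hμ₃)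
  set r₂ := max ρ ρ₁ with hr₂
  have hr₂1 : r₂ < 1 := max_lt (by linarith) hρ₁1
  obtain ⟨η, hη, hη1, hη2, hη3, hη4⟩ :
      ∃ η > 0, η < μ₁ ∧ η < μ₂ ∧ η < μ₃ / 2 ∧ η ≤ τ / 2 := by
    refine ⟨min (min (μ₁ / 2) (μ₂ / 2)) (min (μ₃ / 4) (τ / 2)), by positivity, ?_, ?_, ?_, ?_⟩
    · exact (min_le_left _ _).trans_lt ((min_le_left _ _).trans_lt (by linarith))
    · exact (min_le_left _ _).trans_lt ((min_le_right _ _).trans_lt (by linarith))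
    · exact (min_le_right _ _).trans_lt ((min_le_left _ _).trans_lt (by linarith))
    · exact (min_le_right _ _).trans (min_le_right _ _)
  obtain ⟨S', r', hr'1, hr'2, hnear', hmove', hcross⟩ := S₁.exists_cross (L := 1) hr₂1 hη
  have hρr₂ : ρ ≤ r₂ := le_max_left _ _
  have hdiff : ∀ z : ℂ, ‖z‖ ≤ 1 → |infDist (S'.surf z) A - infDist (S₁.surf z) A| ≤ η :=
    fun z hz => (abs_infDist_sub_infDist_le A _ _).trans (hmove' z hz)
  refine ⟨S', r', by linarith, hr'2, by linarith, ?_, fun z hz => ?_, fun z hz1 hz2 => ?_,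
    fun z hz1 hz2 => ?_, fun z hz => ?_, (Cross.refl.skip (by linarith : r ≤ r₂)).trans hcross
      |>.mono (by linarith)⟩
  · exact ((hnear.mono (by linarith) le_rfl).trans (hnear'.mono (by linarith) le_rfl)).mono le_rfl
      (by linarith)
  · rw [H.mem_iff]
    linarith [(abs_le.1 (hdiff z hz)).2, hm₁ z hz]
  · obtain ⟨ζ, hζ, he⟩ := hpolar z (by linarith)
    have h1 := hρ₁ ζ hζ ‖z‖ ((le_max_right ρ ρ₁).trans (hr'1.le.trans hz1)) hz2
    rw [he, Real.norm_eq_abs] at h1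
    linarith [(abs_le.1 (hdiff z hz2)).1, (abs_le.1 h1).2, hm₃ ζ hζ]
  · linarith [(abs_le.1 (hdiff z hz2)).1, hm₂ z ⟨hz1, hz2⟩]
  · refine NullCurve.norm_surf_sub_le_of_sphere (fun ζ hζ => ?_) hz
    have h1 := hmove' ζ (hsph ζ hζ).le
    obtain ⟨-, e, he, -, -, hf⟩ := hmove ζ hζ 1 (by linarith) le_rfl
    rw [Complex.ofReal_one, one_mul] at hf
    have h2 : √(h * (h - infDist (S.surf ζ) A) / 2) ≤ √(h * d / 2) := by
      have := (hSd ζ (by rw [hsph ζ hζ]; exact hr.le) (hsph ζ hζ).le).le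
      gcongr
    have e1 : S'.surf ζ - S.surf ζ = (S'.surf ζ - S₁.surf ζ) + (S₁.surf ζ - S.surf ζ - e) + e := by
      abel
    rw [e1]
    refine (norm_add₃_le).trans ?_
    linarith

end Stage

section InitialSurface

open Polynomial Filter Topology

lemma exists_mem_sphere_ne_near {ζ₀ : ℂ} (hζ₀ : ζ₀ ∈ sphere (0 : ℂ) 1) {δ : ℝ} (hδ : 0 < δ) :
    ∃ ζ ∈ sphere (0 : ℂ) 1, ζ ≠ ζ₀ ∧ ‖ζ - ζ₀‖ < δ := by
  have hn := norm_eq_one_of_mem_sphere hζ₀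
  have hc : Continuous fun θ : ℝ => ζ₀ * Complex.exp (θ * Complex.I) := by fun_prop
  have h1 := Metric.continuous_iff.1 hc 0 δ hδ
  obtain ⟨s, hs, H⟩ := h1
  have hs' : 0 < min (s / 2) 1 := by positivity
  refine ⟨ζ₀ * Complex.exp ((min (s / 2) 1 : ℝ) * Complex.I), ?_, fun h => ?_, ?_⟩
  · rw [mem_sphere_zero_iff_norm, norm_mul, hn, Complex.norm_exp_ofReal_mul_I, one_mul]
  · have h0 : ζ₀ ≠ 0 := by rintro rfl; simp at hn
    have h2 : Complex.exp ((min (s / 2) 1 : ℝ) * Complex.I) = 1 := mul_left_cancel₀ h0 (by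
      rw [h, mul_one])
    have h3 := congrArg Complex.im h2
    rw [Complex.exp_ofReal_mul_I_im, Complex.one_im] at h3
    have := Real.sin_pos_of_pos_of_lt_pi hs'
      ((min_le_right _ _).trans_lt (by linarith [Real.pi_gt_three]))
    exact this.ne' h3
  · have := H (min (s / 2) 1) (by
      rw [Real.dist_eq, sub_zero, abs_of_pos hs']
      exact (min_le_left _ _).trans_lt (by linarith))
    simpa [dist_eq_norm] using this

/-- A finite set is approachable if nearly flat polynomial minimal disks contained in the
`b`-neighbourhood of `K` have boundaries passing arbitrarily close to all its points. -/
def Approachable (K : Set R3) (b : ℝ) (T : Finset R3) : Prop :=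
  ∀ τ > 0, ∃ S : NullCurve, (∀ z : ℂ, ‖z‖ ≤ 1 → S.surf z ∈ thickening b K) ∧
    ∀ x ∈ T, ∃ ζ ∈ sphere (0 : ℂ) 1, ‖S.surf ζ - x‖ < τ

lemma approachable_singleton {K : Set R3} {b : ℝ} (hb : 0 < b) {x : R3} (hx : x ∈ K) :
    Approachable K b {x} := by
  intro τ hτ
  set s : ℝ := min 1 (min τ b / 2) with hs
  have hs0 : 0 < s := by positivity
  let S : NullCurve :=
    { u := C (s : ℂ)
      v := 0
      F := fun i => C (nullVec s 0 i) * X + C (x i : ℂ)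
      ne := fun z => Or.inl (by simpa using hs0.ne')
      deriv_F := fun i => by fin_cases i <;> simp [nullPoly, nullVec] }
  have hS : ∀ z : ℂ, ‖z‖ ≤ 1 → ‖S.surf z - x‖ < min τ b := by
    intro z hz
    have e : S.surf z - x = reVec (z • nullVec s 0) := by
      ext i
      have e1 : (S.F i).eval z = nullVec s 0 i * z + x i := by simp [S]
      rw [PiLp.sub_apply, NullCurve.surf, reVec_apply, reVec_apply, e1, Complex.add_re,
        Complex.ofReal_re, add_sub_cancel_right, mul_comm]
      rfl
    rw [e, norm_reVec_smul_nullVec, norm_zero, Complex.norm_real, Real.norm_of_nonneg hs0.le]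
    have h1 : s ≤ 1 := min_le_left _ _
    have h2 : s ≤ min τ b / 2 := min_le_right _ _
    have h3 : s ^ 2 ≤ s := by nlinarith
    have h4 : ‖z‖ * (s ^ 2 + 0 ^ 2) ≤ 1 * (s ^ 2 + 0 ^ 2) := by gcongr
    have h5 : 0 < min τ b := by positivity
    linarith
  refine ⟨S, fun z hz => mem_thickening_iff.2 ⟨x, hx, ?_⟩, fun y hy => ⟨1, by simp, ?_⟩⟩
  · rw [dist_eq_norm]; exact (hS z hz).trans_le (min_le_right _ _)
  · rw [Finset.mem_singleton.1 hy]
    exact (hS 1 (by simp)).trans_le (min_le_left _ _)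

lemma Approachable.insert [DecidableEq R3] {K : Set R3} {b : ℝ} {T : Finset R3}
    (hT : Approachable K b T) {x y : R3} (hxT : x ∈ T) (hx : x ∈ K) (hxy : ‖x - y‖ < b / 2) :
    Approachable K b (insert y T) := by
  intro τ hτ
  have hb : 0 < b := by linarith [norm_nonneg (x - y)]
  set τ₀ := min (τ / 5) (b / 16) with hτ₀
  have hτ₀0 : 0 < τ₀ := by positivity
  have hτ₀τ : τ₀ ≤ τ / 5 := min_le_left _ _
  have hτ₀b : τ₀ ≤ b / 16 := min_le_right _ _
  obtain ⟨S, hS, hST⟩ := hT τ₀ hτ₀0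
  obtain ⟨ζ₀, hζ₀, hxζ₀⟩ := hST x hxT
  obtain ⟨s, hs, hsS⟩ := Metric.continuous_iff.1 S.continuous_surf ζ₀ τ₀ hτ₀0
  obtain ⟨ζ₁, hζ₁, hne, hζ₁s⟩ := exists_mem_sphere_ne_near hζ₀ hs
  have hN : 0 < ‖ζ₁ - ζ₀‖ := norm_pos_iff.2 (sub_ne_zero.2 hne)
  have hB : IsCompact {z : ℂ | ‖z‖ ≤ 1} := by
    simpa [closedBall, dist_zero_right] using isCompact_closedBall (0 : ℂ) 1
  have hthick : ∀ p : R3, p ∈ thickening b K ↔ infDist p K < b := fun p =>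
    mem_thickening_iff_infDist_lt ⟨x, hx⟩
  obtain ⟨μ, hμ, hSμ⟩ := hB.exists_margin
    ((continuous_infDist_pt K).comp S.continuous_surf).continuousOn
    (fun z hz => (hthick _).1 (hS z hz))
  simp only [comp_apply, mem_ofPred_eq] at hSμ
  set τ₁ := min τ₀ (μ / 4) with hτ₁
  have hτ₁0 : 0 < τ₁ := by positivity
  have hτ₁τ : τ₁ ≤ τ₀ := min_le_left _ _
  have hτ₁μ : 3 * τ₁ < μ := by linarith [min_le_right τ₀ (μ / 4)]
  let χ : ℂ → ℝ := fun ζ => max 0 (1 - ‖ζ - ζ₀‖ / ‖ζ₁ - ζ₀‖)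
  have hχc : Continuous χ := by fun_prop
  have hχ0 : ∀ ζ, 0 ≤ χ ζ := fun ζ => le_max_left _ _
  have hχ1 : ∀ ζ, χ ζ ≤ 1 := fun ζ => max_le zero_le_one (by
    have : 0 ≤ ‖ζ - ζ₀‖ / ‖ζ₁ - ζ₀‖ := by positivity
    linarith)
  have hχζ₀ : χ ζ₀ = 1 := by simp [χ]
  have hχζ₁ : χ ζ₁ = 0 := by simp [χ, div_self hN.ne']
  have hχs : ∀ ζ, χ ζ ≠ 0 → ‖S.surf ζ - S.surf ζ₀‖ < τ₀ := by
    intro ζ hζ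
    rw [← dist_eq_norm]
    refine hsS ζ ?_
    rw [dist_eq_norm]
    by_contra hcon
    refine hζ (max_eq_left ?_)
    rw [sub_nonpos, one_le_div hN]
    linarith
  have hζ₁S : ‖S.surf ζ₁ - S.surf ζ₀‖ < τ₀ := by
    rw [← dist_eq_norm]
    exact hsS ζ₁ (by rwa [dist_eq_norm])
  obtain ⟨p₁, p₂, hp⟩ := exists_reVec_nullVec_eq (y - S.surf ζ₀)
  have hpn : ‖p₁‖ ^ 2 + ‖p₂‖ ^ 2 = ‖y - S.surf ζ₀‖ := by
    rw [← hp, ← one_smul ℂ (nullVec p₁ p₂), norm_reVec_smul_nullVec, norm_one, one_mul]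
  obtain ⟨S', ρ, ρ', -, hρ0, hρρ', hρ'1, hnear, -, hy, hmove⟩ := S.exists_deformation
    (q₁ := fun ζ => (χ ζ : ℂ) * p₁) (q₂ := fun ζ => (χ ζ : ℂ) * p₂)
    (by fun_prop) (by fun_prop) hζ₀ one_half_lt_one hτ₁0 le_rfl (fun ζ _ => by positivity)
  simp only [hχζ₀, Complex.ofReal_one, one_mul, hp] at hy
  have hsph : ∀ ζ ∈ sphere (0 : ℂ) 1, ‖ζ‖ = 1 := fun ζ hζ => norm_eq_one_of_mem_sphere hζ
  have hin : ∀ {z w : ℂ}, ‖w‖ ≤ 1 → ‖S'.surf z - S.surf w‖ ≤ 3 * τ₁ →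
      S'.surf z ∈ thickening b K := by
    intro z w hw hzw
    rw [hthick]
    have := (abs_le.1 ((abs_infDist_sub_infDist_le K _ _).trans hzw)).2
    linarith [hSμ w hw]
  have hstay : ∀ ζ ∈ sphere (0 : ℂ) 1, χ ζ = 0 → ∀ t : ℝ, ρ ≤ t → t ≤ 1 →
      ‖S'.surf (t * ζ) - S.surf ζ‖ ≤ τ₁ := by
    intro ζ hζ h0 t ht ht1
    obtain ⟨-, φ, -, -, hφ⟩ := hmove ζ hζ t ht ht1
    have e0 : reVec (φ • nullVec ((χ ζ : ℂ) * p₁) ((χ ζ : ℂ) * p₂)) = 0 := by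
      rw [← norm_eq_zero, norm_reVec_smul_nullVec, h0]
      simp
    rwa [e0, sub_zero] at hφ
  refine ⟨S', fun z hz => ?_, fun x' hx' => ?_⟩
  · rcases le_total ‖z‖ ρ with hzρ | hzρ
    · exact hin hz (NullCurve.norm_surf_sub_le (hnear z hzρ).1)
    rcases eq_or_lt_of_le (norm_nonneg z) with hz0 | hz0
    · exact hin hz (NullCurve.norm_surf_sub_le (hnear z (by linarith)).1)
    have hz' : (‖z‖ : ℂ) ≠ 0 := by exact_mod_cast hz0.ne'
    obtain ⟨ζ, hζ, hζz⟩ : ∃ ζ ∈ sphere (0 : ℂ) 1, (‖z‖ : ℂ) * ζ = z :=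
      ⟨z / ‖z‖, by simp [div_self hz0.ne'], mul_div_cancel₀ _ hz'⟩
    by_cases hχ : χ ζ = 0
    · have := hstay ζ hζ hχ ‖z‖ hzρ hz
      rw [hζz] at this
      exact hin (hsph ζ hζ).le (this.trans (by linarith))
    · obtain ⟨-, φ, hφ1, -, hφ⟩ := hmove ζ hζ ‖z‖ hzρ hz
      rw [hζz] at hφ
      set e := reVec (φ • nullVec ((χ ζ : ℂ) * p₁) ((χ ζ : ℂ) * p₂)) with he
      have hen : ‖e‖ ≤ ‖y - S.surf ζ₀‖ := by
        rw [he, norm_reVec_smul_nullVec, norm_mul, norm_mul, Complex.norm_real,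
          Real.norm_of_nonneg (hχ0 ζ), mul_pow, mul_pow, ← mul_add, hpn, ← mul_assoc]
        refine mul_le_of_le_one_left (norm_nonneg _) ?_
        exact mul_le_one₀ hφ1 (by positivity) (pow_le_one₀ (hχ0 ζ) (hχ1 ζ))
      refine mem_thickening_iff.2 ⟨x, hx, ?_⟩
      rw [dist_eq_norm]
      have e1 : S'.surf z - x = (S'.surf z - S.surf ζ - e) + (S.surf ζ - S.surf ζ₀) +
        (S.surf ζ₀ - x) + e := by abel
      have e2 : y - S.surf ζ₀ = -(x - y) - (S.surf ζ₀ - x) := by abel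
      have h1 := norm_sub_le (-(x - y)) (S.surf ζ₀ - x)
      rw [← e2, norm_neg] at h1
      have h2 := norm_add₄_le (a := S'.surf z - S.surf ζ - e) (b := S.surf ζ - S.surf ζ₀)
        (c := S.surf ζ₀ - x) (d := e)
      rw [← e1] at h2
      linarith [hχs ζ hχ]
  · rcases Finset.mem_insert.1 hx' with rfl | hx'
    · refine ⟨ζ₀, hζ₀, ?_⟩
      have : S'.surf ζ₀ - S.surf ζ₀ - (x' - S.surf ζ₀) = S'.surf ζ₀ - x' := by abel
      rw [this] at hy
      linarith
    · obtain ⟨ζ, hζ, hx'ζ⟩ := hST x' hx'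
      by_cases hχ : χ ζ = 0
      · have h2 := hstay ζ hζ hχ 1 (by linarith) le_rfl
        rw [Complex.ofReal_one, one_mul] at h2
        have := norm_sub_le_norm_sub_add_norm_sub (S'.surf ζ) (S.surf ζ) x'
        exact ⟨ζ, hζ, by linarith⟩
      · have h2 := hstay ζ₁ hζ₁ hχζ₁ 1 (by linarith) le_rfl
        rw [Complex.ofReal_one, one_mul] at h2
        have h3 := hχs ζ hχ
        refine ⟨ζ₁, hζ₁, ?_⟩
        have e1 : S'.surf ζ₁ - x' = (S'.surf ζ₁ - S.surf ζ₁) + (S.surf ζ₁ - S.surf ζ₀) +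
          (S.surf ζ - x') - (S.surf ζ - S.surf ζ₀) := by abel
        rw [e1]
        refine (norm_sub_le _ _).trans_lt ?_
        have := norm_add₃_le (a := S'.surf ζ₁ - S.surf ζ₁) (b := S.surf ζ₁ - S.surf ζ₀)
          (c := S.surf ζ - x')
        linarith

/-- Every compact connected set is nearly filled by the boundary of a polynomial minimal disk lying
in a small neighbourhood. -/
lemma exists_nullCurve_near_connected {K : Set R3} (hK : IsCompact K) (hconn : IsConnected K)
    {b : ℝ} (hb : 0 < b) :
    ∃ S : NullCurve, (∀ z : ℂ, ‖z‖ ≤ 1 → S.surf z ∈ thickening b K) ∧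
      ∀ x ∈ K, ∃ ζ ∈ sphere (0 : ℂ) 1, ‖S.surf ζ - x‖ < b := by
  classical
  obtain ⟨N, hNK, hNfin, hcov⟩ := hK.finite_cover_balls (show 0 < b / 4 by positivity)
  lift N to Finset R3 using hNfin
  obtain ⟨x₀, hx₀⟩ := hconn.nonempty
  have hcov' : ∀ x ∈ K, ∃ n ∈ N, ‖x - n‖ < b / 4 := fun x hx => by
    obtain ⟨n, hn, hxn⟩ := mem_iUnion₂.1 (hcov hx)
    exact ⟨n, hn, by rwa [mem_ball, dist_eq_norm] at hxn⟩
  obtain ⟨n₀, hn₀, -⟩ := hcov' x₀ hx₀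
  have main : ∀ k : ℕ, k < N.card → ∃ T ⊆ N, T.card = k + 1 ∧ Approachable K b T := by
    intro k
    induction k with
    | zero => exact fun _ => ⟨{n₀}, by simpa using hn₀, by simp,
        approachable_singleton hb (hNK hn₀)⟩
    | succ k ih =>
      intro hk
      obtain ⟨T, hTN, hTc, hT⟩ := ih (by omega)
      let U : Finset R3 → Set R3 := fun P => ⋃ t ∈ P, ball t (b / 4)
      have hU : ∀ P, IsOpen (U P) := fun P => isOpen_biUnion fun _ _ => isOpen_ball
      have hmemU : ∀ P x, x ∈ U P ↔ ∃ t ∈ P, ‖x - t‖ < b / 4 := fun P x => by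
        simp [U, dist_eq_norm]
      have hne : ∀ P ⊆ N, P.Nonempty → (K ∩ U P).Nonempty := fun P hP ⟨t, ht⟩ =>
        ⟨t, hNK (hP ht), (hmemU P t).2 ⟨t, ht, by simpa using by positivity⟩⟩
      have hTne : T.Nonempty := Finset.card_pos.1 (by omega)
      have hNT : (N \ T).Nonempty := by
        rw [← Finset.card_pos, Finset.card_sdiff_of_subset hTN]; omega
      obtain ⟨z, -, hz1, hz2⟩ := hconn.isPreconnected (U T) (U (N \ T)) (hU _) (hU _)
        (fun x hx => by
          obtain ⟨n, hn, hxn⟩ := hcov' x hx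
          by_cases hnT : n ∈ T
          · exact Or.inl ((hmemU _ _).2 ⟨n, hnT, hxn⟩)
          · exact Or.inr ((hmemU _ _).2 ⟨n, Finset.mem_sdiff.2 ⟨hn, hnT⟩, hxn⟩))
        (hne T hTN hTne) (hne _ Finset.sdiff_subset hNT)
      obtain ⟨t, ht, hzt⟩ := (hmemU _ _).1 hz1
      obtain ⟨n, hn, hzn⟩ := (hmemU _ _).1 hz2
      obtain ⟨hnN, hnT⟩ := Finset.mem_sdiff.1 hn
      refine ⟨insert n T, Finset.insert_subset hnN hTN, ?_, hT.insert ht (hNK (hTN ht)) ?_⟩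
      · rw [Finset.card_insert_of_notMem hnT, hTc]
      · have := norm_sub_le_norm_sub_add_norm_sub t z n
        rw [norm_sub_rev t z] at this
        linarith
  have hNc : 0 < N.card := Finset.card_pos.2 ⟨n₀, hn₀⟩
  obtain ⟨T, hTN, hTc, hT⟩ := main (N.card - 1) (by omega)
  have hTN' : T = N := Finset.eq_of_subset_of_card_le hTN (by omega)
  subst hTN'
  obtain ⟨S, hS1, hS2⟩ := hT (b / 4) (by positivity)
  refine ⟨S, hS1, fun x hx => ?_⟩
  obtain ⟨n, hn, hxn⟩ := hcov' x hx
  obtain ⟨ζ, hζ, h⟩ := hS2 n hn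
  refine ⟨ζ, hζ, ?_⟩
  have := norm_sub_le_norm_sub_add_norm_sub (S.surf ζ) n x
  rw [norm_sub_rev n x] at this
  linarith

end InitialSurface

section PathLength

open Filter Topology

/-- A local lower bound for increments gives a lower bound for the variation along a path. -/
lemma ofReal_sub_le_eVariationOn {γ : ℝ → ℂ} {X : ℂ → R3} {g : ℂ → ℝ} {s t : ℝ} (hst : s ≤ t)
    (hγ : ContinuousOn γ (Icc s t))
    (hloc : ∀ u ∈ Icc s t, ∃ V : Set ℂ, IsOpen V ∧ γ u ∈ V ∧
      ∀ z₁ ∈ V, ∀ z₂ ∈ V, |g z₁ - g z₂| ≤ ‖X z₁ - X z₂‖) :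
    ENNReal.ofReal (g (γ t) - g (γ s)) ≤ eVariationOn (X ∘ γ) (Icc s t) := by
  choose! V hVo hVm hV using hloc
  obtain ⟨p, hp0, hpm, ⟨n, hn⟩, hp⟩ := exists_monotone_Icc_subset_open_cover_Icc hst
    (c := fun u : Icc s t => (Icc s t).domRestrict γ ⁻¹' V u)
    (fun u => (hVo u u.2).preimage hγ.domRestrict)
    (fun u _ => mem_iUnion.2 ⟨u, hVm u u.2⟩)
  have h1 := eVariationOn.sum_le (f := X ∘ γ) (s := Icc s t) (n := n) (u := fun i => (p i : ℝ))
    (fun i j hij => hpm hij) (fun i => (p i).2)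
  refine le_trans ?_ h1
  have h2 : g (γ t) - g (γ s) = ∑ i ∈ Finset.range n, (g (γ (p (i + 1))) - g (γ (p i))) := by
    rw [Finset.sum_range_sub (fun i => g (γ (p i))), hp0, hn n le_rfl]
  rw [h2]
  refine (ENNReal.ofReal_le_ofReal (Finset.sum_le_sum fun i _ => le_abs_self _)).trans ?_
  rw [ENNReal.ofReal_sum_of_nonneg fun _ _ => abs_nonneg _]
  refine Finset.sum_le_sum fun i _ => ?_
  obtain ⟨u, hu⟩ := hp i
  rw [edist_dist, dist_eq_norm]
  exact ENNReal.ofReal_le_ofReal (hV u u.2 _ (hu ⟨hpm i.le_succ, le_rfl⟩) _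
    (hu ⟨le_rfl, hpm i.le_succ⟩))

lemma abs_clamp_sub_le (a b x y : ℝ) : |max a (min b x) - max a (min b y)| ≤ |x - y| := by
  have h1 := abs_max_sub_max_le_max a (min b x) a (min b y)
  have h2 := abs_min_sub_min_le_max b x b y
  simp only [sub_self, abs_zero, abs_nonneg, sup_of_le_right] at h1 h2
  exact h1.trans h2

lemma exists_increment_bound {X : ℂ → R3} {D : ℂ →L[ℝ] R3} {z : ℂ} {lz : ℝ}
    (hX : HasStrictFDerivAt X D z) (hD : ∀ v, ‖D v‖ = lz * ‖v‖) {M : ℝ} (hM : M < lz) :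
    ∃ V : Set ℂ, IsOpen V ∧ z ∈ V ∧ ∀ z₁ ∈ V, ∀ z₂ ∈ V, M * ‖z₁ - z₂‖ ≤ ‖X z₁ - X z₂‖ := by
  have h1 := hX.isLittleO.bound (sub_pos.2 hM)
  rw [nhds_prod_eq] at h1
  obtain ⟨V, ⟨hz, hVo⟩, hV⟩ := (nhds_basis_opens z).prod_self.eventually_iff.1 h1
  refine ⟨V, hVo, hz, fun z₁ h₁ z₂ h₂ => ?_⟩
  have h2 : ‖X z₁ - X z₂ - D (z₁ - z₂)‖ ≤ (lz - M) * ‖z₁ - z₂‖ :=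
    @hV (z₁, z₂) (mk_mem_prod h₁ h₂)
  have h3 := norm_sub_norm_le (D (z₁ - z₂)) (X z₁ - X z₂)
  rw [norm_sub_rev (D (z₁ - z₂)), hD] at h3
  linarith

lemma Cross.le_eVariationOn {X : ℂ → R3} {D : ℂ → ℂ →L[ℝ] R3} {l : ℂ → ℝ}
    (hX : ∀ z ∈ ball (0 : ℂ) 1, HasStrictFDerivAt X (D z) z)
    (hD : ∀ z ∈ ball (0 : ℂ) 1, ∀ v, ‖D z v‖ = l z * ‖v‖) {r r' L : ℝ} (h : Cross l r r' L)
    {γ : ℝ → ℂ} {s t : ℝ} (hst : s ≤ t) (hγ : ContinuousOn γ (Icc s t))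
    (hγU : MapsTo γ (Icc s t) (ball 0 1)) (hs : ‖γ s‖ ≤ r) (ht : r' ≤ ‖γ t‖) :
    ENNReal.ofReal L ≤ eVariationOn (X ∘ γ) (Icc s t) := by
  induction h generalizing t with
  | refl => simp
  | skip _ hab ih => exact ih hst hγ hγU (hab.trans ht)
  | mono _ hL ih => exact (ENNReal.ofReal_le_ofReal hL).trans (ih hst hγ hγU ht)
  | @step a b L M gap hc hab hM hgap hl ih =>
    obtain ⟨m, hm, hγm⟩ := intermediate_value_Icc hst hγ.norm
      (show a ∈ Icc ‖γ s‖ ‖γ t‖ from ⟨hs.trans hc.le, hab.trans ht⟩)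
    have hsub₁ : Icc s m ⊆ Icc s t := Icc_subset_Icc le_rfl hm.2
    have hsub₂ : Icc m t ⊆ Icc s t := Icc_subset_Icc hm.1 le_rfl
    have h1 := ih hm.1 (hγ.mono hsub₁) (hγU.mono_left hsub₁) hγm.ge
    have h2 : ENNReal.ofReal (M * (b - a)) ≤ eVariationOn (X ∘ γ) (Icc m t) := by
      let g : ℂ → ℝ := fun z => M * max a (min b ‖z‖)
      have hg : ∀ z₁ z₂, |g z₁ - g z₂| ≤ M * ‖z₁ - z₂‖ := fun z₁ z₂ => by
        rw [← mul_sub, abs_mul, abs_of_nonneg hM]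
        gcongr
        exact (abs_clamp_sub_le _ _ _ _).trans (abs_norm_sub_norm_le _ _)
      have key := ofReal_sub_le_eVariationOn (X := X) (g := g) hm.2 (hγ.mono hsub₂) (by
        intro u hu
        have hU := hγU (hsub₂ hu)
        rcases lt_or_ge ‖γ u‖ a with h3 | h3
        · refine ⟨{z | ‖z‖ < a}, isOpen_lt continuous_norm continuous_const, h3,
            fun z₁ h₁ z₂ h₂ => ?_⟩
          have e : ∀ z : ℂ, ‖z‖ < a → g z = M * a := fun z hz => by
            simp only [g]; rw [max_eq_left ((min_le_right _ _).trans hz.le)]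
          rw [e z₁ h₁, e z₂ h₂, sub_self, abs_zero]
          exact norm_nonneg _
        rcases lt_or_ge b ‖γ u‖ with h4 | h4
        · refine ⟨{z | b < ‖z‖}, isOpen_lt continuous_const continuous_norm, h4,
            fun z₁ h₁ z₂ h₂ => ?_⟩
          have e : ∀ z : ℂ, b < ‖z‖ → g z = M * max a b := fun z hz => by
            simp only [g]; rw [min_eq_left hz.le]
          rw [e z₁ h₁, e z₂ h₂, sub_self, abs_zero]
          exact norm_nonneg _
        obtain ⟨V, hVo, hV, H⟩ := exists_increment_bound (hX _ hU) (hD _ hU)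
          (show M < l (γ u) by linarith [hl _ h3 h4])
        exact ⟨V, hVo, hV, fun z₁ h₁ z₂ h₂ => (hg z₁ z₂).trans (H z₁ h₁ z₂ h₂)⟩)
      refine le_trans (ENNReal.ofReal_le_ofReal (le_of_eq ?_)) key
      simp only [g]
      rw [show ‖γ m‖ = a from hγm, min_eq_left ht, min_eq_right hab, max_self, max_eq_right hab, mul_sub]
    have h3 := eVariationOn.Icc_add_Icc (X ∘ γ) (s := univ) hm.1 hm.2 (mem_univ m)
    simp only [univ_inter] at h3
    rw [← h3]
    exact ENNReal.ofReal_add_le.trans (add_le_add h1 h2)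

/-- A surface with a sequence of expensive annuli exhausting the disk is complete. -/
lemma completeOn_of_cross {X : ℂ → R3} {D : ℂ → ℂ →L[ℝ] R3} {l : ℂ → ℝ}
    (hX : ∀ z ∈ ball (0 : ℂ) 1, HasStrictFDerivAt X (D z) z)
    (hD : ∀ z ∈ ball (0 : ℂ) 1, ∀ v, ‖D z v‖ = l z * ‖v‖) {r : ℕ → ℝ}
    (hr : ∀ k, r k < 1) (hr1 : Tendsto r atTop (𝓝 1))
    (hcross : ∀ k, Cross l (r k) (r (k + 1)) 1) : CompleteOn X (ball 0 1) := by
  rintro γ ⟨hγ, hγU, hdiv⟩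
  have h0 : ‖γ 0‖ < 1 := by simpa using hγU (show (0 : ℝ) ∈ Ico 0 1 by simp)
  obtain ⟨k, hk⟩ := (hr1.eventually (lt_mem_nhds h0)).exists
  have hc : ∀ n : ℕ, Cross l (r k) (r (k + n)) n := by
    intro n
    induction n with
    | zero => simpa using Cross.refl
    | succ n ih => simpa [add_assoc] using ih.trans (hcross (k + n))
  refine ENNReal.eq_top_of_forall_nnreal_le fun q => ?_
  obtain ⟨n, hn⟩ := exists_nat_ge (q : ℝ)
  obtain ⟨t₀, ht₀, H⟩ := hdiv (closedBall 0 (r (k + n))) (isCompact_closedBall _ _)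
    (closedBall_subset_ball (hr _))
  have ht := H t₀ ⟨le_rfl, ht₀.2⟩
  rw [mem_closedBall_zero_iff, not_le] at ht
  have hsub : Icc 0 t₀ ⊆ Ico (0 : ℝ) 1 := Icc_subset_Ico_right ht₀.2
  have key := (hc n).le_eVariationOn hX hD ht₀.1 (hγ.mono hsub) (hγU.mono_left hsub) hk.le ht.le
  refine le_trans ?_ (key.trans (eVariationOn.mono _ hsub))
  rw [← ENNReal.ofReal_coe_nnreal]
  exact ENNReal.ofReal_le_ofReal hn

end PathLength

section Limit

open Polynomial Filter Topology

lemma hasFDerivAt_re_mul {G : ℂ → ℂ} {w : ℂ} (hG : DifferentiableAt ℂ G w) (c : ℂ) :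
    HasFDerivAt (fun w => (G w * c).re)
      (Complex.reCLM ∘L (ContinuousLinearMap.toSpanSingleton ℂ (deriv G w * c)).restrictScalars ℝ)
      w := by
  have h := (hG.hasDerivAt.mul_const c).hasFDerivAt.restrictScalars ℝ
  exact Complex.reCLM.hasFDerivAt.comp w h

lemma fderiv_re_mul {G : ℂ → ℂ} {w : ℂ} (hG : DifferentiableAt ℂ G w) (c v : ℂ) :
    fderiv ℝ (fun w => (G w * c).re) w v = (v * (deriv G w * c)).re := by
  rw [(hasFDerivAt_re_mul hG c).fderiv]
  simp

lemma harmOn_re {G : ℂ → ℂ} {U : Set ℂ} (hU : IsOpen U) (hG : DifferentiableOn ℂ G U) :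
    HarmOn (fun z => (G z).re) U := by
  intro z hz
  have hG' : DifferentiableOn ℂ (deriv G) U := hG.deriv hU
  have key : ∀ v : ℂ, (fun w => fderiv ℝ (fun z => (G z).re) w v) =ᶠ[𝓝 z]
      fun w => (deriv G w * v).re := fun v => by
    filter_upwards [hU.mem_nhds hz] with w hw
    have := fderiv_re_mul (hG.differentiableAt (hU.mem_nhds hw)) 1 v
    simpa [mul_comm] using this
  have hd := hG'.differentiableAt (hU.mem_nhds hz)
  rw [(key 1).fderiv_eq, (key Complex.I).fderiv_eq, fderiv_re_mul hd, fderiv_re_mul hd]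
  simp

/-- The real part of a holomorphic null curve is a conformal minimal immersion. -/
lemma conformal_of_null {G : Fin 3 → ℂ → ℂ} {U : Set ℂ} (hU : IsOpen U)
    (hG : ∀ i, DifferentiableOn ℂ (G i) U)
    (hnull : ∀ z ∈ U, deriv (G 0) z ^ 2 + deriv (G 1) z ^ 2 + deriv (G 2) z ^ 2 = 0) :
    ContDiffOn ℝ (⊤ : ℕ∞) (fun z => reVec fun i => G i z) U ∧
    (∀ i, HarmOn (fun z => (reVec fun i => G i z) i) U) ∧
    ∀ z ∈ U, HasStrictFDerivAt (fun z => reVec fun i => G i z)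
        (fderiv ℝ (fun z => reVec fun i => G i z) z) z ∧
      ∀ v, ‖fderiv ℝ (fun z => reVec fun i => G i z) z v‖ =
        √((‖deriv (G 0) z‖ ^ 2 + ‖deriv (G 1) z‖ ^ 2 + ‖deriv (G 2) z‖ ^ 2) / 2) * ‖v‖ := by
  have hcd : ContDiffOn ℝ (⊤ : ℕ∞) (fun z => reVec fun i => G i z) U := by
    rw [contDiffOn_euclidean]
    intro i
    simp only [reVec_apply]
    exact Complex.reCLM.contDiff.comp_contDiffOn ((hG i).contDiffOn hU |>.restrict_scalars ℝ)
  refine ⟨hcd, fun i => ?_, fun z hz => ?_⟩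
  · simpa only [reVec_apply] using harmOn_re hU (hG i)
  · have hat := hcd.contDiffAt (hU.mem_nhds hz)
    have hstrict := hat.hasStrictFDerivAt (by simp)
    refine ⟨hstrict, fun v => ?_⟩
    have hv : fderiv ℝ (fun z => reVec fun i => G i z) z v = reVec (v • fun i => deriv (G i) z) := by
      ext i
      have h1 := (hasStrictFDerivAt_euclidean.1 hstrict i).hasFDerivAt
      have h2 := fderiv_re_mul ((hG i).differentiableAt (hU.mem_nhds hz)) 1 v
      simp only [mul_one] at h2
      simp only [reVec_apply] at h1
      rw [h1.fderiv] at h2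
      simpa using h2
    have h3 := norm_reVec_smul_sq (ν := fun i => deriv (G i) z) (hnull z hz) v
    rw [hv]
    refine (sq_eq_sq₀ (norm_nonneg _) (by positivity)).1 ?_
    rw [h3, mul_pow, Real.sq_sqrt (by positivity), mul_comm]

lemma norm_sub_le_of_step {E : Type*} [SeminormedAddCommGroup E] {a : ℕ → E} {t : ℕ → ℝ}
    (ht2 : ∀ k, t (k + 1) ≤ t k / 2) {k : ℕ}
    (h : ∀ m, k ≤ m → ‖a (m + 1) - a m‖ ≤ t m) {m : ℕ} (hkm : k ≤ m) :
    ‖a m - a k‖ ≤ 2 * t k - 2 * t m := by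
  induction m, hkm using Nat.le_induction with
  | base => simp
  | succ m hm ih =>
    have := norm_sub_le_norm_sub_add_norm_sub (a (m + 1)) (a m) (a k)
    linarith [h m hm, ht2 m]

lemma tendsto_zero_of_half {t : ℕ → ℝ} (ht : ∀ k, 0 < t k) (ht2 : ∀ k, t (k + 1) ≤ t k / 2) :
    Tendsto t atTop (𝓝 0) := by
  have h1 : ∀ k, t k ≤ t 0 * (1 / 2) ^ k := by
    intro k
    induction k with
    | zero => simp
    | succ k ih => rw [pow_succ]; linarith [ht2 k]
  have h2 : Tendsto (fun k : ℕ => t 0 * (1 / 2 : ℝ) ^ k) atTop (𝓝 0) := by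
    simpa using (tendsto_pow_atTop_nhds_zero_of_lt_one (by norm_num : (0 : ℝ) ≤ 1 / 2)
      (by norm_num)).const_mul (t 0)
  exact squeeze_zero (fun k => (ht k).le) h1 h2

/-- Locally uniform limits of polynomial null curves. -/
lemma NullCurve.exists_limit {S : ℕ → NullCurve} {r t : ℕ → ℝ} (hr : Monotone r)
    (hr1 : Tendsto r atTop (𝓝 1)) (ht : ∀ k, 0 < t k) (ht2 : ∀ k, t (k + 1) ≤ t k / 2)
    (hnear : ∀ k, (S k).Near (S (k + 1)) (r k) (t k))
    (hlam : ∀ k z, ‖z‖ ≤ r k → 2 * t k < (S k).lam z) :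
    ∃ (ψ : ℂ → R3) (l : ℂ → ℝ), ConfMinImmOn ψ (ball 0 1) ∧
      (∀ z ∈ ball (0 : ℂ) 1, HasStrictFDerivAt ψ (fderiv ℝ ψ z) z) ∧
      (∀ z ∈ ball (0 : ℂ) 1, ∀ v, ‖fderiv ℝ ψ z v‖ = l z * ‖v‖) ∧
      ∀ k z, z ∈ ball (0 : ℂ) 1 → ‖z‖ ≤ r k →
        ‖ψ z - (S k).surf z‖ ≤ 6 * t k ∧ (S k).lam z - 2 * t k ≤ l z := by
  have ht0 := tendsto_zero_of_half ht ht2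
  have hstep : ∀ k z, ‖z‖ ≤ r k → ∀ i m, k ≤ m →
      ‖((S m).F i).eval z - ((S k).F i).eval z‖ ≤ 2 * t k := fun k z hz i m hkm => by
    have := norm_sub_le_of_step (a := fun m => ((S m).F i).eval z) ht2
      (fun m hm => (hnear m z (hz.trans (hr hm))).1 i) hkm
    linarith [ht m]
  have hstepl : ∀ k z, ‖z‖ ≤ r k → ∀ m, k ≤ m → |(S m).lam z - (S k).lam z| ≤ 2 * t k :=
    fun k z hz m hkm => by
    have := norm_sub_le_of_step (a := fun m => (S m).lam z) ht2
      (fun m hm => (hnear m z (hz.trans (hr hm))).2) hkm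
    rw [Real.norm_eq_abs] at this
    linarith [ht m]
  have hin : ∀ z ∈ ball (0 : ℂ) 1, ∃ k, ‖z‖ < r k := fun z hz =>
    (hr1.eventually (lt_mem_nhds (by simpa using hz))).exists
  have hlim : ∀ i z, ∃ w, z ∈ ball (0 : ℂ) 1 →
      Tendsto (fun m => ((S m).F i).eval z) atTop (𝓝 w) := by
    intro i z
    by_cases hz : z ∈ ball (0 : ℂ) 1
    · obtain ⟨k, hk⟩ := hin z hz
      have hc : CauchySeq fun m => ((S m).F i).eval z := by
        refine Metric.cauchySeq_iff'.2 fun ε hε => ?_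
        have h1 : ∀ᶠ m in atTop, t m < ε / 2 := ht0.eventually (gt_mem_nhds (by positivity))
        obtain ⟨N, hN, hkN⟩ := (h1.and (eventually_ge_atTop k)).exists
        refine ⟨N, fun n hn => ?_⟩
        rw [dist_eq_norm]
        linarith [hstep N z (hk.le.trans (hr hkN)) i n hn]
      obtain ⟨w, hw⟩ := cauchySeq_tendsto_of_complete hc
      exact ⟨w, fun _ => hw⟩
    · exact ⟨0, fun h => absurd h hz⟩
  choose G hGlim using hlim
  have hGk : ∀ k z, z ∈ ball (0 : ℂ) 1 → ‖z‖ ≤ r k → ∀ i,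
      ‖G i z - ((S k).F i).eval z‖ ≤ 2 * t k := fun k z hz hzk i =>
    le_of_tendsto ((hGlim i z hz).sub_const _).norm
      (eventually_atTop.2 ⟨k, fun m hm => hstep k z hzk i m hm⟩)
  have hunif : ∀ i, TendstoLocallyUniformlyOn (fun m z => ((S m).F i).eval z) (G i) atTop
      (ball 0 1) := by
    intro i
    rw [Metric.tendstoLocallyUniformlyOn_iff]
    intro ε hε z hz
    obtain ⟨k, hk⟩ := hin z hz
    have h1 : ∀ᶠ m in atTop, t m < ε / 2 := ht0.eventually (gt_mem_nhds (by positivity))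
    have h2 : {w : ℂ | ‖w‖ < r k} ∈ 𝓝 z := (isOpen_lt continuous_norm continuous_const).mem_nhds hk
    refine ⟨ball 0 1 ∩ {w | ‖w‖ < r k}, inter_mem_nhdsWithin _ h2, ?_⟩
    filter_upwards [h1, eventually_ge_atTop k] with m hm hkm w hw
    have hwk : ‖w‖ < r k := hw.2
    rw [dist_eq_norm]
    linarith [hGk m w hw.1 (hwk.le.trans (hr hkm)) i]
  have hpd : ∀ m i, Differentiable ℂ fun z => ((S m).F i).eval z := fun m i =>
    ((S m).F i).differentiable
  have hGd : ∀ i, DifferentiableOn ℂ (G i) (ball 0 1) := fun i =>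
    (hunif i).differentiableOn (Eventually.of_forall fun m => (hpd m i).differentiableOn) isOpen_ball
  have hGder : ∀ i, ∀ z ∈ ball (0 : ℂ) 1,
      Tendsto (fun m => nullVec ((S m).u.eval z) ((S m).v.eval z) i) atTop (𝓝 (deriv (G i) z)) := by
    intro i z hz
    have h1 := ((hunif i).deriv (Eventually.of_forall fun m => (hpd m i).differentiableOn)
      isOpen_ball).tendsto_at hz
    refine h1.congr fun m => ?_
    simp only [comp_apply]
    rw [Polynomial.deriv, (S m).deriv_F, eval_nullPoly]
  have hnull : ∀ z ∈ ball (0 : ℂ) 1,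
      deriv (G 0) z ^ 2 + deriv (G 1) z ^ 2 + deriv (G 2) z ^ 2 = 0 := fun z hz => by
    have h1 := (((hGder 0 z hz).pow 2).add ((hGder 1 z hz).pow 2)).add ((hGder 2 z hz).pow 2)
    refine tendsto_nhds_unique h1 ?_
    simp only [sum_nullVec_sq]
    exact tendsto_const_nhds
  set l : ℂ → ℝ := fun z =>
    √((‖deriv (G 0) z‖ ^ 2 + ‖deriv (G 1) z‖ ^ 2 + ‖deriv (G 2) z‖ ^ 2) / 2) with hl
  have hlamlim : ∀ z ∈ ball (0 : ℂ) 1, Tendsto (fun m => (S m).lam z) atTop (𝓝 (l z)) := by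
    intro z hz
    have h1 := (((hGder 0 z hz).norm.pow 2).add ((hGder 1 z hz).norm.pow 2)).add
      ((hGder 2 z hz).norm.pow 2)
    refine ((h1.div_const 2).sqrt).congr fun m => ?_
    rw [sum_norm_nullVec_sq, mul_div_cancel_left₀ _ two_ne_zero, Real.sqrt_sq (by positivity)]
    rfl
  have hlk : ∀ k z, z ∈ ball (0 : ℂ) 1 → ‖z‖ ≤ r k → |l z - (S k).lam z| ≤ 2 * t k :=
    fun k z hz hzk => le_of_tendsto ((hlamlim z hz).sub_const _).abs
      (eventually_atTop.2 ⟨k, fun m hm => hstepl k z hzk m hm⟩)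
  obtain ⟨c1, c2, c3⟩ := conformal_of_null isOpen_ball hGd hnull
  refine ⟨_, l, ⟨c1, c2, fun z hz => ⟨l z, ?_, (c3 z hz).2⟩⟩, fun z hz => (c3 z hz).1,
    fun z hz => (c3 z hz).2, fun k z hz hzk => ⟨?_, ?_⟩⟩
  · obtain ⟨k, hk⟩ := hin z hz
    linarith [(abs_le.1 (hlk k z hz hk.le)).1, hlam k z hk.le]
  · rw [NullCurve.surf, ← reVec_sub]
    refine (norm_reVec_le_of_forall (c := 2 * t k) fun i => hGk k z hz hzk i).trans (by linarith)
  · linarith [(abs_le.1 (hlk k z hz hzk)).1]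

end Limit

section Recursion

open Filter Topology

lemma isCompact_norm_le_one : IsCompact {z : ℂ | ‖z‖ ≤ 1} := by
  simpa [closedBall, dist_zero_right] using isCompact_closedBall (0 : ℂ) 1

/-- The data of one level of the recursion: a null curve `S`, a radius `r`, a tolerance `t` for
later perturbations and a bound `d` for the distance to the boundary of the image of the annulus
`r ≤ ‖z‖ ≤ 1`. -/
structure Level where
  S : NullCurve
  r : ℝ
  t : ℝ
  d : ℝ

/-- The invariants of the recursion. -/
structure Level.Admissible (A : Set R3) (h : ℝ) (L : Level) : Prop where
  r_nonneg : 0 ≤ L.r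
  r_lt : L.r < 1
  t_pos : 0 < L.t
  d_le : L.d ≤ h / 2
  t_le : 6 * L.t ≤ L.d
  inside : ∀ z : ℂ, ‖z‖ ≤ 1 → infDist (L.S.surf z) A + 6 * L.t < h
  near : ∀ z : ℂ, L.r ≤ ‖z‖ → ‖z‖ ≤ 1 → h - infDist (L.S.surf z) A < L.d
  lam : ∀ z : ℂ, ‖z‖ ≤ 1 → 2 * L.t < L.S.lam z

/-- The relation between consecutive levels of the recursion. -/
structure Level.Step (A : Set R3) (h κ : ℝ) (L L' : Level) : Prop where
  r_lt : L.r < L'.r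
  r_half : 1 - L'.r ≤ (1 - L.r) / 2
  t_half : L'.t ≤ L.t / 2
  d_eq : L'.d = (1 - κ) * L.d
  near : L.S.Near L'.S L.r L.t
  annulus : ∀ z : ℂ, L.r ≤ ‖z‖ → ‖z‖ ≤ 1 → h - infDist (L'.S.surf z) A < 2 * L.d
  displacement : ∀ z : ℂ, ‖z‖ ≤ 1 → ‖L'.S.surf z - L.S.surf z‖ ≤ √(h * L.d / 2) + L.t
  cross : ∀ l : ℂ → ℝ, (∀ z, ‖z‖ ≤ L'.r → L'.S.lam z - 2 * L'.t ≤ l z) → Cross l L.r L'.r 1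

lemma IsCore.exists_tolerance {C A : Set R3} {h σ : ℝ} (H : IsCore C A h σ) (S : NullCurve)
    (hS : ∀ z : ℂ, ‖z‖ ≤ 1 → S.surf z ∈ C) {τ : ℝ} (hτ : 0 < τ) :
    ∃ t > 0, t ≤ τ ∧ (∀ z : ℂ, ‖z‖ ≤ 1 → infDist (S.surf z) A + 6 * t < h) ∧
      ∀ z : ℂ, ‖z‖ ≤ 1 → 2 * t < S.lam z := by
  obtain ⟨μ, hμ, h1⟩ := isCompact_norm_le_one.exists_margin
    ((continuous_infDist_pt A).comp S.continuous_surf).continuousOn fun z hz =>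
      (H.mem_iff _).1 (hS z hz)
  obtain ⟨ν, hν, h2⟩ := isCompact_norm_le_one.exists_margin (c := 0)
    S.continuous_lam.neg.continuousOn fun z _ => neg_lt_zero.2 (S.lam_pos z)
  refine ⟨min τ (min (μ / 7) (ν / 3)), by positivity, min_le_left _ _, fun z hz => ?_,
    fun z hz => ?_⟩
  · have := h1 z hz
    simp only [comp_apply] at this
    linarith [(min_le_right τ _).trans (min_le_left (μ / 7) (ν / 3))]
  · have : -S.lam z ≤ 0 - ν := h2 z hz
    linarith [(min_le_right τ _).trans (min_le_right (μ / 7) (ν / 3))]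

lemma IsCore.exists_step {C A : Set R3} {h σ : ℝ} (H : IsCore C A h σ) {L : Level}
    (hL : L.Admissible A h) :
    ∃ L' : Level, L'.Admissible A h ∧ L.Step A h (h / (8 * (σ + h))) L' := by
  have h0 := H.h_pos
  have hσ := H.σ_nonneg
  have hd0 : 0 < L.d := by linarith [hL.t_pos, hL.t_le]
  obtain ⟨S', r', hrr', hr'1, hhalf, hnear, hin, hann', hann, hdisp, hcross⟩ :=
    H.exists_stage L.S hL.r_nonneg hL.r_lt hL.t_pos hL.d_le
      (fun z hz => (H.mem_iff _).2 (by linarith [hL.inside z hz, hL.t_pos])) hL.near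
  set κ := h / (8 * (σ + h)) with hκ
  have hκ0 : 0 < κ := by positivity
  have hκ1 : κ ≤ 1 / 8 := by rw [hκ, div_le_iff₀ (by positivity)]; linarith
  have hd' : 0 < (1 - κ) * L.d := mul_pos (by linarith) hd0
  obtain ⟨τ, hτ, hrob⟩ := hcross.robust
  obtain ⟨t, ht, hle, h1, h2⟩ := H.exists_tolerance S' hin
    (τ := min (L.t / 2) (min (τ / 2) ((1 - κ) * L.d / 6)))
    (lt_min (half_pos hL.t_pos) (lt_min (half_pos hτ) (by positivity)))
  obtain ⟨ht1, ht23⟩ := le_min_iff.1 hle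
  obtain ⟨ht2, ht3⟩ := le_min_iff.1 ht23
  refine ⟨⟨S', r', t, (1 - κ) * L.d⟩, ⟨hL.r_nonneg.trans hrr'.le, hr'1, ht, ?_, ?_, h1, hann', h2⟩,
    ⟨hrr', hhalf, ht1, rfl, hnear, hann, hdisp, fun l hl => hrob l fun z hz => ?_⟩⟩
  · have := hL.d_le
    have := mul_pos hκ0 hd0
    show (1 - κ) * L.d ≤ h / 2
    linarith
  · show 6 * t ≤ (1 - κ) * L.d
    linarith
  · have := hl z hz
    dsimp only at this
    linarith

lemma exists_seq_of_step {α : Type*} {P : α → Prop} {R : α → α → Prop} {a : α} (ha : P a)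
    (h : ∀ x, P x → ∃ y, P y ∧ R x y) :
    ∃ f : ℕ → α, f 0 = a ∧ (∀ n, P (f n)) ∧ ∀ n, R (f n) (f (n + 1)) := by
  choose g hg using fun x : {x // P x} => h x.1 x.2
  let f : ℕ → {x // P x} := fun n => Nat.rec ⟨a, ha⟩ (fun _ x => ⟨g x, (hg x).1⟩) n
  exact ⟨fun n => (f n).1, rfl, fun n => (f n).2, fun n => (hg (f n)).2⟩

/-- A null curve whose boundary lies close to the boundary of the domain can be perturbed into a
complete proper minimal disc. -/
lemma IsCore.exists_complete_proper {C A : Set R3} {h σ : ℝ} (H : IsCore C A h σ) {L : Level}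
    (hL : L.Admissible A h) :
    ∃ ψ : ℂ → R3, ConfMinImmOn ψ (ball 0 1) ∧ CompleteOn ψ (ball 0 1) ∧ MapsTo ψ (ball 0 1) C ∧
      (∀ η > 0, ∃ ρ < 1, ∀ z : ℂ, ρ ≤ ‖z‖ → ‖z‖ < 1 → h - infDist (ψ z) A < η) ∧
      ∀ z ∈ ball (0 : ℂ) 1, ‖ψ z - L.S.surf z‖ ≤
        √(h * L.d / 2) / (1 - √(1 - h / (8 * (σ + h)))) + 8 * L.t := by
  have h0 := H.h_pos
  have hσ := H.σ_nonneg
  obtain ⟨f, rfl, hf, hstep⟩ := exists_seq_of_step hL fun L hL => H.exists_step hL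
  set κ := h / (8 * (σ + h)) with hκ
  have hκ0 : 0 < κ := by positivity
  have hκ1 : κ ≤ 1 / 8 := by rw [hκ, div_le_iff₀ (by positivity)]; linarith
  have hmono : Monotone fun k => (f k).r := monotone_nat_of_le_succ fun k => (hstep k).r_lt.le
  have ht0 : Tendsto (fun k => (f k).t) atTop (𝓝 0) :=
    tendsto_zero_of_half (fun k => (hf k).t_pos) fun k => (hstep k).t_half
  have hr1 : Tendsto (fun k => (f k).r) atTop (𝓝 1) := by
    have h1 := tendsto_zero_of_half (t := fun k => 1 - (f k).r)
      (fun k => sub_pos.2 (hf k).r_lt) fun k => (hstep k).r_half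
    simpa using h1.const_sub 1
  have hd : ∀ k, (f k).d = (1 - κ) ^ k * (f 0).d := by
    intro k
    induction k with
    | zero => simp
    | succ k ih => rw [(hstep k).d_eq, ih, pow_succ]; ring
  have hd0 : Tendsto (fun k => (f k).d) atTop (𝓝 0) := by
    rw [funext hd]
    simpa using (tendsto_pow_atTop_nhds_zero_of_lt_one (by linarith : 0 ≤ 1 - κ)
      (by linarith)).mul_const (f 0).d
  have hdpos : ∀ k, 0 < (f k).d := fun k => by linarith [(hf k).t_pos, (hf k).t_le]
  have hq1 : √(1 - κ) < 1 := by
    rw [Real.sqrt_lt' one_pos]; linarith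
  obtain ⟨ψ, l, hψ, hstrict, hl, hclose⟩ := NullCurve.exists_limit hmono hr1
    (fun k => (hf k).t_pos) (fun k => (hstep k).t_half) (fun k => (hstep k).near)
    fun k z hz => (hf k).lam z (hz.trans (hf k).r_lt.le)
  have hinf : ∀ k z, ‖z‖ ≤ (f k).r →
      |infDist (ψ z) A - infDist ((f k).S.surf z) A| ≤ 6 * (f k).t := fun k z hz =>
    (abs_infDist_sub_infDist_le A _ _).trans
      (hclose k z (by simpa using hz.trans_lt (hf k).r_lt) hz).1
  have hin : ∀ z ∈ ball (0 : ℂ) 1, ∃ k, ‖z‖ < (f k).r := fun z hz =>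
    (hr1.eventually (lt_mem_nhds (by simpa using hz))).exists
  refine ⟨ψ, hψ, completeOn_of_cross hstrict hl (fun k => (hf k).r_lt) hr1 fun k =>
    (hstep k).cross l fun z hz => ?_, fun z hz => ?_, fun η hη => ?_, fun z hz => ?_⟩
  · exact (hclose (k + 1) z (by simpa using hz.trans_lt (hf (k + 1)).r_lt) hz).2
  · obtain ⟨k, hk⟩ := hin z hz
    rw [H.mem_iff]
    linarith [(abs_le.1 (hinf k z hk.le)).2, (hf k).inside z (hk.trans (hf k).r_lt).le]
  · obtain ⟨m, hm⟩ := (hd0.eventually (gt_mem_nhds (by positivity : 0 < η / 3))).exists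
    refine ⟨(f m).r, (hf m).r_lt, fun z hmz hz => ?_⟩
    have hex := hin z (by simpa using hz)
    classical
    have hspec := Nat.find_spec hex
    have hmin := fun j => Nat.find_min hex (m := j)
    generalize Nat.find hex = n at hspec hmin
    have hmn : m < n := by
      by_contra! hnm
      exact absurd (hmono hnm) (not_le.2 (hspec.trans_le' hmz))
    obtain ⟨k, rfl⟩ : ∃ k, n = k + 1 := ⟨n - 1, by omega⟩
    have hkz : (f k).r ≤ ‖z‖ := not_lt.1 (hmin k (Nat.lt_succ_self k))
    have h1 := (hstep k).annulus z hkz hz.le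
    have h2 := (abs_le.1 (hinf (k + 1) z hspec.le)).1
    have h3 := (hf (k + 1)).t_le
    have h4 : (f (k + 1)).d ≤ (f k).d := by
      rw [(hstep k).d_eq]
      linarith [mul_pos hκ0 (hdpos k)]
    have h5 : (f k).d ≤ (f m).d := by
      rw [hd k, hd m]
      exact mul_le_mul_of_nonneg_right
        (pow_le_pow_of_le_one (by linarith) (by linarith) (by omega)) (hdpos 0).le
    linarith
  · set V : ℕ → ℝ := fun k => √(h * (f k).d / 2) / (1 - √(1 - κ)) + 2 * (f k).t with hV
    have hVpos : ∀ k, 0 ≤ V k := fun k => by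
      have := (hf k).t_pos
      have : 0 < 1 - √(1 - κ) := by linarith
      positivity
    have hVstep : ∀ k, √(h * (f k).d / 2) + (f k).t ≤ V k - V (k + 1) := fun k => by
      have h1 : √(h * (f (k + 1)).d / 2) = √(1 - κ) * √(h * (f k).d / 2) := by
        rw [(hstep k).d_eq, ← Real.sqrt_mul (by linarith)]
        congr 1
        ring
      have h2 : 1 - √(1 - κ) ≠ 0 := by linarith
      have h3 : √(h * (f k).d / 2) = √(h * (f k).d / 2) / (1 - √(1 - κ)) -
          √(1 - κ) * √(h * (f k).d / 2) / (1 - √(1 - κ)) := by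
        field_simp
      have h4 := (hstep k).t_half
      simp only [hV, h1]
      linarith
    have hdisp : ∀ k, ‖(f k).S.surf z - (f 0).S.surf z‖ ≤ V 0 - V k := by
      have hz1 : ‖z‖ ≤ 1 := (by simpa using hz : ‖z‖ < 1).le
      intro k
      induction k with
      | zero => simp
      | succ k ih =>
        have h1 := (hstep k).displacement z hz1
        have h2 := norm_sub_le_norm_sub_add_norm_sub ((f (k + 1)).S.surf z) ((f k).S.surf z)
          ((f 0).S.surf z)
        linarith [hVstep k]
    have ht : ∀ k, (f k).t ≤ (f 0).t := fun k =>
      antitone_nat_of_succ_le (f := fun k => (f k).t)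
        (fun k => by linarith [(hstep k).t_half, (hf k).t_pos]) (Nat.zero_le k)
    obtain ⟨k, hk⟩ := hin z hz
    have h1 := (hclose k z hz hk.le).1
    have h2 := norm_sub_le_norm_sub_add_norm_sub (ψ z) ((f k).S.surf z) ((f 0).S.surf z)
    have h3 : V 0 = √(h * (f 0).d / 2) / (1 - √(1 - κ)) + 2 * (f 0).t := rfl
    linarith [hdisp k, hVpos k, ht k]

end Recursion

section LimitSet

open Filter Topology

variable {C A : Set R3} {h σ : ℝ} {ψ : ℂ → R3}

lemma IsCore.properIn (H : IsCore C A h σ) (hψ : ContinuousOn ψ (ball 0 1))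
    (hbd : ∀ η > 0, ∃ ρ < 1, ∀ z : ℂ, ρ ≤ ‖z‖ → ‖z‖ < 1 → h - infDist (ψ z) A < η) :
    ProperIn ψ (ball 0 1) C := by
  intro K hK hKC
  obtain ⟨η, hη, hle⟩ := hK.exists_margin (continuous_infDist_pt A).continuousOn
    fun x hx => (H.mem_iff x).1 (hKC hx)
  obtain ⟨ρ, hρ, hbd⟩ := hbd η hη
  have heq : ball (0 : ℂ) 1 ∩ ψ ⁻¹' K = closedBall 0 ρ ∩ ψ ⁻¹' K := by
    ext z
    refine ⟨fun ⟨hz, hzK⟩ => ⟨?_, hzK⟩, fun ⟨hz, hzK⟩ => ⟨closedBall_subset_ball hρ hz, hzK⟩⟩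
    rw [mem_ball_zero_iff] at hz
    rw [mem_closedBall_zero_iff]
    by_contra! hlt
    linarith [hbd z hlt.le hz, hle (ψ z) hzK]
  rw [heq]
  refine (isCompact_closedBall (0 : ℂ) ρ).of_isClosed_subset ?_ inter_subset_left
  exact (hψ.mono (closedBall_subset_ball hρ)).preimage_isClosed_of_isClosed isClosed_closedBall
    hK.isClosed

lemma IsCore.limitSet_eq (H : IsCore C A h σ) (hψ : ContinuousOn ψ (ball 0 1))
    (hmaps : MapsTo ψ (ball 0 1) C)
    (hbd : ∀ η > 0, ∃ ρ < 1, ∀ z : ℂ, ρ ≤ ‖z‖ → ‖z‖ < 1 → h - infDist (ψ z) A < η) :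
    limitSet ψ = closure (ψ '' ball 0 1) ∩ {y | h ≤ infDist y A} := by
  ext y
  refine ⟨fun ⟨hy, hy'⟩ => ⟨hy, ?_⟩, fun ⟨hy, hyh⟩ => ⟨hy, ?_⟩⟩
  · by_contra! hlt
    have hlt : infDist y A < h := by simpa using hlt
    obtain ⟨ρ, hρ, hbd⟩ := hbd ((h - infDist y A) / 2) (by linarith)
    have hU : IsOpen {x | infDist x A < h - (h - infDist y A) / 2} :=
      isOpen_lt (continuous_infDist_pt A) continuous_const
    have hyU : y ∈ {x | infDist x A < h - (h - infDist y A) / 2} := by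
      show infDist y A < h - (h - infDist y A) / 2
      linarith
    have hcl : IsClosed (ψ '' closedBall 0 ρ) :=
      ((isCompact_closedBall (0 : ℂ) ρ).image_of_continuousOn
        (hψ.mono (closedBall_subset_ball hρ))).isClosed
    have hsub : {x | infDist x A < h - (h - infDist y A) / 2} ∩ ψ '' ball 0 1 ⊆
        ψ '' closedBall 0 ρ := by
      rintro _ ⟨hx, z, hz, rfl⟩
      refine ⟨z, ?_, rfl⟩
      have hx : infDist (ψ z) A < h - (h - infDist y A) / 2 := hx
      rw [mem_ball_zero_iff] at hz
      rw [mem_closedBall_zero_iff]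
      by_contra! hlt
      linarith [hbd z hlt.le hz]
    have hmem := closure_minimal hsub hcl (hU.inter_closure ⟨hyU, hy⟩)
    exact hy' (image_mono (closedBall_subset_ball hρ) hmem)
  · rintro ⟨z, hz, rfl⟩
    exact absurd ((H.mem_iff _).1 (hmaps hz)) (not_lt.2 hyh)

/-- Every point of the unit circle produces a point of the limit set. -/
lemma IsCore.exists_mem_limitSet (H : IsCore C A h σ) (hC : Bornology.IsBounded C)
    (hψ : ContinuousOn ψ (ball 0 1)) (hmaps : MapsTo ψ (ball 0 1) C)
    (hbd : ∀ η > 0, ∃ ρ < 1, ∀ z : ℂ, ρ ≤ ‖z‖ → ‖z‖ < 1 → h - infDist (ψ z) A < η)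
    {f : ℂ → R3} (hf : Continuous f) {δ : ℝ} (hδ : ∀ z ∈ ball (0 : ℂ) 1, ‖ψ z - f z‖ ≤ δ)
    {ζ : ℂ} (hζ : ζ ∈ sphere (0 : ℂ) 1) :
    ∃ y ∈ limitSet ψ, ‖y - f ζ‖ ≤ δ := by
  have hζ1 : ‖ζ‖ = 1 := by simpa using hζ
  set s : ℕ → ℝ := fun n => 1 - 1 / ((n : ℝ) + 1) with hs
  have hs1 : Tendsto s atTop (𝓝 1) := by
    simpa [hs] using (tendsto_one_div_add_atTop_nhds_zero_nat (𝕜 := ℝ)).const_sub 1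
  have hs01 : ∀ n, 0 ≤ s n ∧ s n < 1 := fun n => by
    have h1 : (0 : ℝ) < 1 / ((n : ℝ) + 1) := by positivity
    have h2 : 1 / ((n : ℝ) + 1) ≤ 1 := by
      rw [div_le_one (by positivity)]
      linarith [(Nat.cast_nonneg n : (0 : ℝ) ≤ n)]
    exact ⟨by simp only [hs]; linarith, by simp only [hs]; linarith⟩
  set w : ℕ → ℂ := fun n => (s n : ℂ) * ζ with hw
  have hwn : ∀ n, ‖w n‖ = s n := fun n => by
    simp [hw, hζ1, abs_of_nonneg (hs01 n).1]
  have hwb : ∀ n, w n ∈ ball (0 : ℂ) 1 := fun n => by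
    rw [mem_ball_zero_iff, hwn]; exact (hs01 n).2
  have hwt : Tendsto w atTop (𝓝 ζ) := by
    simpa using ((Complex.continuous_ofReal.tendsto 1).comp hs1).mul_const ζ
  obtain ⟨y, -, φ, hφ, hy⟩ := hC.isCompact_closure.tendsto_subseq
    (x := fun n => ψ (w n)) fun n => subset_closure (hmaps (hwb n))
  have hft : Tendsto (fun n => f (w (φ n))) atTop (𝓝 (f ζ)) :=
    (hf.tendsto ζ).comp (hwt.comp hφ.tendsto_atTop)
  refine ⟨y, ?_, ?_⟩
  · rw [H.limitSet_eq hψ hmaps hbd]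
    refine ⟨mem_closure_of_tendsto hy (Eventually.of_forall fun n => ⟨_, hwb _, rfl⟩), ?_⟩
    show h ≤ infDist y A
    refine le_of_forall_pos_le_add fun η hη => ?_
    obtain ⟨ρ, hρ, hbd⟩ := hbd η hη
    have hlim : Tendsto (fun n => infDist (ψ (w (φ n))) A) atTop (𝓝 (infDist y A)) :=
      ((continuous_infDist_pt A).tendsto y).comp hy
    have hev : ∀ᶠ n in atTop, ρ < s (φ n) :=
      (hs1.comp hφ.tendsto_atTop).eventually (lt_mem_nhds hρ)
    have := ge_of_tendsto hlim (b := h - η) (hev.mono fun n hn => by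
      linarith [hbd (w (φ n)) (by rw [hwn]; exact hn.le) (by rw [hwn]; exact (hs01 _).2)])
    linarith
  · exact le_of_tendsto (hy.sub hft).norm (Eventually.of_forall fun n => hδ _ (hwb _))

end LimitSet

section Main

open Filter Topology

/-- A connected compact set in the boundary of the domain is approximated by the boundary of a null
curve inside the domain. -/
lemma IsCore.exists_initial {C A : Set R3} {h σ : ℝ} (H : IsCore C A h σ)
    (hCo : IsOpen C) {K : Set R3} (hconn : IsConnected K)
    (hK : IsCompact K) (hKC : K ⊆ frontier C) {d : ℝ} (hd : 0 < d) :
    ∃ S : NullCurve, (∀ z : ℂ, ‖z‖ ≤ 1 → S.surf z ∈ C) ∧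
      (∀ z : ℂ, ‖z‖ ≤ 1 → h - infDist (S.surf z) A < d) ∧
      (∀ z : ℂ, ‖z‖ ≤ 1 → ∃ x ∈ K, ‖S.surf z - x‖ < d) ∧
      ∀ x ∈ K, ∃ ζ ∈ sphere (0 : ℂ) 1, ‖S.surf ζ - x‖ < d := by
  have h0 := H.h_pos
  obtain ⟨o, ho⟩ := H.nonempty
  have hfr : ∀ x ∈ K, infDist x A = h := fun x hx => by
    refine le_antisymm ?_ (not_lt.1 fun hlt => ?_)
    · refine closure_minimal (s := C) (fun y hy => ((H.mem_iff y).1 hy).le)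
        (isClosed_le (continuous_infDist_pt A) continuous_const) (hKC hx).1
    · exact (hKC hx).2 (by rw [hCo.interior_eq]; exact (H.mem_iff x).2 hlt)
  obtain ⟨M, hM⟩ := hK.isBounded.subset_closedBall o
  have hMK : ∀ x ∈ K, ‖o - x‖ ≤ max M 0 := fun x hx => by
    rw [← dist_eq_norm, dist_comm]
    exact (mem_closedBall.1 (hM hx)).trans (le_max_left _ _)
  have hM0 : 0 ≤ max M 0 := le_max_right _ _
  generalize max M 0 = M at hMK hM0
  obtain ⟨s, hs0, hs1, hsd⟩ : ∃ s : ℝ, 0 < s ∧ s < 1 ∧ s * (M + h) < d := by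
    refine ⟨min (1 / 2) (d / (2 * (M + h))), by positivity, ?_, ?_⟩
    · linarith [min_le_left (1 / 2) (d / (2 * (M + h)))]
    · calc min (1 / 2) (d / (2 * (M + h))) * (M + h) ≤ d / (2 * (M + h)) * (M + h) := by
            gcongr; exact min_le_right _ _
        _ = d / 2 := by field_simp
        _ < d := by linarith
  set g : R3 → R3 := fun x => x + s • (o - x) with hg
  have hgc : Continuous g := by fun_prop
  have hgx : ∀ x ∈ K, ‖g x - x‖ ≤ s * M := fun x hx => by
    simp only [hg, add_sub_cancel_left, norm_smul, Real.norm_eq_abs, abs_of_pos hs0]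
    exact mul_le_mul_of_nonneg_left (hMK x hx) hs0.le
  have hgin : ∀ x ∈ K, infDist (g x) A ≤ (1 - s) * h := fun x hx => by
    obtain ⟨a, ha, hax⟩ := H.isCompact.exists_infDist_eq_dist H.nonempty x
    have hmem : (1 - s) • a + s • o ∈ A :=
      H.convex ha ho (by linarith) hs0.le (by ring)
    refine (infDist_le_dist_of_mem hmem).trans ?_
    rw [dist_eq_norm, show g x - ((1 - s) • a + s • o) = (1 - s) • (x - a) by
      simp only [hg]; module, norm_smul, Real.norm_eq_abs, abs_of_pos (by linarith), ← dist_eq_norm,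
      ← hax, hfr x hx]
  have hsh : 0 < s * h := mul_pos hs0 h0
  obtain ⟨S, hS, hζ⟩ := exists_nullCurve_near_connected (hK.image hgc)
    (hconn.image g hgc.continuousOn) hsh
  have hS' : ∀ z : ℂ, ‖z‖ ≤ 1 → ∃ x ∈ K, ‖S.surf z - g x‖ < s * h := fun z hz => by
    obtain ⟨_, ⟨x, hx, rfl⟩, hlt⟩ := mem_thickening_iff.1 (hS z hz)
    exact ⟨x, hx, by rwa [← dist_eq_norm]⟩
  refine ⟨S, fun z hz => ?_, fun z hz => ?_, fun z hz => ?_, fun x hx => ?_⟩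
  · obtain ⟨x, hx, hlt⟩ := hS' z hz
    rw [H.mem_iff]
    linarith [(abs_le.1 (abs_infDist_sub_infDist_le A (S.surf z) (g x))).2, hgin x hx]
  · obtain ⟨x, hx, hlt⟩ := hS' z hz
    linarith [(abs_le.1 (abs_infDist_sub_infDist_le A (S.surf z) (g x))).1,
      (abs_le.1 (abs_infDist_sub_infDist_le A (g x) x)).1, hgx x hx, hfr x hx]
  · obtain ⟨x, hx, hlt⟩ := hS' z hz
    refine ⟨x, hx, ?_⟩
    linarith [norm_sub_le_norm_sub_add_norm_sub (S.surf z) (g x) x, hgx x hx]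
  · obtain ⟨ζ, hζ1, hlt⟩ := hζ (g x) ⟨x, hx, rfl⟩
    refine ⟨ζ, hζ1, ?_⟩
    linarith [norm_sub_le_norm_sub_add_norm_sub (S.surf ζ) (g x) x, hgx x hx]

lemma exists_small_depth {h ε : ℝ} (h0 : 0 < h) (hε : 0 < ε) (q : ℝ) :
    ∃ d : ℝ, 0 < d ∧ d ≤ h / 2 ∧ d < ε / 8 ∧ √(h * d / 2) / q + 8 * (d / 6) < ε / 8 := by
  have hcont : Continuous fun d : ℝ => √(h * d / 2) / q + 8 * (d / 6) :=
    (((continuous_const.mul continuous_id).div_const 2).sqrt.div_const q).add (by fun_prop)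
  have h1 : ∀ᶠ d : ℝ in 𝓝[>] 0, √(h * d / 2) / q + 8 * (d / 6) < ε / 8 :=
    (hcont.tendsto 0).mono_left nhdsWithin_le_nhds |>.eventually
      (gt_mem_nhds (by simpa using hε))
  have h2 : ∀ᶠ d : ℝ in 𝓝[>] 0, d ∈ Ioo 0 (min (h / 2) (ε / 8)) :=
    Ioo_mem_nhdsGT (by positivity)
  obtain ⟨d, hd1, hd2⟩ := (h1.and h2).exists
  exact ⟨d, hd2.1, (hd2.2.trans_le (min_le_left _ _)).le, hd2.2.trans_le (min_le_right _ _), hd1⟩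

end Main

/-- **Theorem B.** For a regular strictly convex bounded domain `C ⊆ ℝ³`, a nonempty
connected compact set `K ⊆ ∂C` and `ε > 0`, there is a complete proper conformal minimal
immersion `ψ : 𝔻 → C` whose limit set is a nonempty compact set at Hausdorff distance
`< ε` from `K`. -/
theorem statement1 (C : Set R3) (hC : RegStrictConvexDomain C)
    (K : Set R3) (hKne : K.Nonempty) (hKconn : IsConnected K) (hKcomp : IsCompact K)
    (hKC : K ⊆ frontier C)
    (ε : ℝ) (hε : 0 < ε) :
    ∃ ψ : ℂ → R3,
      ConfMinImmOn ψ (ball (0:ℂ) 1) ∧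
      CompleteOn ψ (ball (0:ℂ) 1) ∧
      MapsTo ψ (ball (0:ℂ) 1) C ∧
      ProperIn ψ (ball (0:ℂ) 1) C ∧
      (limitSet ψ).Nonempty ∧
      IsCompact (limitSet ψ) ∧
      hausdorffDist (limitSet ψ) K < ε := by
  obtain ⟨A, h, σ, H⟩ := hC.exists_isCore
  have h0 := H.h_pos
  have hσ := H.σ_nonneg
  obtain ⟨-, hCo, -, hCb, -⟩ := hC
  set q := 1 - √(1 - h / (8 * (σ + h))) with hq
  obtain ⟨d, hd0, hdh, hdε, hdq⟩ : ∃ d : ℝ, 0 < d ∧ d ≤ h / 2 ∧ d < ε / 8 ∧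
      √(h * d / 2) / q + 8 * (d / 6) < ε / 8 :=
    exists_small_depth h0 hε q
  obtain ⟨S, hSC, hSd, hSK, hKS⟩ := H.exists_initial hCo hKconn hKcomp hKC hd0
  obtain ⟨t, ht, htd, ht1, ht2⟩ := H.exists_tolerance S hSC (τ := d / 6) (by positivity)
  have hL : Level.Admissible A h ⟨S, 0, t, d⟩ :=
    ⟨le_rfl, one_pos, ht, hdh, by dsimp only; linarith, ht1, fun z _ hz => hSd z hz, ht2⟩
  obtain ⟨ψ, hψ, hcomplete, hmaps, hbd, hclose⟩ := H.exists_complete_proper hL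
  have hcont := hψ.1.continuousOn
  have hδ : ∀ z ∈ ball (0 : ℂ) 1, ‖ψ z - S.surf z‖ ≤ ε / 8 := fun z hz => by
    have := hclose z hz
    dsimp only at this
    rw [← hq] at this
    linarith
  have hlim := fun ζ hζ =>
    H.exists_mem_limitSet hCb hcont hmaps hbd S.continuous_surf hδ (ζ := ζ) hζ
  refine ⟨ψ, hψ, hcomplete, hmaps, H.properIn hcont hbd, ?_, ?_, ?_⟩
  · obtain ⟨y, hy, -⟩ := hlim 1 (by simp)
    exact ⟨y, hy⟩
  · rw [H.limitSet_eq hcont hmaps hbd]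
    exact ((hCb.subset hmaps.image_subset).isCompact_closure).inter_right
      (isClosed_le continuous_const (continuous_infDist_pt A))
  · refine (hausdorffDist_le_of_mem_dist (r := ε / 2) (by positivity) (fun y hy => ?_)
      fun x hx => ?_).trans_lt (by linarith)
    · obtain ⟨_, ⟨z, hz, rfl⟩, hyz⟩ := Metric.mem_closure_iff.1 hy.1 (ε / 8) (by positivity)
      obtain ⟨x, hx, hzx⟩ := hSK z (mem_ball_zero_iff.1 hz).le
      refine ⟨x, hx, ?_⟩
      rw [dist_eq_norm] at hyz ⊢
      linarith [norm_sub_le_norm_sub_add_norm_sub y (ψ z) x, hδ z hz,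
        norm_sub_le_norm_sub_add_norm_sub (ψ z) (S.surf z) x]
    · obtain ⟨ζ, hζ, hζx⟩ := hKS x hx
      obtain ⟨y, hy, hyζ⟩ := hlim ζ hζ
      refine ⟨y, hy, ?_⟩
      rw [dist_comm, dist_eq_norm]
      linarith [norm_sub_le_norm_sub_add_norm_sub y (S.surf ζ) x]
end
end

section
/- Let γ : 𝕊¹ → ℝ³ be an injective C^∞ map with nowhere-vanishing derivative and image Γ, and let ρ > 0. Assume there exists a homeomorphism Φ from 𝕊¹ × B onto the open tube T(Γ, ρ), where B is the open unit disk in ℝ², such that Φ(θ, 0) = γ(θ) for all θ ∈ 𝕊¹ and Φ({θ} × B) ⊆ {x ∈ ℝ³ : ‖x − γ(θ)‖ < ρ} for all θ ∈ 𝕊¹. If σ : 𝕊¹ → T(Γ, ρ) is a continuous loop that is freely homotopic to γ within T(Γ, ρ), then for every x ∈ Γ the image of σ meets the open ball of radius ρ centered at x; in particular sup_{x ∈ Γ} dist(x, σ(𝕊¹)) ≤ ρ. -/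
open Set Metric Function

noncomputable section

/-- A free loop in the circle which is homotopic to the standard degree one loop is surjective. -/
theorem Circle.surjective_of_homotopy_exp (h : C(ℝ × ℝ, Circle))
    (hper : ∀ t s, h (t + 1, s) = h (t, s))
    (hexp : ∀ t, h (t, 1) = Circle.exp (2 * Real.pi * t)) :
    Surjective fun t => h (t, 0) := by
  intro c
  obtain ⟨e₀, he₀⟩ := Circle.isAddQuotientCoveringMap_exp.surjective (h (0, 0))
  obtain ⟨g, ⟨-, hg⟩, -⟩ :=
    Circle.isCoveringMap_exp.existsUnique_continuousMap_lifts h (0, 0) e₀ he₀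
  replace hg : ∀ p, Circle.exp (g p) = h p := congrFun hg
  have hconst := Circle.isCoveringMap_exp.const_of_comp
    (g := fun p : ℝ × ℝ => g (p.1 + 1, p.2) - g p) (by fun_prop)
    (fun _ _ => by simp [hg, hper])
  have hone := Circle.isCoveringMap_exp.const_of_comp
    (g := fun t : ℝ => g (t, 1) - 2 * Real.pi * t) (by fun_prop)
    (fun _ _ => by simp [hg, hexp])
  have hstep : g (1, 0) = g (0, 0) + 2 * Real.pi := by
    have h₁ := hconst (0, 0) (0, 1)
    have h₂ := hone 1 0
    norm_num at h₁ h₂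
    linarith
  obtain ⟨a, rfl⟩ := Circle.isAddQuotientCoveringMap_exp.surjective c
  have hmem := toIcoMod_mem_Ico Real.two_pi_pos (g (0, 0)) a
  obtain ⟨t, -, ht⟩ := intermediate_value_Icc (zero_le_one' ℝ)
    (f := fun t => g (t, 0)) (by fun_prop)
    (show toIcoMod Real.two_pi_pos (g (0, 0)) a ∈ Icc (g (0, 0)) (g (1, 0)) from
      ⟨hmem.1, by rw [hstep]; exact hmem.2.le⟩)
  refine ⟨t, ?_⟩
  dsimp only at ht ⊢
  rw [← hg, ht, toIcoMod, Circle.periodic_exp.sub_zsmul_eq]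

/-- **Solid-torus homology/homotopy fact.** If the tube `T(Γ, ρ)` around a smooth Jordan
curve `Γ = range γ` is parametrized as a solid torus with core `γ` and radial fibers inside
the balls `B(γ(θ), ρ)`, then any loop freely homotopic to `γ` within `T(Γ, ρ)` meets the
ball `B(x, ρ)` for every `x ∈ Γ`; in particular `dist (x, σ(𝕊¹)) ≤ ρ` for all `x ∈ Γ`. -/
theorem statement11 (γ : ℝ → R3) (hγ : SmoothJordan γ) (ρ : ℝ) (hρ : 0 < ρ)
    (Φ : (Circle × ↥(ball ((0:ℝ×ℝ)) 1)) ≃ₜ ↥(thickening ρ (range γ)))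
    (hΦcore : ∀ t : ℝ,
      (Φ (Circle.exp (2 * Real.pi * t), ⟨0, mem_ball_self one_pos⟩) : R3) = γ t)
    (hΦfiber : ∀ (t : ℝ) (b : ↥(ball ((0:ℝ×ℝ)) 1)),
      (Φ (Circle.exp (2 * Real.pi * t), b) : R3) ∈ ball (γ t) ρ)
    (σ : ℝ → R3) (hσcont : Continuous σ) (hσper : Periodic σ 1)
    (hσT : range σ ⊆ thickening ρ (range γ))
    (hhom : HomotopicLoopsIn (thickening ρ (range γ)) σ γ) :
    (∀ x ∈ range γ, ∃ t : ℝ, σ t ∈ ball x ρ) ∧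
    (∀ x ∈ range γ, infDist x (range σ) ≤ ρ) := by
  have hball : ∀ x ∈ range γ, ∃ t : ℝ, σ t ∈ ball x ρ := by
    rintro _ ⟨τ, rfl⟩
    obtain ⟨H, hH, hH₀, hH₁, hHper, hHT⟩ := hhom
    let K : ℝ × ℝ → thickening ρ (range γ) := fun p =>
      ⟨H (p.1, projIcc 0 1 zero_le_one p.2), hHT _ _ (Subtype.prop _)⟩
    have hK : Continuous K := by
      refine Continuous.subtype_mk (hH.comp (continuous_fst.prodMk ?_)) _
      exact continuous_subtype_val.comp (continuous_projIcc.comp continuous_snd)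
    have hK₀ : ∀ t, (K (t, 0) : R3) = σ t := fun t => by simp [K, hH₀]
    have hK₁ : ∀ t, (K (t, 1) : R3) = γ t := fun t => by simp [K, hH₁]
    obtain ⟨t, ht⟩ := Circle.surjective_of_homotopy_exp
      ⟨fun p => (Φ.symm (K p)).1, by fun_prop⟩ (fun t s => by simp [K, hHper])
      (fun t => by
        have : K (t, 1) = Φ (Circle.exp (2 * Real.pi * t), ⟨0, mem_ball_self one_pos⟩) :=
          Subtype.ext ((hK₁ t).trans (hΦcore t).symm)
        simp [this])
      (Circle.exp (2 * Real.pi * τ))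
    have hfib := hΦfiber τ (Φ.symm (K (t, 0))).2
    rw [← ht] at hfib
    exact ⟨t, by simpa [hK₀] using hfib⟩
  refine ⟨hball, fun x hx => ?_⟩
  obtain ⟨t, ht⟩ := hball x hx
  exact (infDist_le_dist_of_mem (mem_range_self t)).trans (mem_ball'.1 ht).le
end
end
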